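/- arXiv:1609.03597 — 2 statements merged into one kernel-verified Lean document; each statement's English description precedes it below -/
import Mathlib

section
/- Any two hyperelliptic involutions in Out(F_n) are conjugate. -/
/-- Inner automorphisms form a normal subgroup of the automorphism group. -/
instance innNormal (G : Type) [Group G] : ((MulAut.conj : G →* MulAut G).range).Normal := by
  constructor
  rintro - ⟨g, rfl⟩ φ
  refine ⟨φ g, ?_⟩
  ext x
  simp [mul_assoc]

/-- The outer automorphism group of a group `G`: automorphisms modulo inner ones. -/
def OutG (G : Type) [Group G] :=
  MulAut G ⧸ (MulAut.conj : G →* MulAut G).range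

instance (G : Type) [Group G] : Group (OutG G) := by
  unfold OutG; infer_instance

/-- The projection `Aut(G) → Out(G)`. -/
def toOut (G : Type) [Group G] : MulAut G →* OutG G :=
  QuotientGroup.mk' _

/-- The endomorphism of the abelianization `H₁(G)` induced by an automorphism of `G`. -/
def abMap {G : Type} [Group G] (θ : MulAut G) :
    Abelianization G →* Abelianization G :=
  Abelianization.lift (Abelianization.of.comp θ.toMonoidHom)


section Cuts

/-- Edge boundary of a set. -/
def bdr {V : Type} (R : V → V → Prop) (A : Set V) : Set (V × V) :=
  {p | p.1 ∈ A ∧ p.2 ∉ A ∧ R p.1 p.2}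

/-- Connectedness of a vertex set. -/
def Cn {V : Type} (R : V → V → Prop) (A : Set V) : Prop :=
  ∀ B ⊆ A, B.Nonempty → (∀ x ∈ B, ∀ y ∈ A, R x y → y ∈ B) → B = A

/-- Nested sets. -/
def Nst {V : Type} (A B : Set V) : Prop :=
  A ⊆ B ∨ A ⊆ Bᶜ ∨ Aᶜ ⊆ B ∨ Aᶜ ⊆ Bᶜ

theorem Nst.symm {V : Type} {A B : Set V} (h : Nst A B) : Nst B A := by
  rcases h with h | h | h | h
  · exact .inr (.inr (.inr (Set.compl_subset_compl.2 h)))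
  · exact .inr (.inl (Set.subset_compl_comm.1 h))
  · exact .inr (.inr (.inl (Set.compl_subset_comm.1 h)))
  · exact .inl (Set.compl_subset_compl.1 h)

theorem Nst.compl_right {V : Type} {A B : Set V} (h : Nst A B) : Nst A Bᶜ := by
  unfold Nst at *
  rw [compl_compl]
  tauto

theorem nst_compl_right {V : Type} {A B : Set V} : Nst A Bᶜ ↔ Nst A B :=
  ⟨fun h => by simpa using h.compl_right, Nst.compl_right⟩

/-- Tight cuts of bounded size. -/
def Tg {V : Type} (R : V → V → Prop) (K : ℕ) (A : Set V) : Prop :=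
  (bdr R A).Finite ∧ (bdr R A).ncard ≤ K ∧ Cn R A ∧ Cn R Aᶜ

theorem bdr_compl {V : Type} {R : V → V → Prop} (hR : Symmetric R) (A : Set V) :
    bdr R Aᶜ = Prod.swap '' bdr R A := by
  ext ⟨x, y⟩
  simp only [bdr, Set.mem_setOf_eq, Set.mem_image, Prod.exists, Prod.swap_prod_mk, Prod.mk.injEq,
    Set.mem_compl_iff, not_not]
  constructor
  · rintro ⟨h1, h2, h3⟩
    exact ⟨y, x, ⟨h2, h1, hR h3⟩, rfl, rfl⟩
  · rintro ⟨a, b, ⟨h1, h2, h3⟩, rfl, rfl⟩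
    exact ⟨h2, h1, hR h3⟩

theorem bdr_compl_fin {V : Type} {R : V → V → Prop} (hR : Symmetric R) {A : Set V}
    (h : (bdr R A).Finite) : (bdr R Aᶜ).Finite := by
  rw [bdr_compl hR]; exact h.image _

theorem bdr_compl_ncard {V : Type} {R : V → V → Prop} (hR : Symmetric R) (A : Set V) :
    (bdr R Aᶜ).ncard = (bdr R A).ncard := by
  rw [bdr_compl hR]; exact Set.ncard_image_of_injective _ Prod.swap_injective

theorem tight_finite {V : Type} (K : ℕ) : ∀ (R : V → V → Prop), Symmetric R → ∀ x y : V,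
    {A : Set V | x ∈ A ∧ y ∉ A ∧ Tg R K A}.Finite := by
  induction K with
  | zero =>
    intro R hR x y
    apply Set.Subsingleton.finite
    -- the set must be the connected component of `x`
    have key : ∀ A ∈ {A : Set V | x ∈ A ∧ y ∉ A ∧ Tg R 0 A},
        A = {z | Relation.ReflTransGen R x z} := by
      rintro A ⟨hx, hy, hf, hc, h1, h2⟩
      have he : bdr R A = ∅ := by
        rw [← Set.ncard_eq_zero hf]; omega
      have hcl : ∀ u ∈ A, ∀ v, R u v → v ∈ A := by
        intro u hu v hv
        by_contra hvA
        have : (u, v) ∈ bdr R A := ⟨hu, hvA, hv⟩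
        rw [he] at this; exact this
      apply Set.Subset.antisymm
      · have := h1 (A ∩ {z | Relation.ReflTransGen R x z}) Set.inter_subset_left
          ⟨x, hx, Relation.ReflTransGen.refl⟩ (fun u hu v hv huv => ⟨hv, hu.2.tail huv⟩)
        rw [← this]; exact Set.inter_subset_right
      · intro z hz
        induction hz with
        | refl => exact hx
        | tail _ h ih => exact hcl _ ih _ h
    intro A hA B hB
    rw [key A hA, key B hB]
  | succ K ih =>
    intro R hR x y
    -- one edge
    have edge : ∀ u v, R u v → {A : Set V | u ∈ A ∧ v ∉ A ∧ Tg R (K+1) A}.Finite := by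
      intro u v huv
      let R' : V → V → Prop := fun a b => R a b ∧ ¬ (a = u ∧ b = v) ∧ ¬ (a = v ∧ b = u)
      have hR' : Symmetric R' := fun a b h => ⟨hR h.1, fun h' => h.2.2 ⟨h'.2, h'.1⟩,
        fun h' => h.2.1 ⟨h'.2, h'.1⟩⟩
      refine (ih R' hR' u v).subset ?_
      rintro A ⟨hu, hv, hf, hc, h1, h2⟩
      have hsub : bdr R' A ⊆ bdr R A := fun p hp => ⟨hp.1, hp.2.1, hp.2.2.1⟩
      have hlt : bdr R' A ⊂ bdr R A := by
        refine ⟨hsub, fun h => ?_⟩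
        have : (u, v) ∈ bdr R' A := h ⟨hu, hv, huv⟩
        exact this.2.2.2.1 ⟨rfl, rfl⟩
      refine ⟨hu, hv, hf.subset hsub, ?_, ?_, ?_⟩
      · have := Set.ncard_lt_ncard hlt hf
        omega
      · intro B hB hne hcl
        refine h1 B hB hne fun a ha b hb hab => hcl a ha b hb ⟨hab, ?_, ?_⟩
        · rintro ⟨rfl, rfl⟩; exact hv hb
        · rintro ⟨rfl, rfl⟩; exact hv (hB ha)
      · intro B hB hne hcl
        refine h2 B hB hne fun a ha b hb hab => hcl a ha b hb ⟨hab, ?_, ?_⟩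
        · rintro ⟨rfl, rfl⟩; exact hB ha hu
        · rintro ⟨rfl, rfl⟩; exact hb hu
    by_cases hxy : Relation.ReflTransGen R x y
    · induction hxy with
      | refl => 
        convert Set.finite_empty
        ext A; simp only [Set.mem_setOf_eq, Set.mem_empty_iff_false, iff_false]
        exact fun h => h.2.1 h.1
      | @tail b c _ h ih2 =>
        refine (ih2.union (edge b c h)).subset ?_
        rintro A ⟨h1, h2, h3⟩
        by_cases hb : b ∈ A
        · exact .inr ⟨hb, h2, h3⟩
        · exact .inl ⟨h1, hb, h3⟩
    · apply Set.Subsingleton.finite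
      have key : ∀ A ∈ {A : Set V | x ∈ A ∧ y ∉ A ∧ Tg R (K+1) A},
          A = {z | Relation.ReflTransGen R x z} := by
        rintro A ⟨hx, hy, hf, hc, h1, h2⟩
        apply Set.Subset.antisymm
        · have := h1 (A ∩ {z | Relation.ReflTransGen R x z}) Set.inter_subset_left
            ⟨x, hx, Relation.ReflTransGen.refl⟩ (fun u hu v hv huv => ⟨hv, hu.2.tail huv⟩)
          rw [← this]; exact Set.inter_subset_right
        · have := h2 (Aᶜ ∩ {z | ¬ Relation.ReflTransGen R x z}) Set.inter_subset_left
            ⟨y, hy, hxy⟩ (fun u hu v hv huv => ⟨hv, fun h => hu.2 (h.tail (hR huv))⟩)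
          intro z hz
          by_contra hzA
          have hz' : z ∈ Aᶜ := hzA
          rw [← this] at hz'
          exact hz'.2 hz
      intro A hA B hB
      rw [key A hA, key B hB]

/-- Tight cuts crossing `A`. -/
def crs {V : Type} (R : V → V → Prop) (K : ℕ) (A : Set V) : Set (Set V) :=
  {D | Tg R K D ∧ ¬ Nst D A}

theorem crs_compl {V : Type} (R : V → V → Prop) (K : ℕ) (A : Set V) :
    crs R K Aᶜ = crs R K A := by
  ext D; simp only [crs, Set.mem_setOf_eq, nst_compl_right]

theorem cn_edge {V : Type} {R : V → V → Prop} {D A : Set V} (hD : Cn R D)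
    (h1 : ¬ D ⊆ A) (h2 : ¬ D ⊆ Aᶜ) : ∃ p ∈ bdr R A, p.1 ∈ D := by
  by_contra hcon
  push Not at hcon
  apply h1
  have := hD (D ∩ A) Set.inter_subset_left ?_ ?_
  · rw [← this]; exact Set.inter_subset_right
  · rw [Set.not_subset] at h2
    obtain ⟨a, ha, ha'⟩ := h2
    exact ⟨a, ha, not_not.1 ha'⟩
  · intro x hx y hy hxy
    refine ⟨hy, ?_⟩
    by_contra hyA
    exact hcon (x, y) ⟨hx.2, hyA, hxy⟩ hx.1

theorem crs_finite {V : Type} {R : V → V → Prop} (hR : Symmetric R) (K : ℕ) {A : Set V}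
    (hA : (bdr R A).Finite) : (crs R K A).Finite := by
  have : (⋃ p ∈ bdr R A, ⋃ q ∈ bdr R A,
      {D : Set V | p.1 ∈ D ∧ q.1 ∉ D ∧ Tg R K D}).Finite :=
    hA.biUnion fun p _ => hA.biUnion fun q _ => tight_finite K R hR _ _
  refine this.subset ?_
  rintro D ⟨hD, hn⟩
  simp only [Nst, not_or] at hn
  obtain ⟨p, hp, hpD⟩ := cn_edge hD.2.2.1 hn.1 hn.2.1
  obtain ⟨q, hq, hqD⟩ := cn_edge hD.2.2.2 hn.2.2.1 hn.2.2.2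
  simp only [Set.mem_iUnion]
  exact ⟨p, hp, q, hq, hpD, hqD, hD⟩

theorem nst_inter {V : Type} {A B D : Set V} (hn : ¬ Nst A B) (ha : Nst D A) (hb : Nst D B) :
    Nst D (A ∩ B) := by
  rcases ha with ha | ha | ha | ha
  · rcases hb with hb | hb | hb | hb
    · exact .inl (Set.subset_inter ha hb)
    · exact .inr (.inl fun x hx h => hb hx h.2)
    · exact absurd (.inr (.inr (.inl fun x hx => hb fun h => hx (ha h)))) hn
    · exact absurd (Or.inr (.inr (.inr fun x hx hB => hb (fun h => hx (ha h)) hB))) hn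
  · exact .inr (.inl fun x hx h => ha hx h.1)
  · rcases hb with hb | hb | hb | hb
    · exact absurd (.inr (.inr (.inl fun x hx => hb (by_contra fun h => hx (ha h))))) hn
    · exact .inr (.inl fun x hx h => hb hx h.2)
    · exact .inr (.inr (.inl (Set.subset_inter ha hb)))
    · exact .inr (.inr (.inr fun x hx h => hb hx h.2))
  · exact .inr (.inr (.inr fun x hx h => ha hx h.1))

theorem nst_union {V : Type} {A B D : Set V} (hn : ¬ Nst A B) (ha : Nst D A) (hb : Nst D B) :
    Nst D (A ∪ B) := by
  rw [← nst_compl_right, Set.compl_union]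
  refine nst_inter (fun h => hn ?_) ha.compl_right hb.compl_right
  exact (nst_compl_right.1 (nst_compl_right.1 h).symm).symm

theorem nst_or {V : Type} {A B D : Set V} (ha : Nst D A) : Nst D (A ∩ B) ∨ Nst D (A ∪ B) := by
  rcases ha with ha | ha | ha | ha
  · exact .inr (.inl fun x hx => .inl (ha hx))
  · exact .inl (.inr (.inl fun x hx h => ha hx h.1))
  · exact .inr (.inr (.inr (.inl fun x hx => .inl (ha hx))))
  · exact .inl (.inr (.inr (.inr fun x hx h => ha hx h.1)))

theorem crs_corner {V : Type} {R : V → V → Prop} (hR : Symmetric R) (K : ℕ) {A B : Set V}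
    (hA : (bdr R A).Finite) (hB : (bdr R B).Finite) (tA : Tg R K A) (hn : ¬ Nst A B) :
    (crs R K (A ∩ B)).ncard + (crs R K (A ∪ B)).ncard <
      (crs R K A).ncard + (crs R K B).ncard := by
  have fA := crs_finite hR K hA
  have fB := crs_finite hR K hB
  have s1 : crs R K (A ∩ B) ∪ crs R K (A ∪ B) ⊂ crs R K A ∪ crs R K B := by
    refine ⟨?_, fun h => ?_⟩
    · rintro D (⟨h1, h2⟩ | ⟨h1, h2⟩)
      · by_contra hcon
        simp only [crs, Set.mem_union, Set.mem_setOf_eq, not_or, not_and, not_not] at hcon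
        have ha := hcon.1 h1
        have hb := hcon.2 h1
        apply h2
        exact nst_inter hn ha hb
      · by_contra hcon
        simp only [crs, Set.mem_union, Set.mem_setOf_eq, not_or, not_and, not_not] at hcon
        have ha := hcon.1 h1
        have hb := hcon.2 h1
        apply h2
        exact nst_union hn ha hb
    · have : A ∈ crs R K (A ∩ B) ∪ crs R K (A ∪ B) := h (.inr ⟨tA, hn⟩)
      rcases this with ⟨_, h⟩ | ⟨_, h⟩
      · exact h (.inr (.inr (.inr (by simp))))
      · exact h (.inl (by simp))
  have s2 : crs R K (A ∩ B) ∩ crs R K (A ∪ B) ⊆ crs R K A ∩ crs R K B := by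
    rintro D ⟨⟨h1, h2⟩, -, h3⟩
    refine ⟨⟨h1, fun h => ?_⟩, ⟨h1, fun h => ?_⟩⟩
    · exact (nst_or h).elim h2 h3
    · rcases nst_or (B := A) h with h | h
      · exact h2 (by rwa [Set.inter_comm])
      · exact h3 (by rwa [Set.union_comm])
  have fU := fA.union fB
  have f12 := fU.subset s1.1
  have e1 := Set.ncard_union_add_ncard_inter (crs R K (A ∩ B)) (crs R K (A ∪ B))
    (f12.subset Set.subset_union_left) (f12.subset Set.subset_union_right)
  have e2 := Set.ncard_union_add_ncard_inter (crs R K A) (crs R K B) fA fB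
  have l1 := Set.ncard_lt_ncard s1 fU
  have l2 := Set.ncard_le_ncard s2 (fA.subset Set.inter_subset_left)
  omega

theorem bdr_corner_sub {V : Type} (R : V → V → Prop) (A B : Set V) :
    bdr R (A ∩ B) ∪ bdr R (A ∪ B) ⊆ bdr R A ∪ bdr R B ∧
    bdr R (A ∩ B) ∩ bdr R (A ∪ B) ⊆ bdr R A ∩ bdr R B := by
  constructor
  · rintro ⟨x, y⟩ h
    simp only [bdr, Set.mem_union, Set.mem_inter_iff, Set.mem_setOf_eq] at *
    tauto
  · rintro ⟨x, y⟩ h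
    simp only [bdr, Set.mem_union, Set.mem_inter_iff, Set.mem_setOf_eq] at *
    tauto

theorem bdr_corner {V : Type} {R : V → V → Prop} {A B : Set V}
    (hA : (bdr R A).Finite) (hB : (bdr R B).Finite) :
    (bdr R (A ∩ B)).Finite ∧ (bdr R (A ∪ B)).Finite ∧
    (bdr R (A ∩ B)).ncard + (bdr R (A ∪ B)).ncard ≤ (bdr R A).ncard + (bdr R B).ncard := by
  obtain ⟨s1, s2⟩ := bdr_corner_sub R A B
  have fU := hA.union hB
  have f12 := fU.subset s1
  have f1 := f12.subset Set.subset_union_left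
  have f2 := f12.subset Set.subset_union_right
  refine ⟨f1, f2, ?_⟩
  have e1 := Set.ncard_union_add_ncard_inter _ _ f1 f2
  have e2 := Set.ncard_union_add_ncard_inter _ _ hA hB
  have l1 := Set.ncard_le_ncard s1 fU
  have l2 := Set.ncard_le_ncard s2 (hA.subset Set.inter_subset_left)
  omega

/-- `A` separates a pair of ultrafilters. -/
def Sp {V : Type} (p : Ultrafilter V × Ultrafilter V) (A : Set V) : Prop :=
  ¬ (A ∈ p.1 ↔ A ∈ p.2)

theorem sp_compl {V : Type} {p : Ultrafilter V × Ultrafilter V} {A : Set V} :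
    Sp p Aᶜ ↔ Sp p A := by
  simp only [Sp, Ultrafilter.compl_mem_iff_notMem]; tauto

/-- Minimal cuts. -/
def Mn {V : Type} (R : V → V → Prop) (p : Ultrafilter V × Ultrafilter V) (A : Set V) : Prop :=
  (bdr R A).Finite ∧ Sp p A ∧ ∀ B, (bdr R B).Finite → Sp p B → (bdr R A).ncard ≤ (bdr R B).ncard

/-- Optimal cuts. -/
def Op {V : Type} (R : V → V → Prop) (K : ℕ) (p : Ultrafilter V × Ultrafilter V) (A : Set V) :
    Prop :=
  Mn R p A ∧ ∀ B, Mn R p B → (crs R K A).ncard ≤ (crs R K B).ncard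

theorem Mn.compl {V : Type} {R : V → V → Prop} (hR : Symmetric R)
    {p : Ultrafilter V × Ultrafilter V} {A : Set V} (h : Mn R p A) : Mn R p Aᶜ :=
  ⟨bdr_compl_fin hR h.1, sp_compl.2 h.2.1, by rw [bdr_compl_ncard hR]; exact h.2.2⟩

theorem Op.compl {V : Type} {R : V → V → Prop} (hR : Symmetric R) {K : ℕ}
    {p : Ultrafilter V × Ultrafilter V} {A : Set V} (h : Op R K p A) : Op R K p Aᶜ :=
  ⟨h.1.compl hR, by rw [crs_compl]; exact h.2⟩

theorem Mn.cn {V : Type} {R : V → V → Prop} (hR : Symmetric R) (hc : Cn R Set.univ)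
    {p : Ultrafilter V × Ultrafilter V} {A : Set V} (h : Mn R p A) : Cn R A := by
  obtain ⟨hf, hs, hm⟩ := h
  intro B hB hne hcl
  by_contra hBA
  have s1 : bdr R B ⊆ bdr R A := by
    rintro ⟨x, y⟩ ⟨h1, h2, h3⟩
    exact ⟨hB h1, fun h => h2 (hcl x h1 y h h3), h3⟩
  have s2 : bdr R (A \ B) ⊆ bdr R A := by
    rintro ⟨x, y⟩ ⟨h1, h2, h3⟩
    refine ⟨h1.1, fun h => h2 ⟨h, fun hb => ?_⟩, h3⟩
    exact h1.2 (hcl y hb x h1.1 (hR h3))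
  have hAu : A ≠ Set.univ := by
    rintro rfl
    exact hs ⟨fun _ => Filter.univ_mem, fun _ => Filter.univ_mem⟩
  have ne : ∀ C ⊆ A, C.Nonempty → (bdr R C).Nonempty := by
    intro C hC hn
    by_contra hcon
    rw [Set.not_nonempty_iff_eq_empty] at hcon
    have := hc C (Set.subset_univ _) hn (fun x hx y _ hxy => by
      by_contra hy
      have : (x, y) ∈ bdr R C := ⟨hx, hy, hxy⟩
      rw [hcon] at this; exact this)
    rw [this] at hC
    exact hAu (Set.univ_subset_iff.1 hC)
  have hne2 : (A \ B).Nonempty := by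
    rw [Set.nonempty_iff_ne_empty, Ne, Set.sdiff_eq_empty]
    exact fun h => hBA (hB.antisymm h)
  have hdis : Disjoint (bdr R B) (bdr R (A \ B)) := by
    rw [Set.disjoint_left]
    rintro ⟨x, y⟩ h1 h2
    exact h2.1.2 h1.1
  have f1 := hf.subset s1
  have f2 := hf.subset s2
  have e1 := Set.ncard_union_eq hdis f1 f2
  have l := Set.ncard_le_ncard (Set.union_subset s1 s2) hf
  have p1 := (Set.ncard_pos f1).2 (ne B hB hne)
  have p2 := (Set.ncard_pos f2).2 (ne (A \ B) Set.sdiff_subset hne2)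
  have hAeq : A = B ∪ (A \ B) := (Set.union_sdiff_cancel hB).symm
  by_cases hsB : Sp p B
  · have := hm B f1 hsB
    omega
  · have : Sp p (A \ B) := by
      by_contra hs2
      apply hs
      rw [hAeq, Ultrafilter.union_mem_iff, Ultrafilter.union_mem_iff]
      simp only [Sp, not_not] at hsB hs2
      rw [hsB, hs2]
    have := hm _ f2 this
    omega

theorem Mn.tg {V : Type} {R : V → V → Prop} (hR : Symmetric R) (hc : Cn R Set.univ) {K : ℕ}
    {p : Ultrafilter V × Ultrafilter V} {A : Set V} (h : Mn R p A) (hK : (bdr R A).ncard ≤ K) :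
    Tg R K A :=
  ⟨h.1, hK, h.cn hR hc, (h.compl hR).cn hR hc⟩

theorem op_corner1 {V : Type} {R : V → V → Prop} (hR : Symmetric R) (hc : Cn R Set.univ) {K : ℕ}
    {p q : Ultrafilter V × Ultrafilter V} {A B : Set V} (hA : Op R K p A) (hB : Op R K q B)
    (kA : (bdr R A).ncard ≤ K) (hn : ¬ Nst A B) :
    ¬ (Sp p (A ∩ B) ∧ Sp q (A ∪ B)) ∧ ¬ (Sp q (A ∩ B) ∧ Sp p (A ∪ B)) := by
  obtain ⟨f1, f2, l⟩ := bdr_corner hA.1.1 hB.1.1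
  have cc := crs_corner hR K hA.1.1 hB.1.1 (hA.1.tg hR hc kA) hn
  constructor
  · rintro ⟨h1, h2⟩
    have l1 := hA.1.2.2 _ f1 h1
    have l2 := hB.1.2.2 _ f2 h2
    have m1 : Mn R p (A ∩ B) := ⟨f1, h1, fun C hC hs => by
      have := hA.1.2.2 C hC hs
      omega⟩
    have m2 : Mn R q (A ∪ B) := ⟨f2, h2, fun C hC hs => by
      have := hB.1.2.2 C hC hs
      omega⟩
    have := hA.2 _ m1
    have := hB.2 _ m2
    omega
  · rintro ⟨h1, h2⟩
    have l1 := hA.1.2.2 _ f2 h2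
    have l2 := hB.1.2.2 _ f1 h1
    have m1 : Mn R p (A ∪ B) := ⟨f2, h2, fun C hC hs => by
      have := hA.1.2.2 C hC hs
      omega⟩
    have m2 : Mn R q (A ∩ B) := ⟨f1, h1, fun C hC hs => by
      have := hB.1.2.2 C hC hs
      omega⟩
    have := hA.2 _ m1
    have := hB.2 _ m2
    omega

theorem op_corner2 {V : Type} {R : V → V → Prop} (hR : Symmetric R) (hc : Cn R Set.univ) {K : ℕ}
    {p q : Ultrafilter V × Ultrafilter V} {A B : Set V} (hA : Op R K p A) (hB : Op R K q B)
    (kA : (bdr R A).ncard ≤ K) (hn : ¬ Nst A B)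
    (h1 : Sp p (A ∩ B)) (h2 : Sp p (A ∪ B)) (h4 : Sp q A) :
    (crs R K A).ncard < (crs R K B).ncard := by
  obtain ⟨f1, f2, l⟩ := bdr_corner hA.1.1 hB.1.1
  have cc := crs_corner hR K hA.1.1 hB.1.1 (hA.1.tg hR hc kA) hn
  have l1 := hA.1.2.2 _ f1 h1
  have l2 := hA.1.2.2 _ f2 h2
  have l3 := hB.1.2.2 _ hA.1.1 h4
  have m1 : Mn R p (A ∩ B) := ⟨f1, h1, fun C hC hs => by
    have := hA.1.2.2 C hC hs
    omega⟩
  have m2 : Mn R p (A ∪ B) := ⟨f2, h2, fun C hC hs => by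
    have := hA.1.2.2 C hC hs
    omega⟩
  have := hA.2 _ m1
  have := hA.2 _ m2
  omega

theorem op_nested {V : Type} {R : V → V → Prop} (hR : Symmetric R) (hc : Cn R Set.univ) {K : ℕ}
    {p q : Ultrafilter V × Ultrafilter V} {A B : Set V} (hA : Op R K p A) (hB : Op R K q B)
    (kA : (bdr R A).ncard ≤ K) (kB : (bdr R B).ncard ≤ K) : Nst A B := by
  by_contra hn
  have hn' : ¬ Nst A Bᶜ := by rwa [nst_compl_right]
  have hB' := hB.compl hR
  have hn2 : ¬ Nst B A := fun h => hn h.symm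
  have hn2' : ¬ Nst B Aᶜ := by rwa [nst_compl_right]
  have a1 := op_corner1 hR hc hA hB kA hn
  have a2 := op_corner1 hR hc hA hB' kA hn'
  have b1 := op_corner2 hR hc hA hB kA hn
  have b2 := op_corner2 hR hc hB hA kB hn2
  have b3 := op_corner2 hR hc hA hB' kA hn'
  have b4 := op_corner2 hR hc hB (hA.compl hR) kB hn2'
  rw [crs_compl] at b3 b4
  have sA := hA.1.2.1
  have sB := hB.1.2.1
  have b12 : ∀ (P Q : Prop), (P → (crs R K A).ncard < (crs R K B).ncard) →
    (Q → (crs R K B).ncard < (crs R K A).ncard) → ¬ (P ∧ Q) := fun P Q h1 h2 h =>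
      absurd (h1 h.1) (not_lt.2 (h2 h.2).le)
  have c1 := b12 (Sp p (A ∩ B) ∧ Sp p (A ∪ B) ∧ Sp q A)
    (Sp q (B ∩ Aᶜ) ∧ Sp q (B ∪ Aᶜ) ∧ Sp p B) (fun h => b1 h.1 h.2.1 h.2.2)
    (fun h => b4 h.1 h.2.1 h.2.2)
  have c2 := b12 (Sp p (A ∩ Bᶜ) ∧ Sp p (A ∪ Bᶜ) ∧ Sp q A)
    (Sp q (B ∩ A) ∧ Sp q (B ∪ A) ∧ Sp p B) (fun h => b3 h.1 h.2.1 h.2.2)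
    (fun h => b2 h.1 h.2.1 h.2.2)
  clear b1 b2 b3 b4 b12
  simp only [Sp, Filter.inter_mem_iff, Ultrafilter.union_mem_iff,
    Ultrafilter.compl_mem_iff_notMem, ← Ultrafilter.mem_coe] at *
  simp only [Sp, Filter.inter_mem_iff, Ultrafilter.union_mem_iff,
    Ultrafilter.compl_mem_iff_notMem, Ultrafilter.mem_coe] at *
  grind

end Cuts

section Trees

/-- Interface for a group action on a (subdivided) tree, encoded by half-spaces. -/
structure TreeAct (G W E : Type) [Group G] [MulAction G W] [MulAction G E] where
  side : W → Set E
  J : W → W → E → Prop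
  side_smul : ∀ (g : G) u B, g • B ∈ side (g • u) ↔ B ∈ side u
  J_smul : ∀ (g : G) {u v D}, J u v D → J (g • u) (g • v) (g • D)
  J_symm : ∀ {u v D}, J u v D → J v u D
  J_off : ∀ {u v D}, J u v D → ∀ B, B ≠ D → (B ∈ side u ↔ B ∈ side v)
  J_at : ∀ {u v D}, J u v D → (D ∈ side v ↔ D ∉ side u)
  fin : ∀ u u', {B | ¬ (B ∈ side u ↔ B ∈ side u')}.Finite
  step : ∀ u u', u ≠ u' → ∃ D v, J u v D ∧ (D ∈ side v ↔ D ∈ side u')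
  uniq : ∀ {u v D v' D'} u', J u v D → J u v' D' → (D ∈ side v ↔ D ∈ side u') →
    (D' ∈ side v' ↔ D' ∈ side u') → D = D'
  edge : ∀ {u v D u' v'}, J u v D → J u' v' D → (D ∈ side v ↔ D ∈ side v') → u = u' ∧ v = v'

namespace TreeAct

variable {G W E : Type} [Group G] [MulAction G W] [MulAction G E] (T : TreeAct G W E)

/-- Separating half-spaces. -/
def df (u u' : W) : Set E := {B | ¬ (B ∈ T.side u ↔ B ∈ T.side u')}

theorem df_finite (u u' : W) : (T.df u u').Finite := T.fin u u'

theorem df_self (u : W) : T.df u u = ∅ := by simp [df]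

theorem df_comm (u u' : W) : T.df u u' = T.df u' u := by
  ext B; simp only [df, Set.mem_setOf_eq]; tauto

theorem df_step {u v D u'} (h : T.J u v D) (ht : D ∈ T.side v ↔ D ∈ T.side u') :
    D ∈ T.df u u' ∧ T.df v u' = T.df u u' \ {D} := by
  have h1 := T.J_at h
  constructor
  · simp only [df, Set.mem_setOf_eq]; tauto
  · ext B
    simp only [df, Set.mem_setOf_eq, Set.mem_diff, Set.mem_singleton_iff]
    by_cases hB : B = D
    · subst hB; tauto
    · have := T.J_off h B hB; tauto

theorem df_step_lt {u v D u'} (h : T.J u v D) (ht : D ∈ T.side v ↔ D ∈ T.side u') :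
    (T.df v u').ncard < (T.df u u').ncard := by
  obtain ⟨h1, h2⟩ := T.df_step h ht
  rw [h2]
  exact Set.ncard_sdiff_singleton_lt_of_mem h1 (T.df_finite _ _)

theorem side_inj {u u' : W} (h : ∀ B, B ∈ T.side u ↔ B ∈ T.side u') : u = u' := by
  by_contra hne
  obtain ⟨D, v, hJ, ht⟩ := T.step u u' hne
  have := T.J_at hJ
  have := h D
  tauto

theorem conn (Z : Set W) {u : W} (hu : u ∈ Z)
    (hcl : ∀ a ∈ Z, ∀ b D, T.J a b D → b ∈ Z) (w : W) : w ∈ Z := by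
  generalize hk : (T.df u w).ncard = k
  induction k using Nat.strong_induction_on generalizing u with
  | _ k ih =>
    by_cases huw : u = w
    · exact huw ▸ hu
    · obtain ⟨D, v, hJ, ht⟩ := T.step u w huw
      have := T.df_step_lt hJ ht
      exact ih _ (hk ▸ this) (hcl u hu v D hJ) rfl

/-- Connected vertex sets. -/
def Con (Y : Set W) : Prop :=
  ∀ u ∈ Y, ∀ u' ∈ Y, u ≠ u' → ∃ D, ∃ v ∈ Y, T.J u v D ∧ (D ∈ T.side v ↔ D ∈ T.side u')

theorem edge_between {Y : Set W} (hY : T.Con Y) {u u' : W} (hu : u ∈ Y) (hu' : u' ∈ Y) {D : E}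
    (hD : D ∈ T.df u u') : ∃ a ∈ Y, ∃ b ∈ Y, T.J a b D ∧ (D ∈ T.side a ↔ D ∈ T.side u) ∧
      (D ∈ T.side b ↔ D ∈ T.side u') ∧ ∀ B, (B ∈ T.side u ↔ B ∈ T.side u') →
        (B ∈ T.side a ↔ B ∈ T.side u) ∧ (B ∈ T.side b ↔ B ∈ T.side u) := by
  generalize hk : (T.df u u').ncard = k
  induction k using Nat.strong_induction_on generalizing u with
  | _ k ih =>
    have hne : u ≠ u' := by
      rintro rfl
      rw [df_self] at hD; exact hD
    obtain ⟨D', v, hv, hJ, ht⟩ := hY u hu u' hu' hne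
    obtain ⟨h1, h2⟩ := T.df_step hJ ht
    have hoff : ∀ B, (B ∈ T.side u ↔ B ∈ T.side u') → (B ∈ T.side v ↔ B ∈ T.side u) := by
      intro B hB
      refine (T.J_off hJ B ?_).symm
      rintro rfl
      exact h1 hB
    by_cases hDD : D = D'
    · subst hDD
      exact ⟨u, hu, v, hv, hJ, Iff.rfl, ht, fun B hB => ⟨Iff.rfl, hoff B hB⟩⟩
    · obtain ⟨a, ha, b, hb, e1, e2, e3, e4⟩ := ih _ (hk ▸ T.df_step_lt hJ ht) hv
        (by rw [h2]; exact ⟨hD, hDD⟩) rfl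
      refine ⟨a, ha, b, hb, e1, e2.trans (T.J_off hJ D hDD).symm, e3, fun B hB => ?_⟩
      have := hoff B hB
      have := e4 B (this.trans hB)
      tauto

/-- Injectivity modulo the group. -/
def Inj (_ : TreeAct G W E) (Y : Set W) : Prop := ∀ u ∈ Y, ∀ g : G, g • u ∈ Y → g • u = u

theorem exists_Y [Nonempty W] : ∃ Y : Set W, T.Con Y ∧ T.Inj Y ∧ Y.Nonempty ∧
    ∀ w, ∃ g : G, ∃ y ∈ Y, w = g • y := by
  obtain ⟨y0⟩ := ‹Nonempty W›
  obtain ⟨Y, hsub, hmax⟩ := zorn_subset_nonempty {Y : Set W | T.Con Y ∧ T.Inj Y} (by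
    intro c hc hch hne
    refine ⟨⋃₀ c, ⟨?_, ?_⟩, fun s hs => Set.subset_sUnion_of_mem hs⟩
    · rintro u ⟨Y1, h1, hu⟩ u' ⟨Y2, h2, hu'⟩ hne
      obtain ⟨Y, hYc, k1, k2⟩ : ∃ Y ∈ c, u ∈ Y ∧ u' ∈ Y := by
        rcases hch.total h1 h2 with h | h
        · exact ⟨Y2, h2, h hu, hu'⟩
        · exact ⟨Y1, h1, hu, h hu'⟩
      obtain ⟨D, v, hv, h⟩ := (hc hYc).1 u k1 u' k2 hne
      exact ⟨D, v, ⟨Y, hYc, hv⟩, h⟩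
    · rintro u ⟨Y1, h1, hu⟩ g ⟨Y2, h2, hu'⟩
      rcases hch.total h1 h2 with h | h
      · exact (hc h2).2 u (h hu) g hu'
      · exact (hc h1).2 u hu g (h hu')) {y0} (by
    constructor
    · rintro u rfl u' rfl h
      exact absurd rfl h
    · rintro u rfl g h
      exact h)
  obtain ⟨hC, hI⟩ := hmax.prop
  have hy0 : y0 ∈ Y := hsub rfl
  refine ⟨Y, hC, hI, ⟨y0, hy0⟩, ?_⟩
  have key : ∀ y ∈ Y, ∀ w D, T.J y w D → ∃ g : G, ∃ y ∈ Y, w = g • y := by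
    intro y hy w D hJ
    by_contra hw
    push Not at hw
    have hwY : w ∉ Y := fun h => hw 1 w h (one_smul _ _).symm
    have : insert w Y ⊆ Y := by
      apply hmax.le_of_ge _ (Set.subset_insert _ _)
      constructor
      · rintro u (rfl | hu) u' (rfl | hu') hne
        · exact absurd rfl hne
        · refine ⟨D, y, .inr hy, T.J_symm hJ, ?_⟩
          by_contra hcon
          have h1 := T.J_at hJ
          have ht : D ∈ T.side u ↔ D ∈ T.side u' := by tauto
          obtain ⟨D', v, hv, hJ', ht'⟩ := hC y hy u' hu' (by
            rintro rfl; tauto)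
          obtain rfl := T.uniq u' hJ hJ' ht ht'
          have := T.edge hJ hJ' (ht.trans ht'.symm)
          exact hwY (this.2 ▸ hv)
        · by_cases huy : u = y
          · subst huy
            exact ⟨D, u', .inl rfl, hJ, Iff.rfl⟩
          · obtain ⟨D', v, hv, hJ', ht'⟩ := hC u hu y hy huy
            refine ⟨D', v, .inr hv, hJ', ?_⟩
            by_cases hDD : D' = D
            · subst hDD
              have := T.edge hJ' (T.J_symm hJ) ht'
              exact absurd (this.1 ▸ hu) hwY
            · exact ht'.trans (T.J_off hJ D' hDD)
        · obtain ⟨D, v, hv, h⟩ := hC u hu u' hu' hne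
          exact ⟨D, v, .inr hv, h⟩
      · rintro u (rfl | hu) g (hg | hg)
        · exact hg
        · exact absurd (by simp) (hw g⁻¹ _ hg)
        · exact absurd hg.symm (hw g u hu)
        · exact hI u hu g hg
    exact hwY (this (.inl rfl))
  refine T.conn {w | ∃ g : G, ∃ y ∈ Y, w = g • y} (u := y0) ⟨1, y0, hy0, (one_smul _ _).symm⟩ ?_
  rintro _ ⟨g, y, hy, rfl⟩ b D hJ
  have := T.J_smul g⁻¹ hJ
  rw [inv_smul_smul] at this
  obtain ⟨k, y', hy', e⟩ := key y hy _ _ this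
  refine ⟨g * k, y', hy', ?_⟩
  rw [mul_smul, ← e, smul_inv_smul]

open Classical in
/-- Indicator of a half-space containing a vertex. -/
noncomputable def chi (u : W) (B : E) : ℤ := if B ∈ T.side u then 1 else 0

theorem chi_smul (g : G) (u : W) (B : E) : T.chi (g • u) (g • B) = T.chi u B := by
  have := T.side_smul g u B
  unfold chi
  split_ifs <;> tauto

theorem chi_eq {u u' : W} {B B' : E} (h : B ∈ T.side u ↔ B' ∈ T.side u') :
    T.chi u B = T.chi u' B' := by
  unfold chi
  split_ifs <;> tauto

theorem chi_eq_iff {u u' : W} {B B' : E} :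
    T.chi u B = T.chi u' B' ↔ (B ∈ T.side u ↔ B' ∈ T.side u') := by
  simp only [chi]
  split_ifs <;> simp_all

open Classical in
/-- Signed number of half-spaces in `O` separating `u` from `u'`. -/
noncomputable def cc (O : Set E) (u u' : W) : ℤ :=
  ∑ᶠ B : E, if B ∈ O then T.chi u' B - T.chi u B else 0

open Classical in
theorem cc_fin (O : Set E) (u u' : W) :
    (Function.support fun B : E => if B ∈ O then T.chi u' B - T.chi u B else 0).Finite := by
  refine (T.df_finite u u').subset fun B hB h => hB ?_
  have := T.chi_eq h
  simp [this]

theorem cc_add (O : Set E) (u v w : W) : T.cc O u v + T.cc O v w = T.cc O u w := by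
  unfold cc
  rw [← finsum_add_distrib (T.cc_fin O u v) (T.cc_fin O v w)]
  congr 1; ext B
  split_ifs <;> ring

theorem cc_self (O : Set E) (u : W) : T.cc O u u = 0 := by
  have := T.cc_add O u u u
  omega

theorem cc_symm (O : Set E) (u v : W) : T.cc O v u = - T.cc O u v := by
  have := T.cc_add O u v u
  rw [cc_self] at this
  omega

theorem cc_smul (g : G) (O O' : Set E) (hO : ∀ B, g • B ∈ O' ↔ B ∈ O) (u v : W) :
    T.cc O' (g • u) (g • v) = T.cc O u v := by
  unfold cc
  rw [← finsum_comp_equiv (MulAction.toPerm g)]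
  congr 1; ext B
  have h1 := hO B
  simp only [MulAction.toPerm_apply, chi_smul]
  split_ifs <;> tauto

/-- The homomorphism counting an invariant family. -/
noncomputable def chom (F : Subgroup G) (O : Set E) (hO : ∀ g ∈ F, ∀ B, g • B ∈ O ↔ B ∈ O)
    (u : W) : F →* Multiplicative ℤ where
  toFun g := Multiplicative.ofAdd (T.cc O u ((g : G) • u))
  map_one' := by simp [cc_self]
  map_mul' a b := by
    rw [← ofAdd_add]
    congr 1
    rw [← T.cc_add O u ((a : G) • u), Subgroup.coe_mul, mul_smul,
      T.cc_smul (a : G) O O (hO a a.2)]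

theorem cc_single (O : Set E) (u u' : W) (D : E)
    (h : ∀ B ∈ O, B ∈ T.df u u' → B = D) (hD : D ∈ O) :
    T.cc O u u' = T.chi u' D - T.chi u D := by
  unfold cc
  rw [finsum_eq_single _ D]
  · simp [hD]
  · intro B hB
    split_ifs with hO
    · by_contra hne
      apply hB
      apply h B hO
      intro h
      exact hne (by rw [T.chi_eq h]; simp)
    · rfl

theorem cc_none (O : Set E) (u u' : W) (h : ∀ B ∈ O, B ∉ T.df u u') : T.cc O u u' = 0 := by
  unfold cc
  apply finsum_eq_zero_of_forall_eq_zero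
  intro B
  split_ifs with hO
  · have := h B hO
    simp only [df, Set.mem_setOf_eq, not_not] at this
    rw [T.chi_eq this]; simp
  · rfl

theorem gen_stab (hhom : ∀ f : G →* Multiplicative ℤ, f = 1) {Y : Set W} (hC : T.Con Y)
    (hI : T.Inj Y) (hne : Y.Nonempty) (hG : ∀ w, ∃ g : G, ∃ y ∈ Y, w = g • y) :
    Subgroup.closure {s : G | ∃ y ∈ Y, s • y = y} = ⊤ := by
  set H := Subgroup.closure {s : G | ∃ y ∈ Y, s • y = y} with hH
  obtain ⟨y0, hy0⟩ := hne
  have key : ∀ y ∈ Y, ∀ w D, T.J y w D → ∃ g ∈ H, ∃ y ∈ Y, w = g • y := by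
    intro y hy w D hJ
    obtain ⟨g, y', hy', rfl⟩ := hG w
    have hOo : ∀ (k : G) (B : E), k • B ∈ MulAction.orbit G D ↔ B ∈ MulAction.orbit G D :=
      fun k B => by
        rw [MulAction.mem_orbit_iff, MulAction.mem_orbit_iff]
        constructor
        · rintro ⟨m, hm⟩
          exact ⟨k⁻¹ * m, by rw [mul_smul, hm, inv_smul_smul]⟩
        · rintro ⟨m, hm⟩
          exact ⟨k * m, by rw [mul_smul, hm]⟩
    let f : G →* Multiplicative ℤ :=
      (T.chom ⊤ (MulAction.orbit G D) (fun k _ B => hOo k B) y').comp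
        (Subgroup.topEquiv (G := G)).symm.toMonoidHom
    have hf : T.cc (MulAction.orbit G D) y' (g • y') = 0 := by
      have : f g = 1 := by rw [hhom f]; rfl
      exact this
    have h1 := T.cc_single (MulAction.orbit G D) y (g • y') D (by
      intro B _ hB
      by_contra hBD
      exact hB (T.J_off hJ B hBD)) (MulAction.mem_orbit_self D)
    have h2 := T.cc_add (MulAction.orbit G D) y y' (g • y')
    rw [hf, h1, add_zero] at h2
    have hat := T.J_at hJ
    obtain ⟨B, hBO, hB1, hB2⟩ : ∃ B ∈ MulAction.orbit G D, (B ∈ T.side y ↔ D ∈ T.side y) ∧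
        (B ∈ T.side y' ↔ D ∈ T.side (g • y')) := by
      by_contra hcon
      push Not at hcon
      by_cases hDy : D ∈ T.side y
      · have hle : 0 ≤ T.cc (MulAction.orbit G D) y y' := by
          apply finsum_nonneg
          intro B
          split_ifs with hO
          · have := hcon B hO
            simp only [chi]
            split_ifs <;> grind
          · rfl
        rw [h2] at hle
        simp only [chi] at hle
        split_ifs at hle <;> grind
      · have hle : T.cc (MulAction.orbit G D) y y' ≤ 0 := by
          rw [← neg_nonneg, ← cc_symm]
          apply finsum_nonneg
          intro B
          split_ifs with hO
          · have := hcon B hO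
            simp only [chi]
            split_ifs <;> grind
          · rfl
        rw [h2] at hle
        simp only [chi] at hle
        split_ifs at hle <;> grind
    obtain ⟨k, rfl⟩ := hBO
    obtain ⟨a, ha, b, hb, e1, e2, e3, -⟩ := T.edge_between hC hy hy' (D := k • D) (by
      intro h; tauto)
    obtain ⟨rfl, rfl⟩ := T.edge e1 (T.J_smul k hJ) (by
      rw [T.side_smul]; exact e3.trans hB2)
    have hky := hI y hy k ha
    have hkw := hI y' hy' (k * g) (by rwa [mul_smul])
    refine ⟨k⁻¹, H.inv_mem (Subgroup.subset_closure ⟨y, hy, hky⟩), y', hy', ?_⟩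
    rw [eq_inv_smul_iff, ← mul_smul, hkw]
  have all := T.conn {w | ∃ g ∈ H, ∃ y ∈ Y, w = g • y} (u := y0)
    ⟨1, H.one_mem, y0, hy0, (one_smul _ _).symm⟩ (by
      rintro _ ⟨g, hg, y, hy, rfl⟩ b D hJ
      have := T.J_smul g⁻¹ hJ
      rw [inv_smul_smul] at this
      obtain ⟨k, hk, y', hy', e⟩ := key y hy _ _ this
      refine ⟨g * k, H.mul_mem hg hk, y', hy', ?_⟩
      rw [mul_smul, ← e, smul_inv_smul])
  rw [eq_top_iff]
  intro g _
  obtain ⟨h, hh, y', hy', e⟩ := all (g • y0)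
  have e' : (h⁻¹ * g) • y0 = y' := by rw [mul_smul, e, inv_smul_smul]
  have := hI y0 hy0 (h⁻¹ * g) (by rw [e']; exact hy')
  have : h⁻¹ * g ∈ H := Subgroup.subset_closure ⟨y0, hy0, this⟩
  simpa using H.mul_mem hh this

end TreeAct
end Trees

section Trees2
namespace TreeAct

variable {G W E : Type} [Group G] [MulAction G W] [MulAction G E] (T : TreeAct G W E)

theorem edge' {Y : Set W} (hC : T.Con Y) {y p : W} (hy : y ∈ Y) (hp : p ∈ Y) {q v : W} {D : E}
    (hJ : T.J q v D) (hD : D ∈ T.df y p) : q ∈ Y ∧ v ∈ Y := by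
  obtain ⟨a, ha, b, hb, e1, -, -, -⟩ := T.edge_between hC hy hp hD
  by_cases h : D ∈ T.side b ↔ D ∈ T.side v
  · obtain ⟨rfl, rfl⟩ := T.edge e1 hJ h
    exact ⟨ha, hb⟩
  · have h1 := T.J_at hJ
    obtain ⟨rfl, rfl⟩ := T.edge e1 (T.J_symm hJ) (by tauto)
    exact ⟨hb, ha⟩

theorem main (T : TreeAct G W E) [Nonempty W] (hhom : ∀ f : G →* Multiplicative ℤ, f = 1) (F : Subgroup G)
    (hF : F.index = 2) (hfree : ∀ g ∈ F, ∀ u : W, g • u = u → g = 1) :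
    ∃ s₀ : G, s₀ ∉ F ∧ s₀ * s₀ = 1 ∧ ∃ (S : Type) (x : S → F),
      Subgroup.closure (Set.range x) = ⊤ ∧ (∀ i, s₀ * x i * s₀⁻¹ = (x i : G)⁻¹) ∧
      ∃ (d : S → ℕ) (f : S → (F →* Multiplicative ℤ)),
        (∀ i, f i (x i) ≠ 1) ∧ (∀ i j, i ≠ j → f i (x j) ≠ 1 → d i < d j) := by
  obtain ⟨Y, hC, hI, hne, hG⟩ := T.exists_Y
  have hgen := T.gen_stab hhom hC hI hne hG
  have hnF : ∀ s : G, s ≠ 1 → ∀ y : W, s • y = y → s ∉ F := fun s hs y hy h => hs (hfree s h y hy)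
  have hFF : ∀ a b : G, a * b ∈ F ↔ (a ∈ F ↔ b ∈ F) := fun a b =>
    Subgroup.mul_mem_iff_of_index_two hF
  have hsq : ∀ s : G, s ≠ 1 → ∀ y : W, s • y = y → s * s = 1 := by
    intro s hs y hy
    exact hfree _ ((hFF s s).2 Iff.rfl) y (by rw [mul_smul, hy, hy])
  have huq : ∀ s t : G, s ≠ 1 → t ∉ F → ∀ y : W, s • y = y → t • y = y → s = t := by
    intro s t hs ht y h1 h2
    have h3 := hnF s hs y h1
    have h4 := hfree (s * t) ((hFF s t).2 (by tauto)) y (by rw [mul_smul, h2, h1])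
    have h5 := hsq s hs y h1
    exact mul_left_cancel (h5.trans h4.symm)
  obtain ⟨s₀, y₀, hs₀, hy₀, hfix₀⟩ : ∃ s₀ : G, ∃ y₀ : W, s₀ ≠ 1 ∧ y₀ ∈ Y ∧ s₀ • y₀ = y₀ := by
    by_contra hcon
    push Not at hcon
    have : Subgroup.closure {s : G | ∃ y ∈ Y, s • y = y} ≤ F := by
      rw [Subgroup.closure_le]
      rintro s ⟨y, hy, h⟩
      have : s = 1 := by
        by_contra hs
        exact hcon s y hs hy h
      rw [this]; exact F.one_mem
    rw [hgen, top_le_iff] at this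
    rw [this, Subgroup.index_top] at hF
    omega
  have hs₀F := hnF s₀ hs₀ y₀ hfix₀
  have hs₀2 := hsq s₀ hs₀ y₀ hfix₀
  have hs₀i : s₀⁻¹ = s₀ := inv_eq_of_mul_eq_one_left hs₀2
  refine ⟨s₀, hs₀F, hs₀2, {s : G // s ≠ 1 ∧ s ≠ s₀ ∧ ∃ y ∈ Y, s • y = y},
    fun s => ⟨s₀ * s, (hFF _ _).2 ?_⟩, ?_, ?_, ?_⟩
  · obtain ⟨s, h1, h2, y, hy, h3⟩ := s
    have := hnF s h1 y h3
    tauto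
  · -- generation
    set x : {s : G // s ≠ 1 ∧ s ≠ s₀ ∧ ∃ y ∈ Y, s • y = y} → F := _
    change Subgroup.closure (Set.range x) = ⊤
    have hx : ∀ s : {s : G // s ≠ 1 ∧ s ≠ s₀ ∧ ∃ y ∈ Y, s • y = y}, (x s : G) = s₀ * s := fun s => rfl
    clear_value x
    set H := (Subgroup.closure (Set.range x)).map F.subtype with hH
    have hHF : H ≤ F := by
      rw [hH]; exact Subgroup.map_subtype_le _
    have hxH : ∀ s : {s : G // s ≠ 1 ∧ s ≠ s₀ ∧ ∃ y ∈ Y, s • y = y}, (s₀ * s : G) ∈ H := fun s => ⟨x s, Subgroup.subset_closure ⟨s, rfl⟩, hx s⟩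
    have key : ∀ g ∈ Subgroup.closure {s : G | ∃ y ∈ Y, s • y = y}, ∀ q : G,
        (q ∈ H ∨ s₀ * q ∈ H) ↔ (g * q ∈ H ∨ s₀ * (g * q) ∈ H) := by
      intro g hg
      induction hg using Subgroup.closure_induction with
      | one => simp
      | mul a b _ _ ha hb =>
        intro q
        rw [hb, ha, mul_assoc]
      | inv a _ ha =>
        intro q
        rw [ha (a⁻¹ * q)]; simp
      | mem s hs =>
        have main : ∀ q, (q ∈ H ∨ s₀ * q ∈ H) → (s * q ∈ H ∨ s₀ * (s * q) ∈ H) := by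
          intro q hq
          by_cases h1 : s = 1
          · simpa [h1] using hq
          by_cases h2 : s = s₀
          · rw [h2, ← mul_assoc, hs₀2, one_mul]; exact hq.symm
          have hm := hxH ⟨s, h1, h2, hs⟩
          obtain ⟨y, hy, hsy⟩ := hs
          have hs2 := hsq s h1 y hsy
          have hsi : s⁻¹ = s := inv_eq_of_mul_eq_one_left hs2
          rcases hq with hq | hq
          · right
            rw [← mul_assoc]
            exact H.mul_mem hm hq
          · left
            have := H.mul_mem (H.inv_mem hm) hq
            have e : (s₀ * s)⁻¹ * (s₀ * q) = s * q := by
              rw [mul_inv_rev, hsi]; group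
            rwa [e] at this
        intro q
        refine ⟨main q, fun h => ?_⟩
        have h' := main _ h
        by_cases h1 : s = 1
        · simpa [h1] using h
        obtain ⟨y, hy, hsy⟩ := hs
        have hs2 := hsq s h1 y hsy
        rwa [← mul_assoc, hs2, one_mul] at h'
    rw [eq_top_iff]
    rintro ⟨f, hf⟩ -
    have := (key f (by rw [hgen]; trivial) 1).1 (.inl H.one_mem)
    rw [mul_one] at this
    rcases this with ⟨f', h1, h2⟩ | h
    · have : f' = ⟨f, hf⟩ := Subtype.ext h2
      rwa [← this]
    · have := (hFF s₀ f).1 (hHF h)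
      tauto
  · rintro ⟨s, h1, h2, y, hy, h3⟩
    have hs2 := hsq s h1 y h3
    have hsi : s⁻¹ = s := inv_eq_of_mul_eq_one_left hs2
    simp only
    rw [mul_inv_rev, hsi, hs₀i, ← mul_assoc, hs₀2, one_mul]
  · -- functionals
    have hch : ∀ s : {s : G // s ≠ 1 ∧ s ≠ s₀ ∧ ∃ y ∈ Y, s • y = y}, ∃ p ∈ Y, (s : G) • p = p ∧
        ∃ D, ∃ v ∈ Y, T.J p v D ∧ (D ∈ T.side v ↔ D ∈ T.side y₀) ∧ (s : G) • v ≠ v := by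
      rintro ⟨s, h1, h2, hex⟩
      have hex' : {y : W | y ∈ Y ∧ s • y = y}.Nonempty := hex
      obtain ⟨p, ⟨hp, hsp⟩, hmin⟩ : ∃ p ∈ {y : W | y ∈ Y ∧ s • y = y},
          ∀ q ∈ {y : W | y ∈ Y ∧ s • y = y}, (T.df p y₀).ncard ≤ (T.df q y₀).ncard :=
        ⟨Function.argminOn (fun q => (T.df q y₀).ncard) _ hex',
          Function.argminOn_mem _ _ hex', fun q hq => Function.argminOn_le (fun q => (T.df q y₀).ncard) _ hq⟩
      have hne : p ≠ y₀ := by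
        rintro rfl
        exact h2 (huq s s₀ h1 hs₀F _ hsp hfix₀)
      obtain ⟨D, v, hv, hJ, ht⟩ := hC p hp y₀ hy₀ hne
      refine ⟨p, hp, hsp, D, v, hv, hJ, ht, fun hsv => ?_⟩
      exact absurd (hmin v ⟨hv, hsv⟩) (not_le.2 (T.df_step_lt hJ ht))
    choose p hp hsp D v hv hJ ht hsv using hch
    have hO : ∀ i, ∀ g ∈ F, ∀ B : E, g • B ∈ {B | ∃ k ∈ F, B = k • D i} ↔
        B ∈ {B | ∃ k ∈ F, B = k • D i} := by
      intro i g hg B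
      constructor
      · rintro ⟨k, hk, h⟩
        exact ⟨g⁻¹ * k, F.mul_mem (F.inv_mem hg) hk, by rw [mul_smul, ← h, inv_smul_smul]⟩
      · rintro ⟨k, hk, h⟩
        exact ⟨g * k, F.mul_mem hg hk, by rw [mul_smul, ← h]⟩
    refine ⟨fun i => (T.df y₀ (p i)).ncard, fun i => T.chom F _ (hO i) y₀, ?_⟩
    have val : ∀ i j : {s : G // s ≠ 1 ∧ s ≠ s₀ ∧ ∃ y ∈ Y, s • y = y}, T.cc {B | ∃ k ∈ F, B = k • D i} y₀ ((s₀ * (j : G)) • y₀) =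
        - (T.chi (p j) (D i) - T.chi y₀ (D i)) := by
      intro i j
      set O := {B | ∃ k ∈ F, B = k • D i} with hOd
      set O' : Set E := {B | ∃ k, k ∉ F ∧ B = k • D i} with hOd'
      have hjF : (j : G) ∉ F := hnF j j.2.1 (p j) (hsp j)
      have sw : ∀ g : G, g ∉ F → ∀ B : E, g • B ∈ O ↔ B ∈ O' := by
        intro g hg B
        constructor
        · rintro ⟨k, hk, h⟩
          refine ⟨g⁻¹ * k, ?_, by rw [mul_smul, ← h, inv_smul_smul]⟩
          rw [hFF, inv_mem_iff]; tauto
        · rintro ⟨k, hk, h⟩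
          exact ⟨g * k, by rw [hFF]; tauto, by rw [mul_smul, ← h]⟩
      have sw' : ∀ g : G, g ∉ F → ∀ B : E, g • B ∈ O' ↔ B ∈ O := by
        intro g hg B
        rw [← sw g⁻¹ (by rwa [inv_mem_iff]), inv_smul_smul]
      have e1 : T.cc O y₀ ((s₀ * (j : G)) • y₀) = T.cc O' y₀ ((j : G) • y₀) := by
        rw [← T.cc_smul s₀ O' O (sw s₀ hs₀F), hfix₀, mul_smul]
      have e2 : T.cc O' ((j : G) • p j) ((j : G) • y₀) = T.cc O (p j) y₀ :=
        T.cc_smul _ O O' (sw' _ hjF) _ _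
      rw [hsp] at e2
      rw [e1, ← T.cc_add O' y₀ (p j), e2, T.cc_symm O y₀ (p j)]
      have z : T.cc O' y₀ (p j) = 0 := by
        apply T.cc_none
        rintro _ ⟨k, hk, rfl⟩ hB
        obtain ⟨k1, k2⟩ := T.edge' hC hy₀ (hp j) (T.J_smul k (hJ i)) hB
        have k3 := hI _ (hp i) _ k1
        have k4 := hI _ (hv i) _ k2
        have := huq i k i.2.1 hk _ (hsp i) k3
        exact hsv i (this ▸ k4)
      rw [z, zero_add, T.cc_single O y₀ (p j) (D i)]
      · rintro _ ⟨k, hk, rfl⟩ hB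
        obtain ⟨k1, k2⟩ := T.edge' hC hy₀ (hp j) (T.J_smul k (hJ i)) hB
        have k3 := hI _ (hp i) _ k1
        rw [hfree k hk _ k3, one_smul]
      · exact ⟨1, F.one_mem, (one_smul _ _).symm⟩
    have val' : ∀ i j : {s : G // s ≠ 1 ∧ s ≠ s₀ ∧ ∃ y ∈ Y, s • y = y}, T.chom F _ (hO i) y₀ ⟨s₀ * (j : G), (hFF _ _).2
        (by have := hnF j j.2.1 (p j) (hsp j); tauto)⟩ ≠ 1 ↔ D i ∈ T.df y₀ (p j) := by
      intro i j
      change ¬ (T.cc {B | ∃ k ∈ F, B = k • D i} y₀ ((s₀ * (j : G)) • y₀) = 0) ↔ _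
      rw [val, df, Set.mem_setOf_eq, ← T.chi_eq_iff]
      refine not_congr ?_
      constructor <;> intro h <;> omega
    constructor
    · intro i
      refine (val' i i).2 ?_
      have := T.J_at (hJ i)
      have := ht i
      simp only [df, Set.mem_setOf_eq]
      tauto
    · intro i j hij h
      have h' := (val' i j).1 h
      rw [T.df_comm] at h'
      obtain ⟨a, ha, b, hb, q1, q2, q3, q4⟩ := T.edge_between hC (hp j) hy₀ h'
      obtain ⟨rfl, -⟩ := T.edge q1 (hJ i) (q3.trans (ht i).symm)
      have hss : T.df y₀ (p i) ⊆ T.df y₀ (p j) := by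
        intro B hB h
        have := (q4 B h.symm).1
        exact hB (h.trans this.symm)
      refine Set.ncard_lt_ncard ⟨hss, fun hcon => hij ?_⟩ (T.df_finite _ _)
      have : p i = p j := by
        apply T.side_inj
        intro B
        by_cases hB : B ∈ T.df y₀ (p j)
        · have h1 := hcon hB
          simp only [df, Set.mem_setOf_eq] at h1 hB
          tauto
        · have h1 := fun h => hB (hss h)
          simp only [df, Set.mem_setOf_eq, not_not] at h1 hB
          tauto
      apply Subtype.ext
      refine huq i j i.2.1 (hnF j j.2.1 (p j) (hsp j)) (p i) (hsp i) ?_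
      rw [this]; exact hsp j

end TreeAct
end Trees2

section Rank

theorem free_rank (n : ℕ) (S : Type) (x : S → FreeGroup (Fin n)) (d : S → ℕ)
    (f : S → (FreeGroup (Fin n) →* Multiplicative ℤ))
    (h1 : ∀ i, f i (x i) ≠ 1) (h2 : ∀ i j, i ≠ j → f i (x j) ≠ 1 → d i < d j) :
    Nonempty (S ↪ Fin n) := by
  classical
  let v : FreeGroup (Fin n) →* Multiplicative (Fin n → ℤ) :=
    FreeGroup.lift fun i => Multiplicative.ofAdd (Pi.single i 1)
  let L : S → ((Fin n → ℤ) →+ ℤ) := fun s =>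
    { toFun := fun c => ∑ i, c i * Multiplicative.toAdd (f s (FreeGroup.of i))
      map_zero' := by simp
      map_add' := fun a b => by simp [add_mul, Finset.sum_add_distrib] }
  have hL : ∀ s y, f s y = Multiplicative.ofAdd (L s (Multiplicative.toAdd (v y))) := by
    intro s
    have : f s = (AddMonoidHom.toMultiplicative (L s)).comp v := by
      ext i
      simp [v, L, Pi.single_apply]
    intro y
    rw [this]; rfl
  have li : LinearIndependent ℤ fun s => Multiplicative.toAdd (v (x s)) := by
    rw [linearIndependent_iff']
    intro t g hg i hi
    by_contra hne
    have hne' : (t.filter fun j => g j ≠ 0).Nonempty := ⟨i, by simp [hi, hne]⟩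
    obtain ⟨j, hj, hmax⟩ := Finset.exists_max_image _ d hne'
    rw [Finset.mem_filter] at hj
    have h3 := congrArg (L j) hg
    rw [map_sum, map_zero, Finset.sum_eq_single j] at h3
    · rw [map_zsmul, smul_eq_mul, mul_eq_zero] at h3
      rcases h3 with h3 | h3
      · exact hj.2 h3
      · apply h1 j
        rw [hL, h3]; rfl
    · intro k hk hkj
      rw [map_zsmul, smul_eq_mul, mul_eq_zero]
      by_contra hcon
      push Not at hcon
      have h4 := hmax k (by simp [hk, hcon.1])
      have h5 := h2 j k (Ne.symm hkj) (by
        rw [hL]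
        intro h
        exact hcon.2 h)
      omega
    · intro h; exact absurd hj.1 h
  have : Finite S := li.finite
  have := Fintype.ofFinite S
  have hc := li.fintype_card_le_finrank
  simp only [Module.finrank_fintype_fun_eq_card, Fintype.card_fin] at hc
  exact ⟨(Fintype.equivFin S).toEmbedding.trans (Fin.castLEEmb hc)⟩

theorem exists_perm_ext {B : Type} [Finite B] (P : B → Prop) (g : {b // P b} → B)
    (hg : Function.Injective g) : ∃ e : Equiv.Perm B, ∀ b, e b.1 = g b := by
  classical
  have := Fintype.ofFinite B
  let e0 : {b // P b} ≃ {b // b ∈ Set.range g} := Equiv.ofInjective g hg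
  exact ⟨e0.extendSubtype, fun b => by
    rw [Equiv.extendSubtype_apply_of_mem e0 b.1 b.2]; rfl⟩

theorem free_resid {α : Type} [DecidableEq α] (w : FreeGroup α) (hw : w ≠ 1) :
    ∃ (B : Type) (_ : Finite B) (ρ : FreeGroup α →* Equiv.Perm B), ρ w ≠ 1 := by
  let B := {z : FreeGroup α // ∃ t, t <:+ w.toWord ∧ z = FreeGroup.mk t}
  have hfin : Finite B := by
    have : {z : FreeGroup α | ∃ t, t <:+ w.toWord ∧ z = FreeGroup.mk t}.Finite := by
      have h : {t | t <:+ w.toWord}.Finite := by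
        refine (List.finite_toSet (w.toWord.tails)).subset fun t ht => ?_
        simpa using ht
      refine (h.image FreeGroup.mk).subset ?_
      rintro z ⟨t, ht, rfl⟩
      exact ⟨t, ht, rfl⟩
    exact this.to_subtype
  have hperm : ∀ a : α, ∃ e : Equiv.Perm B, ∀ (b c : B), c.1 = FreeGroup.of a * b.1 → e b = c := by
    intro a
    obtain ⟨e, he⟩ := exists_perm_ext (fun b : B => ∃ c : B, c.1 = FreeGroup.of a * b.1)
      (fun b => b.2.choose) (by
        intro b b' h
        have h1 := b.2.choose_spec
        have h2 := b'.2.choose_spec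
        simp only at h
        rw [h, h2] at h1
        exact (Subtype.ext (Subtype.ext (mul_left_cancel h1))).symm)
    refine ⟨e, fun b c hc => ?_⟩
    rw [he ⟨b, c, hc⟩]
    have := (⟨c, hc⟩ : ∃ c : B, c.1 = FreeGroup.of a * b.1).choose_spec
    exact Subtype.ext (this.trans hc.symm)
  choose e he using hperm
  refine ⟨B, hfin, FreeGroup.lift e, ?_⟩
  let one : B := ⟨1, [], by simp, rfl⟩
  have key : ∀ t, t <:+ w.toWord → (FreeGroup.lift e (FreeGroup.mk t) one).1 =
      FreeGroup.mk t := by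
    intro t
    induction t with
    | nil => intro ht; rw [← FreeGroup.one_eq_mk, map_one]; rfl
    | cons l t ih =>
      intro ht
      have ht' : t <:+ w.toWord := (List.suffix_cons l t).trans ht
      have e1 : (FreeGroup.mk (l :: t)) = FreeGroup.mk [l] * FreeGroup.mk t := by
        rw [FreeGroup.mul_mk]; rfl
      let c : B := ⟨FreeGroup.mk (l :: t), l :: t, ht, rfl⟩
      have hb := ih ht'
      have e3 : FreeGroup.lift e (FreeGroup.mk (l :: t)) one =
          FreeGroup.lift e (FreeGroup.mk [l]) (FreeGroup.lift e (FreeGroup.mk t) one) := by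
        rw [e1, map_mul, Equiv.Perm.mul_apply]
      have : FreeGroup.lift e (FreeGroup.mk (l :: t)) one = c := by
        rw [e3]
        obtain ⟨a, b⟩ := l
        cases b
        · have e2 : (FreeGroup.mk [(a, false)]) = (FreeGroup.of a)⁻¹ := rfl
          rw [e2, map_inv, FreeGroup.lift_apply_of, Equiv.Perm.inv_eq_iff_eq]
          symm
          apply he
          rw [hb]
          change _ = FreeGroup.of a * FreeGroup.mk ((a, false) :: t)
          rw [e1, e2, mul_inv_cancel_left]
        · have e2 : (FreeGroup.mk [(a, true)]) = FreeGroup.of a := rfl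
          rw [e2, FreeGroup.lift_apply_of]
          apply he
          rw [hb]
          change FreeGroup.mk ((a, true) :: t) = _
          rw [e1, e2]
      rw [this]
  intro hcon
  have h := key w.toWord List.suffix_rfl
  rw [FreeGroup.mk_toWord, hcon] at h
  exact hw h.symm

theorem free_hopf {n : ℕ} (f : FreeGroup (Fin n) →* FreeGroup (Fin n))
    (hf : Function.Surjective f) : Function.Injective f := by
  rw [injective_iff_map_eq_one]
  intro w hw
  by_contra hne
  obtain ⟨B, hB, ρ, hρ⟩ := free_resid w hne
  have : Finite (FreeGroup (Fin n) →* Equiv.Perm B) :=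
    Finite.of_equiv _ (FreeGroup.lift (α := Fin n) (β := Equiv.Perm B))
  have inj : Function.Injective
      (fun σ : FreeGroup (Fin n) →* Equiv.Perm B => σ.comp f) := by
    intro σ τ h
    ext1 i
    obtain ⟨y, hy⟩ := hf (FreeGroup.of i)
    rw [← hy]
    exact DFunLike.congr_fun h y
  obtain ⟨σ, hσ⟩ := (Finite.injective_iff_surjective.1 inj) ρ
  apply hρ
  rw [← hσ]
  simp [hw]

end Rank

section Family
open scoped Pointwise

/-- An invariant nested family of cuts. -/
structure Fam (G : Type) [Group G] where
  c : Set (Set G)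
  compl : ∀ A ∈ c, Aᶜ ∈ c
  inv : ∀ (g : G), ∀ A ∈ c, g • A ∈ c
  nst : ∀ A ∈ c, ∀ B ∈ c, Nst A B
  ne : ∀ A ∈ c, A.Nonempty
  fin : ∀ x y : G, {D | D ∈ c ∧ x ∈ D ∧ y ∉ D}.Finite

namespace Fam
variable {G : Type} [Group G] (C : Fam G)

/-- Midpoint vertex. -/
def mid (D : Set G) : Set (Set G) := {B | B ∈ C.c ∧ (D ⊂ B ∨ Dᶜ ⊂ B)}

/-- End vertex. -/
def head (D : Set G) : Set (Set G) := {B | B ∈ C.c ∧ (D ⊆ B ∨ Dᶜ ⊂ B)}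

theorem mid_compl (D : Set G) : C.mid Dᶜ = C.mid D := by
  ext B; simp only [mid, Set.mem_setOf_eq, compl_compl]; tauto

theorem head_eq {D : Set G} (hD : D ∈ C.c) : C.head D = insert D (C.mid D) := by
  ext B
  simp only [head, mid, Set.mem_setOf_eq, Set.mem_insert_iff]
  rw [subset_iff_ssubset_or_eq]
  constructor
  · rintro ⟨h1, (h | h) | h⟩
    · tauto
    · exact .inl h.symm
    · tauto
  · rintro (rfl | h)
    · exact ⟨hD, .inl (.inr rfl)⟩
    · tauto

theorem not_sub {A : Set G} (hA : A ∈ C.c) {B : Set G} (h1 : A ⊆ B) (h2 : A ⊆ Bᶜ) : False := by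
  obtain ⟨x, hx⟩ := C.ne A hA
  exact h2 hx (h1 hx)

theorem not_sup {B : Set G} (hB : B ∈ C.c) {A : Set G} (h1 : A ⊆ B) (h2 : Aᶜ ⊆ B) : False := by
  obtain ⟨x, hx⟩ := C.ne _ (C.compl B hB)
  exact hx (h2 fun h => hx (h1 h))

theorem notMem_mid {D : Set G} (hD : D ∈ C.c) : D ∉ C.mid D := by
  rintro ⟨-, h | h⟩
  · exact h.ne rfl
  · exact C.not_sup hD subset_rfl h.subset

theorem compl_notMem_mid {D : Set G} (hD : D ∈ C.c) : Dᶜ ∉ C.mid D := by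
  rw [← mid_compl]; exact C.notMem_mid (C.compl D hD)

theorem mid_or {D B : Set G} (hD : D ∈ C.c) (hB : B ∈ C.c) (h1 : B ≠ D) (h2 : B ≠ Dᶜ) :
    B ∈ C.mid D ∨ Bᶜ ∈ C.mid D := by
  have h3 : D ≠ Bᶜ := fun h => h2 (by rw [h, compl_compl])
  rcases C.nst D hD B hB with h | h | h | h
  · exact .inl ⟨hB, .inl (h.ssubset_of_ne h1.symm)⟩
  · exact .inr ⟨C.compl B hB, .inl (h.ssubset_of_ne h3)⟩
  · exact .inl ⟨hB, .inr (h.ssubset_of_ne h2.symm)⟩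
  · exact .inr ⟨C.compl B hB, .inr (h.ssubset_of_ne fun h => h1 (compl_injective h).symm)⟩

theorem head_not_both {D B : Set G} (hD : D ∈ C.c) (h1 : B ∈ C.head D) (h2 : Bᶜ ∈ C.head D) :
    False := by
  obtain ⟨hB, h1⟩ := h1
  obtain ⟨hB', h2⟩ := h2
  rcases h1 with h1 | h1 <;> rcases h2 with h2 | h2
  · exact C.not_sub hD h1 h2
  · exact h2.2 (Set.compl_subset_compl.2 h1)
  · exact h1.2 (by rwa [Set.subset_compl_comm] at h2)
  · exact C.not_sub (C.compl D hD) h1.subset h2.subset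

theorem head_or {D B : Set G} (hD : D ∈ C.c) (hB : B ∈ C.c) :
    B ∈ C.head D ∨ Bᶜ ∈ C.head D := by
  rw [C.head_eq hD]
  by_cases h1 : B = D
  · exact .inl (.inl h1)
  by_cases h2 : B = Dᶜ
  · exact .inr (.inl (by rw [h2, compl_compl]))
  exact (C.mid_or hD hB h1 h2).imp .inr .inr

/-- Vertices. -/
def IsV (u : Set (Set G)) : Prop := ∃ D ∈ C.c, u = C.mid D ∨ u = C.head D

theorem mid_sub_head (D : Set G) : C.mid D ⊆ C.head D := fun _ h =>
  ⟨h.1, h.2.imp (fun h => h.subset) id⟩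

theorem IsV.sub_head {C : Fam G} {u} (h : C.IsV u) :
    ∃ D ∈ C.c, u ⊆ C.head D ∧ C.mid D ⊆ u := by
  obtain ⟨D, hD, rfl | rfl⟩ := h
  · exact ⟨D, hD, C.mid_sub_head D, subset_rfl⟩
  · exact ⟨D, hD, subset_rfl, C.mid_sub_head D⟩

theorem IsV.sub {C : Fam G} {u B} (h : C.IsV u) (hB : B ∈ u) : B ∈ C.c := by
  obtain ⟨D, hD, h1, -⟩ := h.sub_head
  exact (h1 hB).1

theorem IsV.up {C : Fam G} {u B B'} (h : C.IsV u) (hB : B ∈ u) (hB' : B' ∈ C.c) (hs : B ⊆ B') :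
    B' ∈ u := by
  obtain ⟨D, hD, rfl | rfl⟩ := h
  · exact ⟨hB', hB.2.imp (fun h => h.trans_subset hs) (fun h => h.trans_subset hs)⟩
  · exact ⟨hB', hB.2.imp (fun h => h.trans hs) (fun h => h.trans_subset hs)⟩

theorem IsV.not_both {C : Fam G} {u B} (h : C.IsV u) (h1 : B ∈ u) (h2 : Bᶜ ∈ u) : False := by
  obtain ⟨D, hD, h3, -⟩ := h.sub_head
  exact C.head_not_both hD (h3 h1) (h3 h2)

theorem IsV.eq_mid {C : Fam G} {u B} (h : C.IsV u) (hB : B ∈ C.c) (h1 : B ∉ u) (h2 : Bᶜ ∉ u) :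
    u = C.mid B := by
  obtain ⟨D, hD, rfl | rfl⟩ := h
  · by_cases e1 : B = D
    · rw [e1]
    by_cases e2 : B = Dᶜ
    · rw [e2, mid_compl]
    exact absurd (C.mid_or hD hB e1 e2) (by tauto)
  · exact absurd (C.head_or hD hB) (by tauto)

theorem mid_ne_head {D D' : Set G} (hD : D ∈ C.c) (hD' : D' ∈ C.c) : C.mid D ≠ C.head D' := by
  intro h
  rcases C.head_or hD' hD with h1 | h1
  · exact C.notMem_mid hD (h ▸ h1)
  · exact C.compl_notMem_mid hD (h ▸ h1)

theorem mid_inj {D D' : Set G} (hD : D ∈ C.c) (hD' : D' ∈ C.c) (h : C.mid D = C.mid D') :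
    D' = D ∨ D' = Dᶜ := by
  by_contra hcon
  push Not at hcon
  rcases C.mid_or hD hD' hcon.1 hcon.2 with h1 | h1
  · exact C.notMem_mid hD' (h ▸ h1)
  · exact C.compl_notMem_mid hD' (h ▸ h1)

theorem head_self {D : Set G} (hD : D ∈ C.c) : D ∈ C.head D := ⟨hD, .inl subset_rfl⟩

theorem head_ne {D D' : Set G} (hD : D ∈ C.c) (hD' : D' ∈ C.c) (h : C.head D = C.head D')
    (hne : D ≠ D') : Dᶜ ⊂ D' := by
  have h1 : D' ∈ C.head D := h ▸ C.head_self hD'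
  have h2 : D ∈ C.head D' := h ▸ C.head_self hD
  rcases h1.2 with h1 | h1
  · rcases h2.2 with h2 | h2
    · exact absurd (h1.antisymm h2) hne
    · exact (C.not_sup hD' subset_rfl (h2.subset.trans h1)).elim
  · exact h1

theorem int_fin {A B : Set G} (hA : A ∈ C.c) (hB : B ∈ C.c) :
    {D | D ∈ C.c ∧ A ⊆ D ∧ D ⊆ B}.Finite := by
  obtain ⟨x, hx⟩ := C.ne A hA
  obtain ⟨y, hy⟩ := C.ne _ (C.compl B hB)
  exact (C.fin x y).subset fun D hD => ⟨hD.1, hD.2.1 hx, fun h => hy (hD.2.2 h)⟩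

theorem diff_fin {u u' : Set (Set G)} (hu : C.IsV u) (hu' : C.IsV u') : (u \ u').Finite := by
  obtain ⟨D, hD, h1, -⟩ := hu.sub_head
  obtain ⟨D', hD', -, h2⟩ := hu'.sub_head
  have cD := C.compl D hD
  have cD' := C.compl D' hD'
  refine ((((C.int_fin hD hD').union (C.int_fin hD cD')).union
    ((C.int_fin cD hD').union (C.int_fin cD cD'))).union
      (Set.toFinite {D', D'ᶜ})).subset ?_
  rintro B ⟨hB, hB'⟩
  obtain ⟨hBc, hB1⟩ := h1 hB
  by_cases e1 : B = D'
  · exact .inr (.inl e1)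
  by_cases e2 : B = D'ᶜ
  · exact .inr (.inr e2)
  left
  rcases C.mid_or hD' hBc e1 e2 with h | h
  · exact absurd (h2 h) hB'
  · have h3 : B ⊆ D' ∨ B ⊆ D'ᶜ := by
      rcases h.2 with h | h
      · exact .inr (Set.subset_compl_comm.1 h.subset)
      · exact .inl (Set.compl_subset_compl.1 h.subset)
    have h4 : D ⊆ B ∨ Dᶜ ⊆ B := hB1.imp id fun h => h.subset
    simp only [Set.mem_union, Set.mem_setOf_eq]
    tauto

theorem smul_mem_iff (g : G) {A : Set G} : g • A ∈ C.c ↔ A ∈ C.c :=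
  ⟨fun h => by simpa using C.inv g⁻¹ _ h, C.inv g A⟩

theorem smul_ssub (g : G) {A B : Set G} : g • A ⊂ g • B ↔ A ⊂ B := by
  rw [ssubset_iff_subset_ne, ssubset_iff_subset_ne, Set.smul_set_subset_smul_set_iff, Ne, smul_left_cancel_iff]

theorem smul_mid (g : G) (D : Set G) : g • C.mid D = C.mid (g • D) := by
  ext B
  obtain ⟨B, rfl⟩ : ∃ B', B = g • B' := ⟨g⁻¹ • B, by simp⟩
  rw [Set.smul_mem_smul_set_iff]
  simp only [mid, Set.mem_setOf_eq, smul_mem_iff, smul_ssub, ← Set.smul_set_compl]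

theorem smul_head (g : G) (D : Set G) : g • C.head D = C.head (g • D) := by
  ext B
  obtain ⟨B, rfl⟩ : ∃ B', B = g • B' := ⟨g⁻¹ • B, by simp⟩
  rw [Set.smul_mem_smul_set_iff]
  simp only [head, Set.mem_setOf_eq, smul_mem_iff, smul_ssub, ← Set.smul_set_compl,
    Set.smul_set_subset_smul_set_iff]

theorem IsV.smul {C : Fam G} (g : G) {u} (h : C.IsV u) : C.IsV (g • u) := by
  obtain ⟨D, hD, rfl | rfl⟩ := h
  · exact ⟨g • D, C.inv g D hD, .inl (C.smul_mid g D)⟩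
  · exact ⟨g • D, C.inv g D hD, .inr (C.smul_head g D)⟩

/-- The vertex type. -/
def W : Type := {u : Set (Set G) // C.IsV u}

instance : MulAction G C.W where
  smul g u := ⟨g • u.1, u.2.smul g⟩
  one_smul u := Subtype.ext (one_smul G u.1)
  mul_smul g h u := Subtype.ext (mul_smul g h u.1)

theorem coe_smul (g : G) (u : C.W) : (g • u).1 = g • u.1 := rfl

theorem head_eq_of_sub {B D : Set G} (hB : B ∈ C.c) (hD : D ∈ C.c) (h : C.head B ⊆ C.head D) :
    C.head B = C.head D := by
  refine h.antisymm fun A hA => ?_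
  rcases C.head_or hB hA.1 with h1 | h1
  · exact h1
  · exact (C.head_not_both hD hA (h h1)).elim

theorem isV_mid {D : Set G} (hD : D ∈ C.c) : C.IsV (C.mid D) := ⟨D, hD, .inl rfl⟩
theorem isV_head {D : Set G} (hD : D ∈ C.c) : C.IsV (C.head D) := ⟨D, hD, .inr rfl⟩

theorem head_step {D : Set G} (hD : D ∈ C.c) {u' : Set (Set G)} (hu' : C.IsV u')
    (hne : C.head D ≠ u') : ∃ B ∈ C.c, C.head B = C.head D ∧ B ∉ u' := by
  have hne' : (C.head D \ u').Nonempty := by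
    by_contra hcon
    rw [Set.not_nonempty_iff_eq_empty, Set.sdiff_eq_empty] at hcon
    apply hne
    refine hcon.antisymm fun B hB => ?_
    rcases C.head_or hD (hu'.sub hB) with h | h
    · exact h
    · exact (hu'.not_both hB (hcon h)).elim
  obtain ⟨B, hB⟩ := (C.diff_fin (C.isV_head hD) hu').exists_minimal hne'
  have hBc := (C.isV_head hD).sub hB.prop.1
  refine ⟨B, hBc, C.head_eq_of_sub hBc hD ?_, hB.prop.2⟩
  rintro A ⟨hA, h | h⟩
  · exact (C.isV_head hD).up hB.prop.1 hA h
  · by_contra hcon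
    have h1 : Aᶜ ∈ C.head D := (C.head_or hD hA).resolve_left hcon
    have h2 : Aᶜ ⊆ B := Set.compl_subset_comm.1 h.subset
    have h3 : Aᶜ ∈ u' := by
      by_contra h3
      have := hB.le_of_le ⟨h1, h3⟩ h2
      exact h.2 (Set.subset_compl_comm.1 this)
    exact hB.prop.2 (hu'.up h3 hBc h2)

/-- The tree. -/
def tree : TreeAct G C.W (Set G) where
  side u := u.1
  J u v D := D ∈ C.c ∧ ((u.1 = C.mid D ∧ v.1 = C.head D) ∨ (u.1 = C.head D ∧ v.1 = C.mid D))
  side_smul g u B := by rw [coe_smul, Set.smul_mem_smul_set_iff]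
  J_smul g {u v D} h := by
    refine ⟨C.inv g D h.1, ?_⟩
    rw [coe_smul, coe_smul, ← smul_mid, ← smul_head]
    rcases h.2 with ⟨h1, h2⟩ | ⟨h1, h2⟩
    · exact .inl ⟨by rw [h1], by rw [h2]⟩
    · exact .inr ⟨by rw [h1], by rw [h2]⟩
  J_symm h := ⟨h.1, h.2.symm.imp And.symm And.symm⟩
  J_off {u v D} h B hB := by
    have := C.head_eq h.1
    rcases h.2 with ⟨h1, h2⟩ | ⟨h1, h2⟩ <;> rw [h1, h2, this] <;> simp [hB]
  J_at {u v D} h := by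
    have := C.head_self h.1
    have := C.notMem_mid h.1
    rcases h.2 with ⟨h1, h2⟩ | ⟨h1, h2⟩ <;> rw [h1, h2] <;> tauto
  fin u u' := by
    refine ((C.diff_fin u.2 u'.2).union (C.diff_fin u'.2 u.2)).subset fun B hB => ?_
    simp only [Set.mem_setOf_eq] at hB
    simp only [Set.mem_union, Set.mem_sdiff]
    tauto
  step u u' hne := by
    have hne' : u.1 ≠ u'.1 := fun h => hne (Subtype.ext h)
    obtain ⟨u, D, hD, rfl | rfl⟩ := u
    · by_cases h1 : D ∈ u'.1
      · exact ⟨D, ⟨C.head D, C.isV_head hD⟩, ⟨hD, .inl ⟨rfl, rfl⟩⟩,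
          iff_of_true (C.head_self hD) h1⟩
      · by_cases h2 : Dᶜ ∈ u'.1
        · have hD' := C.compl D hD
          exact ⟨Dᶜ, ⟨C.head Dᶜ, C.isV_head hD'⟩, ⟨hD', .inl ⟨(C.mid_compl D).symm, rfl⟩⟩,
            iff_of_true (C.head_self hD') h2⟩
        · exact absurd (u'.2.eq_mid hD h1 h2).symm hne'
    · obtain ⟨B, hB, e, hB'⟩ := C.head_step hD u'.2 hne'
      exact ⟨B, ⟨C.mid B, C.isV_mid hB⟩, ⟨hB, .inr ⟨e.symm, rfl⟩⟩,
        iff_of_false (C.notMem_mid hB) hB'⟩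
  uniq {u v D v' D'} u' hJ hJ' ht ht' := by
    obtain ⟨hD, hJ⟩ := hJ
    obtain ⟨hD', hJ'⟩ := hJ'
    rcases hJ with ⟨h1, h2⟩ | ⟨h1, h2⟩ <;> rcases hJ' with ⟨h1', h2'⟩ | ⟨h1', h2'⟩
    · rcases C.mid_inj hD hD' (h1.symm.trans h1') with h | h
      · exact h.symm
      · have k1 := ht.1 (by rw [h2]; exact C.head_self hD)
        have k2 := ht'.1 (by rw [h2']; exact C.head_self hD')
        rw [h] at k2
        exact (u'.2.not_both k1 k2).elim
    · exact absurd (h1.symm.trans h1') (C.mid_ne_head hD hD')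
    · exact absurd (h1'.symm.trans h1) (C.mid_ne_head hD' hD)
    · by_contra hne
      have k := C.head_ne hD hD' (h1.symm.trans h1') hne
      have k1 : D ∉ u'.1 := fun h => by
        have := ht.2 h
        rw [h2] at this
        exact C.notMem_mid hD this
      have k2 : D' ∉ u'.1 := fun h => by
        have := ht'.2 h
        rw [h2'] at this
        exact C.notMem_mid hD' this
      by_cases k3 : Dᶜ ∈ u'.1
      · exact k2 (u'.2.up k3 hD' k.subset)
      · have := u'.2.eq_mid hD k1 k3
        rw [this] at k2
        exact k2 ⟨hD', .inr k⟩
  edge {u v D u' v'} hJ hJ' h := by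
    obtain ⟨hD, hJ⟩ := hJ
    obtain ⟨-, hJ'⟩ := hJ'
    have a1 := C.head_self hD
    have a2 := C.notMem_mid hD
    rcases hJ with ⟨h1, h2⟩ | ⟨h1, h2⟩ <;> rcases hJ' with ⟨h1', h2'⟩ | ⟨h1', h2'⟩
    · exact ⟨Subtype.ext (h1.trans h1'.symm), Subtype.ext (h2.trans h2'.symm)⟩
    · rw [h2, h2'] at h; tauto
    · rw [h2, h2'] at h; tauto
    · exact ⟨Subtype.ext (h1.trans h1'.symm), Subtype.ext (h2.trans h2'.symm)⟩

theorem free_aux {u : Set (Set G)} (hu : C.IsV u) {A : Set G} (hA : A ∈ u) {h : G}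
    (hh : h • A ⊂ A) (hf : h • u = u) : False := by
  obtain ⟨D, hD, h1, -⟩ := hu.sub_head
  have hAc := hu.sub hA
  have cD := C.compl D hD
  have lt : ∀ k : ℕ, h ^ (k + 1) • A ⊂ h ^ k • A := by
    intro k
    rw [pow_succ, mul_smul, smul_ssub]
    exact hh
  have anti : StrictAnti fun k : ℕ => h ^ k • A := strictAnti_nat_of_succ_lt lt
  have mem : ∀ k : ℕ, h ^ k • A ∈ u := by
    intro k
    induction k with
    | zero => simpa using hA
    | succ k ih =>
      rw [pow_succ', mul_smul, ← hf, Set.smul_mem_smul_set_iff]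
      exact ih
  refine Set.infinite_range_of_injective anti.injective
    (((C.int_fin hD hAc).union (C.int_fin cD hAc)).subset ?_)
  rintro _ ⟨k, rfl⟩
  have h2 : h ^ k • A ⊆ A := by simpa using anti.antitone (Nat.zero_le k)
  obtain ⟨h3, h4⟩ := h1 (mem k)
  exact h4.imp (fun h => ⟨h3, h, h2⟩) (fun h => ⟨h3, h.subset, h2⟩)

theorem free_act {u : Set (Set G)} (hu : C.IsV u) {A : Set G} (hA : A ∈ C.c) {h : G}
    (hh : h • A ⊂ A) (hf : h • u = u) : False := by
  by_cases h1 : A ∈ u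
  · exact C.free_aux hu h1 hh hf
  by_cases h2 : Aᶜ ∈ u
  · refine C.free_aux hu h2 (h := h⁻¹) ?_ ?_
    · rw [← smul_ssub h, smul_inv_smul, Set.smul_set_compl]
      exact compl_lt_compl_iff_lt.2 hh
    · rw [inv_smul_eq_iff, hf]
  · have e := hu.eq_mid hA h1 h2
    rw [e, smul_mid] at hf
    rcases C.mid_inj (C.inv h A hA) hA hf with h3 | h3
    · exact hh.ne h3.symm
    · have := hh.subset
      nth_rw 2 [h3] at this
      exact C.not_sub (C.inv h A hA) subset_rfl this

theorem tree_free (F : Subgroup G) (hsep : ∀ g ∈ F, g ≠ 1 → ∃ A ∈ C.c, ∃ j : ℕ,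
    g ^ j • A ⊂ A ∨ A ⊂ g ^ j • A) : ∀ g ∈ F, ∀ u : C.W, g • u = u → g = 1 := by
  intro g hg u hu
  by_contra hne
  have hu' : g • u.1 = u.1 := congrArg Subtype.val hu
  obtain ⟨A, hA, j, h⟩ := hsep g hg hne
  have hj : ∀ j : ℕ, g ^ j • u.1 = u.1 := by
    intro j
    induction j with
    | zero => simp
    | succ j ih => rw [pow_succ, mul_smul, hu', ih]
  rcases h with h | h
  · exact C.free_act u.2 hA h (hj j)
  · refine C.free_act u.2 hA (h := (g ^ j)⁻¹) ?_ ?_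
    · rw [← smul_ssub (g ^ j), smul_inv_smul]; exact h
    · rw [inv_smul_eq_iff, hj]

end Fam
end Family

section Invariance

theorem bdr_image {V : Type} {R : V → V → Prop} (e : V ≃ V) (hE : ∀ x y, R (e x) (e y) ↔ R x y)
    (A : Set V) : bdr R (e '' A) = (Equiv.prodCongr e e) '' bdr R A := by
  ext ⟨x, y⟩
  obtain ⟨x, rfl⟩ := e.surjective x
  obtain ⟨y, rfl⟩ := e.surjective y
  simp [bdr, hE]

theorem bdr_image_fin {V : Type} {R : V → V → Prop} (e : V ≃ V)
    (hE : ∀ x y, R (e x) (e y) ↔ R x y) {A : Set V} :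
    (bdr R (e '' A)).Finite ↔ (bdr R A).Finite := by
  rw [bdr_image e hE, Set.finite_image_iff (Equiv.injective _).injOn]

theorem bdr_image_ncard {V : Type} {R : V → V → Prop} (e : V ≃ V)
    (hE : ∀ x y, R (e x) (e y) ↔ R x y) {A : Set V} :
    (bdr R (e '' A)).ncard = (bdr R A).ncard := by
  rw [bdr_image e hE, Set.ncard_image_of_injective _ (Equiv.injective _)]

theorem nst_image {V : Type} (e : V ≃ V) {A B : Set V} : Nst (e '' A) (e '' B) ↔ Nst A B := by
  simp only [Nst, ← Set.image_compl_eq e.bijective, Set.image_subset_image_iff e.injective]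

theorem Cn.image {V : Type} {R : V → V → Prop} (e : V ≃ V) (hE : ∀ x y, R (e x) (e y) ↔ R x y)
    {A : Set V} (h : Cn R A) : Cn R (e '' A) := by
  intro B hB hne hcl
  have := h (e ⁻¹' B) (fun x hx => by
      obtain ⟨a, ha, hax⟩ := hB hx
      rwa [← e.injective hax])
    (by obtain ⟨b, hb⟩ := hne; exact ⟨e.symm b, by simpa using hb⟩)
    (fun x hx y hy hxy => hcl _ hx _ ⟨y, hy, rfl⟩ ((hE x y).2 hxy))
  rw [← this, Set.image_preimage_eq _ e.surjective]

theorem Tg.image {V : Type} {R : V → V → Prop} (e : V ≃ V) (hE : ∀ x y, R (e x) (e y) ↔ R x y)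
    {K : ℕ} {A : Set V} (h : Tg R K A) : Tg R K (e '' A) :=
  ⟨(bdr_image_fin e hE).2 h.1, (bdr_image_ncard e hE).trans_le h.2.1, h.2.2.1.image e hE, by
    rw [← Set.image_compl_eq e.bijective]; exact h.2.2.2.image e hE⟩

theorem equiv_symm_rel {V : Type} {R : V → V → Prop} (e : V ≃ V)
    (hE : ∀ x y, R (e x) (e y) ↔ R x y) : ∀ x y, R (e.symm x) (e.symm y) ↔ R x y := by
  intro x y
  rw [← hE]; simp

theorem crs_image {V : Type} {R : V → V → Prop} (e : V ≃ V) (hE : ∀ x y, R (e x) (e y) ↔ R x y)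
    {K : ℕ} {A : Set V} : (crs R K (e '' A)).ncard = (crs R K A).ncard := by
  have : crs R K (e '' A) = (fun D => e '' D) '' crs R K A := by
    ext D
    constructor
    · rintro ⟨h1, h2⟩
      refine ⟨e.symm '' D, ⟨h1.image e.symm (equiv_symm_rel e hE), ?_⟩, by simp⟩
      rw [← nst_image e]; simpa using h2
    · rintro ⟨D, ⟨h1, h2⟩, rfl⟩
      exact ⟨h1.image e hE, by rwa [nst_image e]⟩
  rw [this, Set.ncard_image_of_injective _ e.injective.image_injective]

theorem sp_image {V : Type} (e : V ≃ V) {p : Ultrafilter V × Ultrafilter V} {A : Set V} :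
    Sp (p.1.map e, p.2.map e) (e '' A) ↔ Sp p A := by
  simp [Sp, Ultrafilter.mem_map, Set.preimage_image_eq _ e.injective]

theorem Mn.image {V : Type} {R : V → V → Prop} (e : V ≃ V) (hE : ∀ x y, R (e x) (e y) ↔ R x y)
    {p : Ultrafilter V × Ultrafilter V} {A : Set V} (h : Mn R p A) :
    Mn R (p.1.map e, p.2.map e) (e '' A) := by
  refine ⟨(bdr_image_fin e hE).2 h.1, (sp_image e).2 h.2.1, fun B hB hs => ?_⟩
  rw [bdr_image_ncard e hE]
  have hb : B = e '' (e.symm '' B) := by simp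
  rw [hb] at hB hs ⊢
  rw [bdr_image_ncard e hE]
  exact h.2.2 _ ((bdr_image_fin e hE).1 hB) ((sp_image e).1 hs)

theorem mn_image {V : Type} {R : V → V → Prop} (e : V ≃ V) (hE : ∀ x y, R (e x) (e y) ↔ R x y)
    {p : Ultrafilter V × Ultrafilter V} {A : Set V} (h : Mn R (p.1.map e, p.2.map e) (e '' A)) :
    Mn R p A := by
  have := h.image e.symm (equiv_symm_rel e hE)
  simpa [Ultrafilter.map_map] using this

theorem Op.image {V : Type} {R : V → V → Prop} (e : V ≃ V) (hE : ∀ x y, R (e x) (e y) ↔ R x y)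
    {K : ℕ} {p : Ultrafilter V × Ultrafilter V} {A : Set V} (h : Op R K p A) :
    Op R K (p.1.map e, p.2.map e) (e '' A) := by
  refine ⟨h.1.image e hE, fun B hB => ?_⟩
  rw [crs_image e hE]
  have hb : B = e '' (e.symm '' B) := by simp
  rw [hb] at hB ⊢
  rw [crs_image e hE]
  exact h.2 _ (mn_image e hE hB)

theorem op_exists {V : Type} {R : V → V → Prop} (K : ℕ) {p : Ultrafilter V × Ultrafilter V}
    {B : Set V} (hB : (bdr R B).Finite) (hs : Sp p B) (hk : (bdr R B).ncard ≤ K) :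
    ∃ A, Op R K p A ∧ (bdr R A).ncard ≤ K := by
  obtain ⟨A, ⟨hA1, hA2⟩, hA3⟩ := exists_minimalFor_of_wellFoundedLT
    (fun B => (bdr R B).Finite ∧ Sp p B) (fun B => (bdr R B).ncard) ⟨B, hB, hs⟩
  have hmn : Mn R p A := ⟨hA1, hA2, fun B h1 h2 => by
    by_contra hlt
    exact hlt (hA3 ⟨h1, h2⟩ (le_of_not_ge hlt))⟩
  obtain ⟨D, hD1, hD3⟩ := exists_minimalFor_of_wellFoundedLT
    (fun B => Mn R p B) (fun B => (crs R K B).ncard) ⟨A, hmn⟩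
  refine ⟨D, ⟨hD1, fun B h1 => ?_⟩, (hD1.2.2 B hB hs).trans hk⟩
  by_contra hlt
  exact hlt (hD3 h1 (le_of_not_ge hlt))

end Invariance

section Cayley
open scoped Pointwise

/-- Cayley adjacency. -/
def cay {G : Type} [Group G] (S : Set G) (x y : G) : Prop := x⁻¹ * y ∈ S

theorem cay_symm {G : Type} [Group G] {S : Set G} (hS : S⁻¹ = S) : Symmetric (cay S) := by
  intro x y h
  have : (x⁻¹ * y)⁻¹ ∈ S⁻¹ := Set.inv_mem_inv.2 h
  rw [hS] at this
  simpa [cay] using this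

theorem cay_cn {G : Type} [Group G] {S : Set G} (hS : S⁻¹ = S) (hg : Subgroup.closure S = ⊤) :
    Cn (cay S) Set.univ := by
  intro B _ hne hcl
  obtain ⟨b, hb⟩ := hne
  have key : ∀ g ∈ Subgroup.closure S, ∀ x, x ∈ B ↔ x * g ∈ B := by
    intro g hg
    induction hg using Subgroup.closure_induction with
    | mem g hg =>
      intro x
      refine ⟨fun h => hcl x h _ trivial (by simpa [cay] using hg), fun h => ?_⟩
      refine hcl _ h _ trivial ?_
      rw [← hS]
      simpa [cay] using hg
    | one => simp
    | mul g h _ _ h1 h2 => intro x; rw [h1, h2, mul_assoc]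
    | inv g _ h1 => intro x; rw [h1 (x * g⁻¹)]; simp
  ext x
  simp only [Set.mem_univ, iff_true]
  have := (key (b⁻¹ * x) (by rw [hg]; trivial) b).1 hb
  simpa using this

theorem cay_left {G : Type} [Group G] (S : Set G) (g : G) (x y : G) :
    cay S (Equiv.mulLeft g x) (Equiv.mulLeft g y) ↔ cay S x y := by
  simp [cay, mul_assoc]

theorem smul_eq_image {G : Type} [Group G] (g : G) (A : Set G) :
    g • A = Equiv.mulLeft g '' A := rfl

/-- The invariant nested family of optimal cuts. -/
def cutFam {G : Type} [Group G] (S : Set G) (hS : S⁻¹ = S) (hg : Subgroup.closure S = ⊤) (K : ℕ) :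
    Fam G where
  c := {A | (bdr (cay S) A).ncard ≤ K ∧ ∃ p, Op (cay S) K p A}
  compl := by
    rintro A ⟨h1, p, h2⟩
    exact ⟨(bdr_compl_ncard (cay_symm hS) A).trans_le h1, p, h2.compl (cay_symm hS)⟩
  inv := by
    rintro g A ⟨h1, p, h2⟩
    rw [smul_eq_image]
    exact ⟨(bdr_image_ncard _ (cay_left S g)).trans_le h1, _, h2.image _ (cay_left S g)⟩
  nst := by
    rintro A ⟨h1, p, h2⟩ B ⟨h3, q, h4⟩
    exact op_nested (cay_symm hS) (cay_cn hS hg) h2 h4 h1 h3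
  ne := by
    rintro A ⟨h1, p, h2⟩
    rw [Set.nonempty_iff_ne_empty]
    rintro rfl
    exact h2.1.2.1 (by simp)
  fin := by
    intro x y
    refine (tight_finite K _ (cay_symm hS) x y).subset ?_
    rintro A ⟨⟨h1, p, h2⟩, hx, hy⟩
    exact ⟨hx, hy, h2.1.tg (cay_symm hS) (cay_cn hS hg) h1⟩

/-- Almost invariance under right multiplication. -/
def AI {G : Type} [Group G] (A : Set G) (s : G) : Prop := {x | ¬ (x ∈ A ↔ x * s ∈ A)}.Finite

theorem AI.one {G : Type} [Group G] (A : Set G) : AI A 1 := by simp [AI]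

theorem AI.mul {G : Type} [Group G] {A : Set G} {s t : G} (hs : AI A s) (ht : AI A t) :
    AI A (s * t) := by
  refine (hs.union (ht.preimage (f := fun x => x * s) (mul_left_injective s).injOn)).subset ?_
  intro x hx
  simp only [Set.mem_union, Set.mem_setOf_eq, Set.mem_preimage, ← mul_assoc] at *
  tauto

theorem AI.inv {G : Type} [Group G] {A : Set G} {s : G} (hs : AI A s) : AI A s⁻¹ := by
  refine (hs.preimage (f := fun x => x * s⁻¹) (mul_left_injective _).injOn).subset ?_
  intro x hx
  simp only [Set.mem_setOf_eq, Set.mem_preimage, inv_mul_cancel_right] at *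
  tauto

theorem AI.closure {G : Type} [Group G] {A : Set G} {S : Set G} (h : ∀ s ∈ S, AI A s)
    {g : G} (hg : g ∈ Subgroup.closure S) : AI A g := by
  induction hg using Subgroup.closure_induction with
  | mem g hg => exact h g hg
  | one => exact AI.one A
  | mul g h _ _ h1 h2 => exact h1.mul h2
  | inv g _ h1 => exact h1.inv

theorem AI.smul {G : Type} [Group G] {A : Set G} {s : G} (hs : AI A s) (g : G) : AI (g • A) s := by
  refine (hs.preimage (f := fun x => g⁻¹ * x) (mul_right_injective _).injOn).subset ?_
  intro x hx
  simpa only [Set.mem_setOf_eq, Set.mem_preimage, Set.mem_smul_set_iff_inv_smul_mem, smul_eq_mul,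
    mul_assoc] using hx

theorem bdr_fin_of_ai {G : Type} [Group G] {A : Set G} {S : Set G} (hf : S.Finite)
    (h : ∀ s ∈ S, AI A s) : (bdr (cay S) A).Finite := by
  have : (⋃ s ∈ S, (fun x => (x, x * s)) '' {x | ¬ (x ∈ A ↔ x * s ∈ A)}).Finite :=
    hf.biUnion fun s hs => (h s hs).image _
  refine this.subset ?_
  rintro ⟨x, y⟩ ⟨h1, h2, h3⟩
  simp only [Set.mem_iUnion]
  refine ⟨x⁻¹ * y, h3, x, ?_, by simp⟩
  simp only [Set.mem_setOf_eq, mul_inv_cancel_left]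
  exact fun h => h2 (h.1 h1)

theorem ai_of_bdr_fin {G : Type} [Group G] {A : Set G} {S : Set G} (hS : S⁻¹ = S)
    (h : (bdr (cay S) A).Finite) : ∀ s ∈ S, AI A s := by
  intro s hs
  refine ((h.image Prod.fst).union (h.image Prod.snd)).subset ?_
  intro x hx
  by_cases hxA : x ∈ A
  · left
    refine ⟨(x, x * s), ⟨hxA, fun h => hx (by tauto), by simpa [cay] using hs⟩, rfl⟩
  · right
    refine ⟨(x * s, x), ⟨by_contra fun h => hx (by tauto), hxA, ?_⟩, rfl⟩
    have : s⁻¹ ∈ S⁻¹ := Set.inv_mem_inv.2 hs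
    rw [hS] at this
    simpa [cay] using this

/-- Powers eventually are on a fixed side. -/
theorem AI.eventually {G : Type} [Group G] {A : Set G} {γ : G} (h : AI A γ)
    (hinj : Function.Injective (fun i : ℕ => γ ^ i)) :
    ∃ N, (∀ i ≥ N, γ ^ i ∈ A) ∨ (∀ i ≥ N, γ ^ i ∉ A) := by
  have hf : {i : ℕ | ¬ (γ ^ i ∈ A ↔ γ ^ (i + 1) ∈ A)}.Finite := by
    refine (Set.Finite.preimage (f := fun i : ℕ => γ ^ i) hinj.injOn h).subset ?_
    intro i hi
    simpa [pow_succ] using hi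
  obtain ⟨N, hN⟩ := hf.bddAbove
  refine ⟨N + 1, ?_⟩
  have key : ∀ i ≥ N + 1, (γ ^ i ∈ A ↔ γ ^ (N + 1) ∈ A) := by
    intro i hi
    induction i, hi using Nat.le_induction with
    | base => rfl
    | succ i hi ih =>
      rw [← ih]
      by_contra hc
      have := hN (a := i) (fun h => hc h.symm)
      omega
  by_cases hc : γ ^ (N + 1) ∈ A
  · left; intro i hi; exact (key i hi).2 hc
  · right; intro i hi h; exact hc ((key i hi).1 h)

/-- The ultrafilter of large powers. -/
noncomputable def powU {G : Type} [Group G] (γ : G) : Ultrafilter G :=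
  (Filter.hyperfilter ℕ).map fun i => γ ^ i

theorem powU_mem {G : Type} [Group G] {γ : G} {A : Set G} (N : ℕ) (h : ∀ i ≥ N, γ ^ i ∈ A) :
    A ∈ powU γ := by
  refine Ultrafilter.mem_map.2 ?_
  exact Nat.hyperfilter_le_atTop (Filter.mem_atTop_sets.2 ⟨N, h⟩)

theorem powU_not_mem {G : Type} [Group G] {γ : G} {A : Set G} (N : ℕ) (h : ∀ i ≥ N, γ ^ i ∉ A) :
    A ∉ powU γ := by
  rw [← Ultrafilter.compl_mem_iff_notMem]
  exact powU_mem N h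

theorem cutFam_sep {G : Type} [Group G] (S : Set G) (hS : S⁻¹ = S)
    (hg : Subgroup.closure S = ⊤) (K : ℕ) (γ : G)
    (hinj : Function.Injective (fun i : ℕ => γ ^ i)) (B : Set G) (hB : (bdr (cay S) B).Finite)
    (hk : (bdr (cay S) B).ncard ≤ K) (N : ℕ) (h1 : ∀ i ≥ N, γ ^ i ∈ B)
    (h2 : ∀ i ≥ N, γ⁻¹ ^ i ∉ B) :
    ∃ A ∈ (cutFam S hS hg K).c, γ • A ⊂ A ∨ A ⊂ γ • A := by
  have hinj' : Function.Injective (fun i : ℕ => γ⁻¹ ^ i) := by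
    intro i j hij
    apply hinj
    simpa using hij
  obtain ⟨A, hA, hkA⟩ := op_exists K (p := (powU γ, powU γ⁻¹)) hB
    (fun h => powU_not_mem N h2 (h.1 (powU_mem N h1))) hk
  have hai : AI A γ :=
    AI.closure (ai_of_bdr_fin hS hA.1.1) (by rw [hg]; trivial)
  have hsp := hA.1.2.1
  -- choose the side
  have key : ∃ A ∈ (cutFam S hS hg K).c, ∃ M, (∀ i ≥ M, γ ^ i ∈ A) ∧ (∀ i ≥ M, γ⁻¹ ^ i ∉ A) := by
    have hAc : A ∈ (cutFam S hS hg K).c := ⟨hkA, _, hA⟩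
    obtain ⟨M1, hM1⟩ := hai.eventually hinj
    obtain ⟨M2, hM2⟩ := hai.inv.eventually hinj'
    rcases hM1 with hM1 | hM1 <;> rcases hM2 with hM2 | hM2
    · exact absurd (iff_of_true (powU_mem M1 hM1) (powU_mem M2 hM2)) hsp
    · exact ⟨A, hAc, max M1 M2, fun i hi => hM1 i (le_of_max_le_left hi),
        fun i hi => hM2 i (le_of_max_le_right hi)⟩
    · refine ⟨Aᶜ, Fam.compl _ A hAc, max M1 M2, fun i hi => hM1 i (le_of_max_le_left hi),
        fun i hi h => h (hM2 i (le_of_max_le_right hi))⟩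
    · exact absurd (iff_of_false (powU_not_mem M1 hM1) (powU_not_mem M2 hM2)) hsp
  obtain ⟨A, hA, M, m1, m2⟩ := key
  refine ⟨A, hA, ?_⟩
  have mg : ∀ x, x ∈ γ • A ↔ γ⁻¹ * x ∈ A := fun x => Set.mem_smul_set_iff_inv_smul_mem
  have e1 : γ ^ (M + 1) ∈ γ • A := by
    rw [mg, pow_succ', inv_mul_cancel_left]; exact m1 M le_rfl
  have e2 : γ⁻¹ ^ M ∉ γ • A := by
    rw [mg, ← pow_succ']; exact m2 _ (by omega)
  have hne : γ • A ≠ A := by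
    intro h
    have : ∀ i : ℕ, ∀ x ∈ A, γ⁻¹ ^ i * x ∈ A := by
      intro i
      induction i with
      | zero => simp
      | succ i ih =>
        intro x hx
        rw [← h, mg] at hx
        rw [pow_succ, mul_assoc]
        exact ih _ hx
    have := this (M + M) _ (m1 M le_rfl)
    rw [pow_add, mul_assoc, inv_pow, inv_mul_cancel, mul_one, ← inv_pow] at this
    exact m2 M le_rfl this
  rcases (cutFam S hS hg K).nst _ ((cutFam S hS hg K).inv γ A hA) A hA with h | h | h | h
  · exact .inl (h.ssubset_of_ne hne)
  · exact absurd (m1 _ (by omega)) (h e1)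
  · exact absurd (h e2) (m2 M le_rfl)
  · exact .inr ((Set.compl_subset_compl.1 h).ssubset_of_ne (Ne.symm hne))

end Cayley

section FreeHalf
open scoped Pointwise

/-- Half trees in a free group. -/
def hft {n : ℕ} (l : Fin n × Bool) : Set (FreeGroup (Fin n)) :=
  {z | (z⁻¹).toWord.getLast? = some l}

theorem getLast_of_mul {n : ℕ} (a : Fin n) (z : FreeGroup (Fin n)) (h1 : z ≠ 1)
    (h2 : z ≠ (FreeGroup.of a)⁻¹) :
    (FreeGroup.of a * z).toWord.getLast? = z.toWord.getLast? := by
  rw [FreeGroup.toWord_mul, FreeGroup.toWord_of, List.singleton_append, FreeGroup.reduce.cons,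
    FreeGroup.reduce_toWord]
  have h1' : z.toWord ≠ [] := by simpa using h1
  have h2' : z.toWord ≠ [(a, false)] := by
    intro h
    apply h2
    rw [← FreeGroup.toWord_inj, h]
    simp [FreeGroup.invRev]
  generalize z.toWord = w at *
  match w with
  | [] => exact absurd rfl h1'
  | [hd] =>
    have : ¬ (a = hd.1 ∧ true = !hd.2) := by
      rintro ⟨h, h'⟩
      apply h2'
      rw [Prod.ext_iff.2 (show hd.1 = (a, false).1 ∧ hd.2 = (a, false).2 from ⟨h.symm, by simpa using h'⟩)]
    simp only [if_neg this]
    simp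
  | hd :: b :: tl =>
    simp only
    split_ifs <;> simp

theorem hft_ai_of {n : ℕ} (l : Fin n × Bool) (a : Fin n) : AI (hft l) (FreeGroup.of a) := by
  have : AI (hft l) (FreeGroup.of a)⁻¹ := by
    refine (Set.toFinite {1, FreeGroup.of a}).subset ?_
    intro x hx
    by_contra hc
    simp only [Set.mem_insert_iff, Set.mem_singleton_iff, not_or] at hc
    apply hx
    simp only [hft, Set.mem_setOf_eq, mul_inv_rev, inv_inv]
    rw [getLast_of_mul a x⁻¹ (by simpa using hc.1) (by simpa using hc.2)]
  simpa using this.inv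

theorem hft_ai {n : ℕ} (l : Fin n × Bool) (f : FreeGroup (Fin n)) : AI (hft l) f := by
  induction f using FreeGroup.induction_on with
  | C1 => exact AI.one _
  | of a => exact hft_ai_of l a
  | inv_of a h => exact (hft_ai_of l a).inv
  | mul x y hx hy => exact hx.mul hy

theorem free_pow_inj {n : ℕ} {g : FreeGroup (Fin n)} (hg : g ≠ 1) :
    Function.Injective (fun i : ℕ => g ^ i) := IsMulTorsionFree.pow_right_injective hg

theorem hft_cyc {n : ℕ} (g : FreeGroup (Fin n)) (hg : g ≠ 1) :
    ∃ (u g0 : FreeGroup (Fin n)) (l : Fin n × Bool), g = u * g0 * u⁻¹ ∧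
      ∀ i ≥ 1, g0 ^ i ∈ hft l ∧ g0⁻¹ ^ i ∉ hft l := by
  set L := FreeGroup.reduceCyclically g.toWord with hL
  have hc : FreeGroup.IsCyclicallyReduced L :=
    FreeGroup.reduceCyclically.isCyclicallyReduced FreeGroup.isReduced_toWord
  have hgu : g = FreeGroup.mk (FreeGroup.reduceCyclically.conjugator g.toWord) * FreeGroup.mk L *
      (FreeGroup.mk (FreeGroup.reduceCyclically.conjugator g.toWord))⁻¹ := by
    rw [FreeGroup.inv_mk, FreeGroup.mul_mk, FreeGroup.mul_mk,
      FreeGroup.reduceCyclically.conj_conjugator_reduceCyclically, FreeGroup.mk_toWord]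
  have hne : L ≠ [] := by
    intro h
    rw [h] at hgu
    apply hg
    rw [hgu]
    rw [← FreeGroup.one_eq_mk]; group
  have hw : ∀ i : ℕ, (FreeGroup.mk L ^ i).toWord = (List.replicate i L).flatten := by
    intro i
    rw [FreeGroup.pow_mk, FreeGroup.toWord_mk]
    exact (hc.flatten_replicate i).isReduced.reduce_eq
  obtain ⟨h, hh⟩ : ∃ h, L.head? = some h := by
    cases hL2 : L with
    | nil => exact absurd hL2 hne
    | cons a t => exact ⟨a, rfl⟩
  refine ⟨_, FreeGroup.mk L, (h.1, !h.2), hgu, fun i hi => ⟨?_, ?_⟩⟩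
  · simp only [hft, Set.mem_setOf_eq, FreeGroup.toWord_inv, hw, FreeGroup.invRev,
      List.getLast?_reverse, List.head?_map]
    rw [List.head?_flatten_replicate (by omega), hh]
    rfl
  · simp only [hft, Set.mem_setOf_eq, inv_pow, inv_inv, hw]
    rw [List.getLast?_flatten_replicate (by omega)]
    intro hl
    have := hc.2 _ hl _ hh rfl
    simp at this

theorem hft_sep {n : ℕ} (g : FreeGroup (Fin n)) (hg : g ≠ 1) :
    ∃ (u : FreeGroup (Fin n)) (l : Fin n × Bool) (N : ℕ),
      (∀ i ≥ N, g ^ i ∈ u • hft l) ∧ ∀ i ≥ N, g⁻¹ ^ i ∉ u • hft l := by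
  obtain ⟨u, g0, l, hu, h⟩ := hft_cyc g hg
  have hg0 : g0 ≠ 1 := by rintro rfl; simp at hu; exact hg hu
  have key : ∀ k : FreeGroup (Fin n), k ≠ 1 →
      ∃ N, ∀ i ≥ N, (k ^ i ∈ hft l ↔ k ^ i * u⁻¹ ∈ hft l) := by
    intro k hk
    have := (hft_ai l u⁻¹).preimage (free_pow_inj hk).injOn
    obtain ⟨N, hN⟩ := this.bddAbove
    refine ⟨N + 1, fun i hi => ?_⟩
    by_contra hc
    have := hN (a := i) hc
    omega
  obtain ⟨N1, hN1⟩ := key g0 hg0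
  obtain ⟨N2, hN2⟩ := key g0⁻¹ (by simpa using hg0)
  have hu' : g⁻¹ = u * g0⁻¹ * u⁻¹ := by rw [hu]; group
  refine ⟨u, l, N1 + N2 + 1, fun i hi => ?_, fun i hi => ?_⟩
  · rw [Set.mem_smul_set_iff_inv_smul_mem, hu, conj_pow, smul_eq_mul, mul_assoc,
      inv_mul_cancel_left, ← hN1 i (by omega)]
    exact (h i (by omega)).1
  · rw [Set.mem_smul_set_iff_inv_smul_mem, hu', conj_pow, smul_eq_mul, mul_assoc,
      inv_mul_cancel_left, ← hN2 i (by omega)]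
    exact (h i (by omega)).2

end FreeHalf

section Induced
open scoped Pointwise

/-- The induced subset. -/
def indS {G : Type} [Group G] {n : ℕ} (ι : FreeGroup (Fin n) →* G) (σ : G)
    (H : Set (FreeGroup (Fin n))) : Set G :=
  {x | ∃ h ∈ H, x = ι h ∨ x = ι h * σ}

theorem mem_indS {G : Type} [Group G] {n : ℕ} {ι : FreeGroup (Fin n) →* G}
    (hι : Function.Injective ι) {σ : G} (hσ : σ ∉ ι.range) {H : Set (FreeGroup (Fin n))}
    (z : FreeGroup (Fin n)) : ι z ∈ indS ι σ H ↔ z ∈ H := by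
  constructor
  · rintro ⟨h, hh, e | e⟩
    · rwa [hι e]
    · exact absurd ⟨h⁻¹ * z, by rw [map_mul, e]; simp⟩ hσ
  · intro h
    exact ⟨z, h, .inl rfl⟩

theorem mem_indS' {G : Type} [Group G] {n : ℕ} {ι : FreeGroup (Fin n) →* G}
    (hι : Function.Injective ι) {σ : G} (hσ : σ ∉ ι.range) {H : Set (FreeGroup (Fin n))}
    (z : FreeGroup (Fin n)) : ι z * σ ∈ indS ι σ H ↔ z ∈ H := by
  constructor
  · rintro ⟨h, hh, e | e⟩
    · exact absurd ⟨z⁻¹ * h, by rw [map_mul, ← e]; simp⟩ hσ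
    · rwa [hι (mul_right_cancel e)]
  · intro h
    exact ⟨z, h, .inr rfl⟩

theorem smul_indS {G : Type} [Group G] {n : ℕ} (ι : FreeGroup (Fin n) →* G)
    (σ : G) (H : Set (FreeGroup (Fin n))) (u : FreeGroup (Fin n)) :
    ι u • indS ι σ H = indS ι σ (u • H) := by
  ext x
  constructor
  · rintro ⟨y, ⟨h, hh, e | e⟩, rfl⟩
    · exact ⟨u * h, ⟨h, hh, rfl⟩, .inl (by simp [e])⟩
    · exact ⟨u * h, ⟨h, hh, rfl⟩, .inr (by simp [e, mul_assoc])⟩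
  · rintro ⟨_, ⟨h, hh, rfl⟩, e | e⟩
    · exact ⟨ι h, ⟨h, hh, .inl rfl⟩, by simp [e]⟩
    · exact ⟨ι h * σ, ⟨h, hh, .inr rfl⟩, by simp [e, mul_assoc]⟩

theorem two_cosets {G : Type} [Group G] {n : ℕ} {ι : FreeGroup (Fin n) →* G}
    (hF : ι.range.index = 2) {σ : G} (hσ : σ ∉ ι.range) (x : G) :
    (∃ z, x = ι z) ∨ ∃ z, x = ι z * σ := by
  by_cases hx : x ∈ ι.range
  · obtain ⟨z, rfl⟩ := hx; exact .inl ⟨z, rfl⟩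
  · right
    have : x * σ⁻¹ ∈ ι.range := by
      rw [Subgroup.mul_mem_iff_of_index_two hF]
      simp [hx, hσ]
    obtain ⟨z, hz⟩ := this
    exact ⟨z, by rw [hz]; simp⟩

theorem indS_ai {G : Type} [Group G] {n : ℕ} {ι : FreeGroup (Fin n) →* G}
    (hι : Function.Injective ι) (hF : ι.range.index = 2) {σ : G} (hσ : σ ∉ ι.range)
    {H : Set (FreeGroup (Fin n))} (hH : ∀ f, AI H f) (f : FreeGroup (Fin n)) :
    AI (indS ι σ H) (ι f) := by
  have hn : ι.range.Normal := Subgroup.normal_of_index_eq_two hF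
  obtain ⟨f', hf'⟩ := hn.conj_mem (ι f) ⟨f, rfl⟩ σ
  refine (((hH f).image ι).union ((hH f').image fun z => ι z * σ)).subset ?_
  intro x hx
  rcases two_cosets hF hσ x with ⟨z, rfl⟩ | ⟨z, rfl⟩
  · left
    refine ⟨z, ?_, rfl⟩
    rwa [Set.mem_setOf_eq, ← map_mul, mem_indS hι hσ, mem_indS hι hσ] at hx
  · right
    refine ⟨z, ?_, rfl⟩
    have : ι z * σ * ι f = ι (z * f') * σ := by
      rw [map_mul, hf']; group
    rwa [Set.mem_setOf_eq, this, mem_indS' hι hσ, mem_indS' hι hσ] at hx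

theorem indS_ai' {G : Type} [Group G] {n : ℕ} {ι : FreeGroup (Fin n) →* G}
    (hι : Function.Injective ι) (hF : ι.range.index = 2) {σ : G} (hσ : σ ∉ ι.range)
    {H : Set (FreeGroup (Fin n))} (hH : ∀ f, AI H f) :
    AI (indS ι σ H) σ := by
  obtain ⟨f', hf'⟩ : σ * σ ∈ ι.range := by
    rw [Subgroup.mul_mem_iff_of_index_two hF]
  refine ((hH f').image fun z => ι z * σ).subset ?_
  intro x hx
  rcases two_cosets hF hσ x with ⟨z, rfl⟩ | ⟨z, rfl⟩
  · rw [Set.mem_setOf_eq, mem_indS hι hσ, mem_indS' hι hσ] at hx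
    exact absurd Iff.rfl hx
  · refine ⟨z, ?_, rfl⟩
    have : ι z * σ * σ = ι (z * f') := by
      rw [map_mul, hf']; group
    rwa [Set.mem_setOf_eq, this, mem_indS' hι hσ, mem_indS hι hσ] at hx

theorem fam_exists {G : Type} [Group G] {n : ℕ} (ι : FreeGroup (Fin n) →* G)
    (hι : Function.Injective ι) (hF : ι.range.index = 2) :
    ∃ C : Fam G, ∀ g ∈ ι.range, g ≠ 1 → ∃ A ∈ C.c, g • A ⊂ A ∨ A ⊂ g • A := by
  obtain ⟨σ, hσ⟩ : ∃ σ, σ ∉ ι.range := by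
    by_contra! h
    rw [(Subgroup.eq_top_iff' _).2 h] at hF
    simp at hF
  set T : Set G := insert σ (Set.range fun i => ι (FreeGroup.of i)) with hT
  set S : Set G := T ∪ T⁻¹ with hSd
  have hTf : T.Finite := (Set.finite_range _).insert _
  have hSf : S.Finite := hTf.union hTf.inv
  have hS : S⁻¹ = S := by rw [hSd, Set.union_inv, inv_inv, Set.union_comm]
  have hTS : T ⊆ S := Set.subset_union_left
  have hfr : ι.range ≤ Subgroup.closure S := by
    rintro _ ⟨f, rfl⟩
    induction f using FreeGroup.induction_on with
    | C1 => simp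
    | of a => exact Subgroup.subset_closure (hTS (.inr ⟨a, rfl⟩))
    | inv_of a h => rw [map_inv]; exact inv_mem h
    | mul x y hx hy => rw [map_mul]; exact mul_mem hx hy
  have hg : Subgroup.closure S = ⊤ := by
    rw [Subgroup.eq_top_iff']
    intro x
    rcases two_cosets hF hσ x with ⟨z, rfl⟩ | ⟨z, rfl⟩
    · exact hfr ⟨z, rfl⟩
    · exact mul_mem (hfr ⟨z, rfl⟩) (Subgroup.subset_closure (hTS (.inl rfl)))
  have hT1 : ∀ l, ∀ s ∈ T, AI (indS ι σ (hft l)) s := by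
    rintro l s (rfl | ⟨a, rfl⟩)
    · exact indS_ai' hι hF hσ (hft_ai l)
    · exact indS_ai hι hF hσ (hft_ai l) _
  have hS1 : ∀ l, ∀ s ∈ S, AI (indS ι σ (hft l)) s := by
    rintro l s (h | h)
    · exact hT1 l s h
    · simpa using (hT1 l _ h).inv
  have hb : ∀ l, (bdr (cay S) (indS ι σ (hft l))).Finite := fun l => bdr_fin_of_ai hSf (hS1 l)
  set K : ℕ := ∑ l, (bdr (cay S) (indS ι σ (hft l))).ncard with hK
  have hbK : ∀ l, (bdr (cay S) (indS ι σ (hft l))).ncard ≤ K := fun l =>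
    Finset.single_le_sum (f := fun l => (bdr (cay S) (indS ι σ (hft l))).ncard)
      (fun _ _ => Nat.zero_le _) (Finset.mem_univ l)
  refine ⟨cutFam S hS hg K, ?_⟩
  rintro _ ⟨g, rfl⟩ hg1
  have hg1' : g ≠ 1 := by rintro rfl; simp at hg1
  obtain ⟨u, l, N, h1, h2⟩ := hft_sep g hg1'
  refine cutFam_sep S hS hg K (ι g) ?_ (ι u • indS ι σ (hft l)) ?_ ?_ N ?_ ?_
  · intro i j hij
    simp only [← map_pow] at hij
    exact free_pow_inj hg1' (hι hij)
  · rw [smul_eq_image, bdr_image_fin _ (cay_left S _)]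
    exact hb l
  · rw [smul_eq_image, bdr_image_ncard _ (cay_left S _)]
    exact hbK l
  · intro i hi
    rw [smul_indS, ← map_pow, mem_indS hι hσ]
    exact h1 i hi
  · intro i hi
    rw [smul_indS, ← map_inv, ← map_pow, mem_indS hι hσ]
    exact h2 i hi

end Induced

section Abs
open scoped Pointwise

theorem main_abs {G : Type} [Group G] {n : ℕ} (hn : 0 < n) (ι : FreeGroup (Fin n) →* G)
    (hι : Function.Injective ι) (hF : ι.range.index = 2)
    (hhom : ∀ f : G →* Multiplicative ℤ, f = 1) :
    ∃ s₀ : G, s₀ ∉ ι.range ∧ s₀ * s₀ = 1 ∧ ∃ x : Fin n → FreeGroup (Fin n),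
      Subgroup.closure (Set.range x) = ⊤ ∧ ∀ i, s₀ * ι (x i) * s₀⁻¹ = (ι (x i))⁻¹ := by
  obtain ⟨C, hC⟩ := fam_exists ι hι hF
  have hne : Nonempty C.W := by
    obtain ⟨A, hA, -⟩ := hC (ι (FreeGroup.of ⟨0, hn⟩)) ⟨_, rfl⟩ (by
      rw [Ne, map_eq_one_iff ι hι]
      exact FreeGroup.of_ne_one _)
    exact ⟨⟨C.mid A, C.isV_mid hA⟩⟩
  have hfree := C.tree_free ι.range fun g hg hg1 => by
    obtain ⟨A, hA, h⟩ := hC g hg hg1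
    exact ⟨A, hA, 1, by simpa using h⟩
  obtain ⟨s₀, hs, hs2, S, x, hx, hconj, d, f, hf1, hf2⟩ := C.tree.main hhom ι.range hF hfree
  let e : FreeGroup (Fin n) ≃* ι.range := MonoidHom.ofInjective hι
  have he : ∀ z, (e z : G) = ι z := fun z => rfl
  obtain ⟨emb⟩ := free_rank n S (fun i => e.symm (x i)) d (fun i => (f i).comp e.toMonoidHom)
    (by intro i; simpa using hf1 i) (by intro i j hij; simpa using hf2 i j hij)
  refine ⟨s₀, hs, hs2, Function.extend emb (fun i => e.symm (x i)) 1, ?_, ?_⟩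
  · have h1 : Subgroup.closure (Set.range fun i => e.symm (x i)) = ⊤ := by
      have : (Set.range fun i => e.symm (x i)) = e.symm.toMonoidHom '' Set.range x := by
        rw [← Set.range_comp]; rfl
      rw [this, ← MonoidHom.map_closure, hx, Subgroup.map_top_of_surjective]
      exact e.symm.surjective
    rw [eq_top_iff, ← h1]
    apply Subgroup.closure_mono
    rintro _ ⟨i, rfl⟩
    exact ⟨emb i, emb.injective.extend_apply _ _ _⟩
  · intro i
    by_cases hi : ∃ j, emb j = i
    · obtain ⟨j, rfl⟩ := hi
      rw [emb.injective.extend_apply, ← he, MulEquiv.apply_symm_apply]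
      exact hconj j
    · rw [Function.extend_apply' _ _ _ hi]
      simp

end Abs

section Final

theorem free_commute {n : ℕ} [Subsingleton (Fin n)] (x y : FreeGroup (Fin n)) : Commute x y := by
  induction x using FreeGroup.induction_on with
  | C1 => exact Commute.one_left _
  | of a =>
    induction y using FreeGroup.induction_on with
    | C1 => exact Commute.one_right _
    | of b => rw [Subsingleton.elim a b]
    | inv_of b h => exact h.inv_right
    | mul x y hx hy => exact hx.mul_right hy
  | inv_of a h => exact h.inv_left
  | mul x y hx hy => exact hx.mul_left hy

theorem ab_of_injective {G : Type} [Group G] (h : ∀ x y : G, x * y = y * x) :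
    Function.Injective (Abelianization.of : G →* Abelianization G) := by
  letI : CommGroup G := { (inferInstance : Group G) with mul_comm := h }
  intro x y hxy
  have := congrArg (Abelianization.lift (MonoidHom.id G)) hxy
  rwa [Abelianization.lift_apply_of, Abelianization.lift_apply_of] at this

theorem abMap_of {G : Type} [Group G] (θ : MulAut G) (x : G) :
    abMap θ (Abelianization.of x) = Abelianization.of (θ x) :=
  Abelianization.lift_apply_of _ _

theorem free_center {n : ℕ} (hn : 2 ≤ n) (z : FreeGroup (Fin n))
    (hz : ∀ y, y * z = z * y) : z = 1 := by
  by_contra hne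
  have hw : z.toWord ≠ [] := by simpa using hne
  obtain ⟨c, hc⟩ : ∃ c : Fin n, c ≠ (z.toWord.head hw).1 := by
    haveI : Nontrivial (Fin n) := Fin.nontrivial_iff_two_le.2 hn
    exact exists_ne _
  obtain ⟨e, he⟩ : ∃ e : Bool, c = (z.toWord.getLast hw).1 → (z.toWord.getLast hw).2 = e :=
    ⟨_, fun _ => rfl⟩
  have hr : FreeGroup.IsReduced z.toWord := FreeGroup.isReduced_toWord
  have r1 : FreeGroup.IsReduced ((c, e) :: z.toWord) := by
    generalize z.toWord = w at *
    cases w with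
    | nil => exact absurd rfl hw
    | cons a t =>
      rw [FreeGroup.isReduced_cons_cons]
      exact ⟨fun h => absurd h hc, hr⟩
  have r2 : FreeGroup.IsReduced (z.toWord ++ [(c, e)]) := by
    refine List.isChain_append.2 ⟨hr, List.isChain_singleton _, ?_⟩
    intro x hx y hy h
    rw [List.getLast?_eq_some_getLast hw] at hx
    simp only [Option.mem_def, Option.some.injEq, List.head?_cons] at hx hy
    subst hx hy
    exact he h.symm
  have h := congrArg FreeGroup.toWord (hz (FreeGroup.mk [(c, e)]))
  rw [FreeGroup.toWord_mul, FreeGroup.toWord_mul, FreeGroup.toWord_mk] at h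
  have h1 : FreeGroup.reduce [(c, e)] = [(c, e)] :=
    FreeGroup.IsReduced.reduce_eq (List.isChain_singleton _)
  rw [h1, List.singleton_append, r1.reduce_eq, r2.reduce_eq] at h
  have h2 := congrArg List.head? h
  rw [List.head?_append_of_ne_nil _ hw, List.head?_cons, List.head?_eq_some_head hw] at h2
  apply hc
  rw [← Option.some.inj h2]

theorem free_conj_inj {n : ℕ} (hn : 2 ≤ n) :
    Function.Injective (MulAut.conj : FreeGroup (Fin n) →* MulAut (FreeGroup (Fin n))) := by
  rw [injective_iff_map_eq_one]
  intro z hz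
  refine free_center hn z fun y => ?_
  have := DFunLike.congr_fun hz y
  rw [MulAut.conj_apply, MulAut.one_apply, mul_inv_eq_iff_eq_mul] at this
  exact this.symm

theorem toOut_eq_one {G : Type} [Group G] (θ : MulAut G) :
    toOut G θ = 1 ↔ ∃ g, MulAut.conj g = θ :=
  QuotientGroup.eq_one_iff θ

theorem multZ_sq {a : Multiplicative ℤ} (h : a * a = 1) : a = 1 := by
  have h' : Multiplicative.toAdd a + Multiplicative.toAdd a = 0 := congrArg Multiplicative.toAdd h
  have : Multiplicative.toAdd a = 0 := by omega
  exact this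

theorem std_form {n : ℕ} (hn : 2 ≤ n) (φ : MulAut (FreeGroup (Fin n)))
    (hab : ∀ a : Abelianization (FreeGroup (Fin n)), abMap φ a = a⁻¹)
    (h2 : toOut _ φ ^ 2 = 1) (h1 : toOut _ φ ≠ 1) :
    ∃ θ α : MulAut (FreeGroup (Fin n)), toOut _ θ = toOut _ φ ∧
      ∀ i, θ (α (FreeGroup.of i)) = (α (FreeGroup.of i))⁻¹ := by
  set P : Subgroup (MulAut (FreeGroup (Fin n))) :=
    (Subgroup.zpowers (toOut _ φ)).comap (toOut _) with hP
  have hPm : ∀ θ, θ ∈ P ↔ (toOut _ θ = 1 ∨ toOut _ θ = toOut _ φ) := by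
    intro θ
    rw [hP, Subgroup.mem_comap, Subgroup.mem_zpowers_iff]
    constructor
    · rintro ⟨k, hk⟩
      rcases Int.even_or_odd' k with ⟨m, rfl | rfl⟩
      · left; rw [← hk, zpow_mul]
        have : toOut _ φ ^ (2 : ℤ) = 1 := by exact_mod_cast h2
        rw [this, one_zpow]
      · right; rw [← hk, zpow_add, zpow_mul]
        have : toOut _ φ ^ (2 : ℤ) = 1 := by exact_mod_cast h2
        rw [this, one_zpow, one_mul, zpow_one]
    · rintro (h | h)
      · exact ⟨0, by rw [h, zpow_zero]⟩
      · exact ⟨1, by rw [h, zpow_one]⟩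
  have hc1 : ∀ x, toOut _ (MulAut.conj x : MulAut (FreeGroup (Fin n))) = 1 :=
    fun x => (toOut_eq_one _).2 ⟨x, rfl⟩
  let ι : FreeGroup (Fin n) →* P := MulAut.conj.codRestrict P fun x => (hPm _).2 (.inl (hc1 x))
  have hιc : ∀ x, ((ι x : P) : MulAut (FreeGroup (Fin n))) = MulAut.conj x := fun x => rfl
  have hι : Function.Injective ι := by
    intro x y hxy
    exact free_conj_inj hn (by rw [← hιc, ← hιc, hxy])
  have hmem : ∀ g : P, g ∈ ι.range ↔ toOut _ (g : MulAut (FreeGroup (Fin n))) = 1 := by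
    intro g
    rw [toOut_eq_one]
    constructor
    · rintro ⟨x, rfl⟩; exact ⟨x, rfl⟩
    · rintro ⟨x, hx⟩; exact ⟨x, Subtype.ext hx⟩
  let φ' : P := ⟨φ, (hPm φ).2 (.inr rfl)⟩
  have hidx : ι.range.index = 2 := by
    rw [Subgroup.index_eq_two_iff]
    refine ⟨φ', fun b => ?_⟩
    rw [hmem, hmem, Subgroup.coe_mul, map_mul]
    change Xor (toOut _ (b : MulAut (FreeGroup (Fin n))) * toOut _ φ = 1) _
    rcases (hPm b).1 b.2 with h | h
    · right; exact ⟨h, by rw [h, one_mul]; exact h1⟩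
    · left; rw [h]; exact ⟨by rw [← pow_two]; exact h2, h1⟩
  have hconj : ∀ (g : P) x, g * ι x * g⁻¹ = ι ((g : MulAut (FreeGroup (Fin n))) x) := by
    intro g x
    apply Subtype.ext
    rw [hιc, Subgroup.coe_mul, Subgroup.coe_mul, hιc, Subgroup.coe_inv]
    ext y
    simp
  have hhom : ∀ f : P →* Multiplicative ℤ, f = 1 := by
    intro f
    have hx : ∀ x, f (ι x) = 1 := by
      intro x
      apply multZ_sq
      have e1 : f (ι (φ x)) = f (ι x) := by
        rw [← hconj φ' x, map_mul, map_mul, map_inv, mul_comm, inv_mul_cancel_left]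
      have e2 : f (ι (φ x)) = (f (ι x))⁻¹ := by
        have := congrArg (Abelianization.lift (f.comp ι)) (hab (Abelianization.of x))
        rw [abMap_of, map_inv, Abelianization.lift_apply_of, Abelianization.lift_apply_of] at this
        exact this
      rw [e1] at e2
      nth_rewrite 1 [e2]
      exact inv_mul_cancel _
    ext1 g
    rw [MonoidHom.one_apply]
    apply multZ_sq
    rw [← map_mul]
    obtain ⟨x, hxg⟩ : g * g ∈ ι.range := by rw [Subgroup.mul_mem_iff_of_index_two hidx]
    rw [← hxg, hx]
  obtain ⟨s, hs, hs2, x, hx, hxs⟩ := main_abs (by omega) ι hι hidx hhom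
  have hsurj : Function.Surjective (FreeGroup.lift x) := by
    rw [← MonoidHom.range_eq_top, FreeGroup.range_lift_eq_closure]
    exact hx
  let α : MulAut (FreeGroup (Fin n)) :=
    MulEquiv.ofBijective (FreeGroup.lift x) ⟨free_hopf _ hsurj, hsurj⟩
  refine ⟨s, α, ?_, fun i => ?_⟩
  · rcases (hPm s).1 s.2 with h | h
    · exact absurd ((hmem s).2 h) hs
    · exact h
  · have ha : α (FreeGroup.of i) = x i := FreeGroup.lift_apply_of
    rw [ha]
    apply hι
    rw [← hconj, hxs, map_inv]

end Final

/-- Any two hyperelliptic involutions in `Out(Fₙ)` are conjugate.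
A hyperelliptic involution is an outer automorphism of order 2 inducing `−I` on the
abelianization `H₁(Fₙ) ≅ ℤⁿ` (i.e. inverting every element of the abelianization;
this property is independent of the representative automorphism, since inner
automorphisms act trivially on homology). -/
theorem hyperelliptic_involutions_conjugate (n : ℕ)
    (φ ψ : MulAut (FreeGroup (Fin n)))
    (hφab : ∀ a : Abelianization (FreeGroup (Fin n)), abMap φ a = a⁻¹)
    (hψab : ∀ a : Abelianization (FreeGroup (Fin n)), abMap ψ a = a⁻¹)
    (hφ2 : toOut _ φ ^ 2 = 1) (hψ2 : toOut _ ψ ^ 2 = 1)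
    (hφ1 : toOut _ φ ≠ 1) (hψ1 : toOut _ ψ ≠ 1) :
    IsConj (toOut _ φ) (toOut _ ψ) := by
  by_cases hn : 2 ≤ n
  · obtain ⟨θ, α, h1, h2⟩ := std_form hn φ hφab hφ2 hφ1
    obtain ⟨θ', α', h1', h2'⟩ := std_form hn ψ hψab hψ2 hψ1
    rw [← h1, ← h1', isConj_iff]
    refine ⟨toOut _ (α' * α⁻¹), ?_⟩
    rw [← map_inv, ← map_mul, ← map_mul]
    congr 1
    rw [mul_inv_eq_iff_eq_mul]
    have : α⁻¹ * θ * α = α'⁻¹ * θ' * α' := by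
      apply MulEquiv.toMonoidHom_injective
      ext i
      simp [MulAut.mul_apply, h2, h2']
    calc α' * α⁻¹ * θ = α' * (α⁻¹ * θ * α) * α⁻¹ := by group
      _ = θ' * (α' * α⁻¹) := by rw [this]; group
  · haveI : Subsingleton (Fin n) := Fin.subsingleton_iff_le_one.2 (by omega)
    have : φ = ψ := by
      ext x
      apply ab_of_injective (fun x y => (free_commute x y).eq)
      rw [← abMap_of, ← abMap_of, hφab, hψab]
    rw [this]
end

section
/- The Torelli subgroup of Out(F_n), i.e. the kernel of the natural surjection Out(F_n) → GL_n(ℤ), is torsion-free. -/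
set_option linter.unusedSectionVars false
set_option linter.unusedTactic false

namespace Torelli

/-- Noncommutative formal power series with rational coefficients. -/
def NC (α : Type) := List α → ℚ

variable {α : Type}

instance : AddCommGroup (NC α) := inferInstanceAs (AddCommGroup (List α → ℚ))
noncomputable instance : Module ℚ (NC α) := inferInstanceAs (Module ℚ (List α → ℚ))

@[ext] theorem NC.ext {f g : NC α} (h : ∀ l : List α, f l = g l) : f = g := funext h

/-- Auxiliary recursive convolution product. -/
def mulAux : List α → NC α → NC α → ℚ
  | [], f, g => f [] * g []
  | a :: l, f, g => f [] * g (a :: l) + mulAux l (fun t => f (a :: t)) g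

/-- Brzozowski derivative. -/
def D (a : α) (f : NC α) : NC α := fun t => f (a :: t)

instance : Mul (NC α) := ⟨fun f g l => mulAux l f g⟩
instance : One (NC α) := ⟨fun l => match l with | [] => 1 | _ :: _ => 0⟩

@[simp] theorem add_app (f g : NC α) (l : List α) : (f + g) l = f l + g l := rfl
@[simp] theorem sub_app (f g : NC α) (l : List α) : (f - g) l = f l - g l := rfl
@[simp] theorem neg_app (f : NC α) (l : List α) : (-f) l = - f l := rfl
@[simp] theorem zero_app (l : List α) : (0 : NC α) l = 0 := rfl
@[simp] theorem smul_app (c : ℚ) (f : NC α) (l : List α) : (c • f) l = c * f l := rfl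
@[simp] theorem one_nil : (1 : NC α) [] = 1 := rfl
@[simp] theorem one_cons (a : α) (l : List α) : (1 : NC α) (a :: l) = 0 := rfl
@[simp] theorem mul_nil (f g : NC α) : (f * g) [] = f [] * g [] := rfl
theorem mul_cons (f g : NC α) (a : α) (l : List α) :
    (f * g) (a :: l) = f [] * g (a :: l) + (D a f * g) l := rfl
theorem D_app (a : α) (f : NC α) (l : List α) : D a f l = f (a :: l) := rfl
theorem D_mul (a : α) (f g : NC α) : D a (f * g) = f [] • D a g + D a f * g := rfl
theorem D_add (a : α) (f g : NC α) : D a (f + g) = D a f + D a g := rfl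
theorem D_smul (a : α) (c : ℚ) (g : NC α) : D a (c • g) = c • D a g := rfl
theorem D_one (a : α) : D a (1 : NC α) = 0 := rfl
theorem D_zero (a : α) : D a (0 : NC α) = 0 := rfl

theorem nc_add_mul (f g h : NC α) : (f + g) * h = f * h + g * h := by
  ext l
  induction l generalizing f g with
  | nil => simp [add_mul]
  | cons a l ih => simp only [mul_cons, add_app, D_add, ih]; ring

theorem nc_mul_add (f g h : NC α) : f * (g + h) = f * g + f * h := by
  ext l
  induction l generalizing f with
  | nil => simp [mul_add]
  | cons a l ih => simp only [mul_cons, add_app, ih]; ring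

theorem nc_smul_mul (c : ℚ) (f g : NC α) : (c • f) * g = c • (f * g) := by
  ext l
  induction l generalizing f with
  | nil => simp [mul_assoc]
  | cons a l ih => simp only [mul_cons, smul_app, D_smul, ih]; ring

theorem nc_mul_smul (c : ℚ) (f g : NC α) : f * (c • g) = c • (f * g) := by
  ext l
  induction l generalizing f with
  | nil => simp; ring
  | cons a l ih => simp only [mul_cons, smul_app, ih]; ring

theorem nc_zero_mul (f : NC α) : 0 * f = 0 := by
  have := nc_smul_mul (0 : ℚ) 0 f
  simpa using this

theorem nc_mul_zero (f : NC α) : f * 0 = 0 := by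
  have := nc_mul_smul (0 : ℚ) f 0
  simpa using this

theorem nc_mul_assoc (f g h : NC α) : f * g * h = f * (g * h) := by
  ext l
  induction l generalizing f g with
  | nil => simp [mul_assoc]
  | cons a l ih =>
    simp only [mul_cons, D_mul, nc_add_mul, nc_smul_mul, add_app, smul_app, mul_nil, ih]; ring

theorem nc_one_mul (f : NC α) : 1 * f = f := by
  ext l
  cases l with
  | nil => simp
  | cons a l => simp [mul_cons, D_one, nc_zero_mul]

theorem nc_mul_one (f : NC α) : f * 1 = f := by
  ext l
  induction l generalizing f with
  | nil => simp
  | cons a l ih => simp [mul_cons, ih, D_app]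

noncomputable instance : Ring (NC α) :=
  { (inferInstance : AddCommGroup (NC α)) with
    mul := (· * ·)
    one := 1
    left_distrib := nc_mul_add
    right_distrib := nc_add_mul
    zero_mul := nc_zero_mul
    mul_zero := nc_mul_zero
    mul_assoc := nc_mul_assoc
    one_mul := nc_one_mul
    mul_one := nc_mul_one }

noncomputable instance : Algebra ℚ (NC α) :=
  Algebra.ofModule nc_smul_mul nc_mul_smul

@[simp] theorem sum_app {ι : Type} (s : Finset ι) (f : ι → NC α) (l : List α) :
    (∑ i ∈ s, f i) l = ∑ i ∈ s, f i l := by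
  classical
  induction s using Finset.induction_on with
  | empty => simp
  | insert a s ha ih => simp [Finset.sum_insert ha, ih]

theorem mul_split (f g : NC α) (l : List α) :
    (f * g) l = ∑ i ∈ Finset.range (l.length + 1), f (l.take i) * g (l.drop i) := by
  induction l generalizing f with
  | nil => simp
  | cons a l ih =>
    rw [mul_cons, ih, List.length_cons, Finset.sum_range_succ' _ (l.length + 1)]
    simp [D_app, add_comm]

/-- The degree filtration. -/
def V (k : ℕ) : Submodule ℚ (NC α) where
  carrier := {f | ∀ l : List α, l.length < k → f l = 0}
  add_mem' := by intro f g hf hg l hl; simp [hf l hl, hg l hl]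
  zero_mem' := by intro l _; rfl
  smul_mem' := by intro c f hf l hl; simp [hf l hl]

theorem mem_V {k : ℕ} {f : NC α} : f ∈ V k ↔ ∀ l : List α, l.length < k → f l = 0 := Iff.rfl

theorem V_mul {j k : ℕ} {f g : NC α} (hf : f ∈ V j) (hg : g ∈ V k) : f * g ∈ V (j + k) := by
  intro l hl
  rw [mul_split]
  apply Finset.sum_eq_zero
  intro i hi
  by_cases h : (l.take i).length < j
  · rw [hf _ h, zero_mul]
  · rw [hg (l.drop i), mul_zero]
    simp at h ⊢
    omega

theorem V_zero (f : NC α) : f ∈ V 0 := fun _ hl => absurd hl (Nat.not_lt_zero _)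

theorem V_mono {j k : ℕ} (h : j ≤ k) {f : NC α} (hf : f ∈ V k) : f ∈ V j :=
  fun l hl => hf l (by omega)

theorem V_mul_left {k : ℕ} {f g : NC α} (hg : g ∈ V k) : f * g ∈ V k := by
  simpa using V_mul (V_zero f) hg

theorem V_mul_right {k : ℕ} {f g : NC α} (hf : f ∈ V k) : f * g ∈ V k := by
  simpa using V_mul hf (V_zero g)

theorem V_one_iff {f : NC α} : f ∈ V 1 ↔ f [] = 0 := by
  constructor
  · intro h; exact h [] (by simp)
  · intro h l hl
    have : l = [] := by simpa using hl
    rw [this, h]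

theorem V_all {f : NC α} (h : ∀ k, f ∈ V k) : f = 0 := by
  ext l
  exact h (l.length + 1) l (by omega)

theorem D_V {k : ℕ} {f : NC α} (a : α) (h : f ∈ V (k + 1)) : D a f ∈ V k :=
  fun l hl => h (a :: l) (by simpa using hl)

theorem exists_fixed (T : NC α → NC α) (h1 : ∀ f, f [] = 1 → T f [] = 1)
    (hT : ∀ k f g, f [] = 1 → g [] = 1 → f - g ∈ V k → T f - T g ∈ V (k + 1)) :
    ∃ f, f [] = 1 ∧ T f = f := by
  let s : ℕ → NC α := fun k => T^[k] 1
  have s1 : ∀ k, s k [] = 1 := by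
    intro k
    induction k with
    | zero => rfl
    | succ k ih => simp only [s, Function.iterate_succ_apply']; exact h1 _ ih
  have ss : ∀ k, s (k + 1) = T (s k) := fun k => Function.iterate_succ_apply' _ _ _
  have hs : ∀ k, s (k + 1) - s k ∈ V (k + 1) := by
    intro k
    induction k with
    | zero => rw [zero_add, V_one_iff]; simp [s1]
    | succ k ih => rw [ss (k + 1), ss k]; rw [ss k] at ih; exact hT _ _ _ (by rw [← ss]; exact s1 _) (s1 _) ih
  have hs2 : ∀ k j, s (k + j) - s k ∈ V (k + 1) := by
    intro k j
    induction j with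
    | zero => simp
    | succ j ih =>
      have := Submodule.add_mem _ (V_mono (by omega : k + 1 ≤ k + j + 1) (hs (k + j))) ih
      rw [sub_add_sub_cancel] at this
      exact this
  let f : NC α := fun l => s l.length l
  have hf : ∀ k, f - s k ∈ V (k + 1) := by
    intro k l hl
    have := hs2 l.length (k - l.length) l (by omega)
    rw [Nat.add_sub_cancel' (by omega)] at this
    rw [sub_app] at this ⊢
    have e : f l = s l.length l := rfl
    rw [e]
    linarith
  refine ⟨f, s1 0, ?_⟩
  rw [← sub_eq_zero]
  apply V_all
  intro k
  have a1 := hT (k + 1) f (s k) (s1 0) (s1 k) (hf k)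
  have a2 := hf (k + 1)
  rw [← ss] at a1
  have := Submodule.sub_mem _ a1 a2
  rw [sub_sub_sub_cancel_right] at this
  exact V_mono (by omega) this

theorem exists_rinv (f : NC α) (hf : f [] = 1) : ∃ g : NC α, g [] = 1 ∧ f * g = 1 := by
  have h1 : (1 - f) ∈ V 1 := by rw [V_one_iff]; simp [hf]
  obtain ⟨g, hg, hT⟩ := exists_fixed (fun g => 1 + (1 - f) * g) (by intro g _; simp [hf]) (by
    intro k a b _ _ h
    have := V_mul h1 h
    rw [add_comm 1 k] at this
    convert this using 1
    noncomm_ring)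
  refine ⟨g, hg, ?_⟩
  have : 1 + (1 - f) * g = g := hT
  rw [sub_mul, one_mul] at this
  have h2 : f * g = 1 + (g - f * g) - g + f * g - (1 + (g - f * g) - g) + 0 := by abel
  have h3 : (1 + (g - f * g)) - g = 0 := sub_eq_zero.2 this
  have h4 : 1 - f * g = 0 := by rw [← h3]; abel
  exact (sub_eq_zero.1 h4).symm

theorem exists_unit (f : NC α) (hf : f [] = 1) : ∃ u : (NC α)ˣ, (u : NC α) = f := by
  obtain ⟨g, hg, h⟩ := exists_rinv f hf
  obtain ⟨f', _, h'⟩ := exists_rinv g hg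
  have : f = f' := left_inv_eq_right_inv h h'
  exact ⟨⟨f, g, h, by rw [this]; exact h'⟩, rfl⟩

theorem pow_nil {f : NC α} (hf : f [] = 1) (m : ℕ) : (f ^ m) [] = 1 := by
  induction m with
  | zero => rfl
  | succ m ih => rw [pow_succ, mul_nil, ih, hf, one_mul]

theorem pow_sub (k : ℕ) {f g : NC α} (hf : f [] = 1) (hg : g [] = 1) (h : f - g ∈ V k) (m : ℕ) :
    f ^ m - g ^ m - (m : ℚ) • (f - g) ∈ V (k + 1) := by
  induction m with
  | zero => simp
  | succ m ih =>
    have e : f ^ (m + 1) - g ^ (m + 1) - ((m + 1 : ℕ) : ℚ) • (f - g)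
        = (f ^ m - 1) * (f - g) + (f ^ m - g ^ m - (m : ℚ) • (f - g)) * g
          + ((m : ℚ) • (f - g)) * (g - 1) := by
      push_cast
      rw [pow_succ, pow_succ, add_smul, one_smul]
      noncomm_ring
    rw [e]
    have a1 : f ^ m - 1 ∈ V 1 := by rw [V_one_iff]; simp [pow_nil hf]
    have a2 : g - 1 ∈ V 1 := by rw [V_one_iff]; simp [hg]
    refine Submodule.add_mem _ (Submodule.add_mem _ ?_ (V_mul_right ih)) ?_
    · have := V_mul a1 h
      rwa [add_comm] at this
    · exact V_mul (Submodule.smul_mem _ _ h) a2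

theorem root_unique {f g : NC α} (hf : f [] = 1) (hg : g [] = 1) {m : ℕ} (hm : 0 < m)
    (h : f ^ m = g ^ m) : f = g := by
  rw [← sub_eq_zero]
  apply V_all
  intro k
  induction k with
  | zero => exact V_zero _
  | succ k ih =>
    have := pow_sub k hf hg ih m
    rw [h, sub_self, zero_sub, Submodule.neg_mem_iff] at this
    have h2 := Submodule.smul_mem _ (m : ℚ)⁻¹ this
    rwa [inv_smul_smul₀ (by positivity)] at h2

theorem root_exists {f : NC α} (hf : f [] = 1) {m : ℕ} (hm : 0 < m) :
    ∃ g : NC α, g [] = 1 ∧ g ^ m = f := by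
  have hm0 : (m : ℚ) ≠ 0 := by positivity
  obtain ⟨g, hg, hT⟩ := exists_fixed (fun g => g + (m : ℚ)⁻¹ • (f - g ^ m))
    (by intro g hg; simp [hf, hg, pow_nil hg]) (by
    intro k a b ha hb h
    have := Submodule.smul_mem _ (-(m : ℚ)⁻¹) (pow_sub k ha hb h m)
    convert this using 1
    rw [neg_smul, smul_sub _ _ ((m : ℚ) • (a - b)), inv_smul_smul₀ hm0, smul_sub, smul_sub, smul_sub]
    abel)
  refine ⟨g, hg, ?_⟩
  have h1 : g + (m : ℚ)⁻¹ • (f - g ^ m) = g := hT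
  rw [add_eq_left, smul_eq_zero] at h1
  rcases h1 with h1 | h1
  · exact absurd h1 (by positivity)
  · exact (sub_eq_zero.1 h1).symm

section letters
variable [DecidableEq α]

/-- The variable indexed by `a`. -/
def X (a : α) : NC α := fun l => if l = [a] then 1 else 0

@[simp] theorem X_nil (a : α) : X a [] = 0 := by simp [X]

theorem D_X (a b : α) : D b (X a) = if b = a then 1 else 0 := by
  ext l
  cases l <;> by_cases h : b = a <;> simp [D_app, X, h]

theorem X_mul_cons (a b : α) (f : NC α) (l : List α) :
    (X a * f) (b :: l) = if b = a then f l else 0 := by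
  rw [mul_cons, D_X]
  split <;> simp

theorem mul_X_snoc (a b : α) (f : NC α) (l : List α) :
    (f * X a) (l ++ [b]) = if b = a then f l else 0 := by
  induction l generalizing f with
  | nil => simp [mul_cons, X]
  | cons c l ih => rw [List.cons_append, mul_cons, ih]; simp [X, D_app]

theorem X_V (a : α) : X a ∈ V 1 := by rw [V_one_iff]; simp

theorem expand [Fintype α] (f : NC α) : f = f [] • 1 + ∑ a, X a * D a f := by
  ext l
  cases l with
  | nil => simp
  | cons b l => simp [X_mul_cons, D_app]

theorem hom_expand [Fintype α] {β : Type} (Φ : NC α →ₐ[ℚ] NC β) (f : NC α) :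
    Φ f = f [] • 1 + ∑ a, Φ (X a) * Φ (D a f) := by
  conv_lhs => rw [expand f]
  simp

theorem hom_ext [Fintype α] {β : Type} {Φ Ψ : NC α →ₐ[ℚ] NC β} (h : ∀ a, Φ (X a) = Ψ (X a))
    (h0 : ∀ a, Φ (X a) [] = 0) : Φ = Ψ := by
  apply AlgHom.ext
  intro f
  rw [← sub_eq_zero]
  apply V_all
  intro k
  induction k generalizing f with
  | zero => exact V_zero _
  | succ k ih =>
    rw [hom_expand Φ, hom_expand Ψ, add_sub_add_left_eq_sub, ← Finset.sum_sub_distrib]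
    refine Submodule.sum_mem _ fun a _ => ?_
    rw [← h, ← mul_sub, add_comm]
    exact V_mul (V_one_iff.2 (h0 a)) (ih _)

/-- Finite stages of the substitution map. -/
noncomputable def subT [Fintype α] {β : Type} (Y : α → NC β) : ℕ → NC α → NC β
  | 0, _ => 0
  | m + 1, f => f [] • 1 + ∑ a, Y a * subT Y m (D a f)

theorem subT_step [Fintype α] {β : Type} (Y : α → NC β) (hY : ∀ a, Y a [] = 0) (m : ℕ)
    (f : NC α) : subT Y (m + 1) f - subT Y m f ∈ V m := by
  induction m generalizing f with
  | zero => exact V_zero _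
  | succ m ih =>
    rw [subT, subT, add_sub_add_left_eq_sub, ← Finset.sum_sub_distrib]
    refine Submodule.sum_mem _ fun a _ => ?_
    rw [← mul_sub, add_comm m 1]
    have := V_mul (V_one_iff.2 (hY a)) (ih (D a f))
    rwa [add_comm m 1] at this

theorem subT_step' [Fintype α] {β : Type} (Y : α → NC β) (hY : ∀ a, Y a [] = 0) (m j : ℕ)
    (f : NC α) : subT Y (m + j) f - subT Y m f ∈ V m := by
  induction j with
  | zero => simp
  | succ j ih =>
    have := Submodule.add_mem _ (V_mono (by omega : m ≤ m + j) (subT_step Y hY (m + j) f)) ih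
    rw [sub_add_sub_cancel] at this
    exact this

/-- The substitution map as a function. -/
noncomputable def subF [Fintype α] {β : Type} (Y : α → NC β) (f : NC α) : NC β :=
  fun l => subT Y (l.length + 1) f l

theorem subF_T [Fintype α] {β : Type} (Y : α → NC β) (hY : ∀ a, Y a [] = 0) (m : ℕ) (f : NC α) :
    subF Y f - subT Y m f ∈ V m := by
  intro l hl
  have := subT_step' Y hY (l.length + 1) (m - (l.length + 1)) f l (by omega)
  rw [Nat.add_sub_cancel' (by omega)] at this
  simp only [sub_app, subF] at this ⊢
  linarith

theorem subF_eq [Fintype α] {β : Type} (Y : α → NC β) (hY : ∀ a, Y a [] = 0) (f : NC α) :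
    subF Y f = f [] • 1 + ∑ a, Y a * subF Y (D a f) := by
  rw [← sub_eq_zero]
  apply V_all
  intro k
  apply V_mono (Nat.le_succ k)
  have h1 := subF_T Y hY (k + 1) f
  have h2 : subT Y (k + 1) f - (f [] • 1 + ∑ a, Y a * subF Y (D a f)) ∈ V (k + 1) := by
    rw [subT, add_sub_add_left_eq_sub, ← Finset.sum_sub_distrib]
    refine Submodule.sum_mem _ fun a _ => ?_
    rw [← mul_sub, add_comm]
    refine V_mul (V_one_iff.2 (hY a)) ?_
    rw [← Submodule.neg_mem_iff, neg_sub]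
    exact subF_T Y hY k _
  have := Submodule.add_mem _ h1 h2
  rwa [sub_add_sub_cancel] at this

theorem subF_unique [Fintype α] {β : Type} (Y : α → NC β) (hY : ∀ a, Y a [] = 0)
    {ι : Type} (u v : ι → NC β) (c : ι → NC β) (n : α → ι → ι)
    (hu : ∀ i, u i = c i + ∑ a, Y a * u (n a i)) (hv : ∀ i, v i = c i + ∑ a, Y a * v (n a i))
    (i : ι) : u i = v i := by
  rw [← sub_eq_zero]
  apply V_all
  intro k
  induction k generalizing i with
  | zero => exact V_zero _
  | succ k ih =>
    rw [hu i, hv i, add_sub_add_left_eq_sub, ← Finset.sum_sub_distrib]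
    refine Submodule.sum_mem _ fun a _ => ?_
    rw [← mul_sub, add_comm]
    exact V_mul (V_one_iff.2 (hY a)) (ih _)

theorem subF_add [Fintype α] {β : Type} (Y : α → NC β) (hY : ∀ a, Y a [] = 0) (f g : NC α) :
    subF Y (f + g) = subF Y f + subF Y g :=
  subF_unique Y hY (fun p : NC α × NC α => subF Y (p.1 + p.2))
    (fun p => subF Y p.1 + subF Y p.2) (fun p => (p.1 [] + p.2 []) • 1)
    (fun a p => (D a p.1, D a p.2))
    (fun p => by rw [subF_eq Y hY]; rfl)
    (fun p => by
      beta_reduce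
      rw [subF_eq Y hY p.1, subF_eq Y hY p.2]
      simp only [mul_add, Finset.sum_add_distrib, add_smul]
      abel) (f, g)

theorem subF_smul [Fintype α] {β : Type} (Y : α → NC β) (hY : ∀ a, Y a [] = 0) (c : ℚ)
    (f : NC α) : subF Y (c • f) = c • subF Y f :=
  subF_unique Y hY (fun p : NC α => subF Y (c • p))
    (fun p => c • subF Y p) (fun p => (c * p []) • 1)
    (fun a p => D a p)
    (fun p => by rw [subF_eq Y hY]; rfl)
    (fun p => by
      beta_reduce
      rw [subF_eq Y hY p]
      simp only [smul_add, Finset.smul_sum, mul_smul_comm, mul_smul]) f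

theorem subF_one [Fintype α] {β : Type} (Y : α → NC β) (hY : ∀ a, Y a [] = 0) :
    subF Y (1 : NC α) = 1 := by
  have h0 : subF Y (0 : NC α) = 0 := by simpa using subF_smul Y hY 0 0
  rw [subF_eq Y hY]
  simp [D_one, h0]

theorem subF_mul [Fintype α] {β : Type} (Y : α → NC β) (hY : ∀ a, Y a [] = 0) (f g : NC α) :
    subF Y (f * g) = subF Y f * subF Y g :=
  subF_unique Y hY (fun p : NC α => subF Y (p * g))
    (fun p => subF Y p * subF Y g) (fun p => p [] • subF Y g)
    (fun a p => D a p)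
    (fun p => by
      beta_reduce
      rw [subF_eq Y hY]
      simp only [D_mul, subF_add Y hY, subF_smul Y hY, mul_add, Finset.sum_add_distrib]
      rw [← add_assoc]
      congr 1
      conv_rhs => rw [subF_eq Y hY g]
      simp only [smul_add, Finset.smul_sum, mul_smul_comm, mul_smul, mul_nil])
    (fun p => by
      beta_reduce
      conv_lhs => rw [subF_eq Y hY p]
      simp only [add_mul, Finset.sum_mul, mul_assoc, smul_mul_assoc, one_mul]) f

/-- The substitution map as an algebra homomorphism. -/
noncomputable def subst [Fintype α] {β : Type} (Y : α → NC β) (hY : ∀ a, Y a [] = 0) :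
    NC α →ₐ[ℚ] NC β :=
  AlgHom.ofLinearMap
    { toFun := subF Y, map_add' := subF_add Y hY, map_smul' := subF_smul Y hY }
    (subF_one Y hY) (subF_mul Y hY)

theorem subst_X [Fintype α] {β : Type} (Y : α → NC β) (hY : ∀ a, Y a [] = 0) (a : α) :
    subst Y hY (X a) = Y a := by
  change subF Y (X a) = Y a
  have h0 : subF Y (0 : NC α) = 0 := by simpa using subF_smul Y hY 0 0
  rw [subF_eq Y hY]
  simp only [D_X, X_nil, zero_smul, zero_add]
  rw [Finset.sum_eq_single a]
  · simp [subF_one Y hY]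
  · intro b _ hb; simp [hb, h0]
  · simp

end letters


section trace

theorem sum_shift (k : ℕ) (F : ℕ → ℚ) (hF : ∀ r, F (r + k) = F r) (i : ℕ) :
    ∑ r ∈ Finset.range k, F (r + i) = ∑ r ∈ Finset.range k, F r := by
  induction i with
  | zero => simp
  | succ i ih =>
    rw [← ih]
    have h1 := Finset.sum_range_succ (fun r => F (r + i)) k
    have h2 := Finset.sum_range_succ' (fun r => F (r + i)) k
    have h3 := hF i
    simp only [zero_add] at h2
    rw [add_comm i k] at h3
    have h4 : ∀ r, F (r + (i + 1)) = F (r + 1 + i) := fun r => by congr 1; ring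
    simp only [h4]
    linarith

/-- Sum of the coefficients over all rotations of a word. -/
def tr (c : List α) (f : NC α) : ℚ := ∑ r ∈ Finset.range c.length, f (c.rotate r)

theorem tr_mul_comm (c : List α) (f g : NC α) : tr c (f * g) = tr c (g * f) := by
  unfold tr
  simp only [mul_split, List.length_rotate]
  rw [Finset.sum_comm]
  conv_rhs => rw [Finset.sum_comm, ← Finset.sum_range_reflect]
  apply Finset.sum_congr rfl
  intro i hi
  have hi' : i ≤ c.length := by simp at hi; omega
  rw [← sum_shift c.length (fun r => g ((c.rotate r).take (c.length + 1 - 1 - i)) *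
    f ((c.rotate r).drop (c.length + 1 - 1 - i))) (by
      intro r
      rw [← List.rotate_rotate]
      conv_lhs => rw [← List.length_rotate c r, List.rotate_length]
      simp) i]
  apply Finset.sum_congr rfl
  intro r _
  have e : c.rotate (r + i) = (c.rotate r).drop i ++ (c.rotate r).take i := by
    rw [← List.rotate_rotate, List.rotate_eq_drop_append_take (by simpa using hi')]
  have e1 : ((c.rotate r).drop i).length = c.length + 1 - 1 - i := by simp
  beta_reduce
  rw [e, List.take_left' e1, List.drop_left' e1, mul_comm]

theorem tr_conj (c : List α) (u : (NC α)ˣ) (f : NC α) :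
    tr c ((u : NC α) * f * ((u⁻¹ : (NC α)ˣ) : NC α)) = tr c f := by
  rw [tr_mul_comm, ← mul_assoc, Units.inv_mul, one_mul]

end trace

section magnus
variable [DecidableEq α]

theorem cent {i : α} {f : NC α} (h : f * X i = X i * f) {l : List α} {b : α} (hb : b ∈ l)
    (hbi : b ≠ i) : f l = 0 := by
  have hA : ∀ b l, b ≠ i → f (b :: l) = 0 := by
    intro b l hb
    have h1 := mul_X_snoc i i f (b :: l)
    rw [h, List.cons_append, X_mul_cons] at h1
    simpa [hb] using h1.symm
  have hB : ∀ l, f (i :: l) = f (l ++ [i]) := by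
    intro l
    have h1 := mul_X_snoc i i f (i :: l)
    rw [h, List.cons_append, X_mul_cons] at h1
    simpa using h1.symm
  have hC : ∀ (l : List α) (t : ℕ), (∃ b ∈ l, b ≠ i) → f (l ++ List.replicate t i) = 0 := by
    intro l
    induction l with
    | nil => rintro t ⟨b, hb, _⟩; simp at hb
    | cons c l ih =>
      rintro t ⟨b, hb, hbi⟩
      by_cases hc : c = i
      · subst hc
        rw [List.cons_append, hB, List.append_assoc, ← List.replicate_succ']
        apply ih
        rcases List.mem_cons.1 hb with rfl | hb
        · exact absurd rfl hbi
        · exact ⟨b, hb, hbi⟩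
      · exact hA _ _ hc
  simpa using hC l 0 ⟨b, hb, hbi⟩

theorem cent_D {i b : α} {f : NC α} (h : f * X i = X i * f) (hb : b ≠ i) : D b f = 0 := by
  ext l
  exact cent h (List.mem_cons_self) hb

theorem cent_one {i j : α} (hij : i ≠ j) {f : NC α} (hi : f * X i = X i * f)
    (hj : f * X j = X j * f) (h1 : f [] = 1) : f = 1 := by
  ext l
  cases l with
  | nil => simpa using h1
  | cons c l =>
    by_cases hc : c = i
    · exact cent hj (b := c) List.mem_cons_self (by rw [hc]; exact hij)
    · exact cent hi (b := c) List.mem_cons_self hc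

/-- The unit `1 + X a`. -/
noncomputable def mag1 (a : α) : (NC α)ˣ :=
  Classical.choose (exists_unit (1 + X a) (by simp))

theorem mag1_val (a : α) : (mag1 a : NC α) = 1 + X a :=
  Classical.choose_spec (exists_unit (1 + X a) (by simp))

/-- The Magnus embedding. -/
noncomputable def mag : FreeGroup α →* (NC α)ˣ := FreeGroup.lift mag1

theorem mag_of (a : α) : (mag (FreeGroup.of a) : NC α) = 1 + X a := by
  simp [mag, mag1_val]

theorem inv_nil {u : (NC α)ˣ} (h : (u : NC α) [] = 1) :
    ((u⁻¹ : (NC α)ˣ) : NC α) [] = 1 := by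
  have := congrArg (fun f : NC α => f []) (Units.mul_inv u)
  simpa [h] using this

theorem mag_nil (w : FreeGroup α) : (mag w : NC α) [] = 1 := by
  induction w using FreeGroup.induction_on with
  | C1 => simp
  | of a => simp [mag_of]
  | inv_of a ih => rw [map_inv]; exact inv_nil ih
  | mul x y hx hy => simp [hx, hy]

/-- The linear coefficient as a homomorphism. -/
noncomputable def lin (b : α) : FreeGroup α →* Multiplicative ℚ where
  toFun w := Multiplicative.ofAdd ((mag w : NC α) [b])
  map_one' := by simp
  map_mul' x y := by
    rw [map_mul, Units.val_mul, mul_cons]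
    simp [mag_nil, D_app, add_comm, ofAdd_add]

theorem lin_of (a b : α) : (mag (FreeGroup.of a) : NC α) [b] = if b = a then 1 else 0 := by
  simp [mag_of, X]

theorem lin_zpow (a b : α) (e : ℤ) :
    (mag (FreeGroup.of a ^ e) : NC α) [b] = if b = a then (e : ℚ) else 0 := by
  have h := map_zpow (lin b) (FreeGroup.of a) e
  have h2 : (mag (FreeGroup.of a ^ e) : NC α) [b]
      = e • ((mag (FreeGroup.of a) : NC α) [b]) := congrArg Multiplicative.toAdd h
  rw [h2, lin_of]
  split <;> simp

theorem comm_X_of {u : NC α} {a : α} (h : u * (mag (FreeGroup.of a) : NC α)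
    = (mag (FreeGroup.of a) : NC α) * u) : u * X a = X a * u := by
  rw [mag_of, mul_add, add_mul, mul_one, one_mul] at h
  exact add_left_cancel h

theorem zpow_comm (a : α) (e : ℤ) : (mag (FreeGroup.of a ^ e) : NC α) * X a
    = X a * (mag (FreeGroup.of a ^ e) : NC α) := by
  apply comm_X_of
  rw [← Units.val_mul, ← Units.val_mul, ← map_mul, ← map_mul]
  congr 2
  exact ((Commute.refl (FreeGroup.of a)).zpow_left e)

/-- Product of syllables. -/
def prodL (L : List (α × ℤ)) : FreeGroup α := (L.map fun p => FreeGroup.of p.1 ^ p.2).prod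

theorem prodL_cons (p : α × ℤ) (L : List (α × ℤ)) :
    prodL (p :: L) = FreeGroup.of p.1 ^ p.2 * prodL L := by simp [prodL]

theorem prodL_append (L M : List (α × ℤ)) : prodL (L ++ M) = prodL L * prodL M := by
  simp [prodL]

theorem prodL_surj (w : FreeGroup α) : ∃ L, prodL L = w := by
  induction w using FreeGroup.induction_on with
  | C1 => exact ⟨[], rfl⟩
  | of a => exact ⟨[(a, 1)], by simp [prodL]⟩
  | inv_of a => exact ⟨[(a, -1)], by simp [prodL]⟩
  | mul x y hx hy =>
    obtain ⟨L, rfl⟩ := hx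
    obtain ⟨M, rfl⟩ := hy
    exact ⟨L ++ M, prodL_append _ _⟩

theorem mag_coeff (L : List (α × ℤ)) (v : List α) (hv : v.IsChain (· ≠ ·))
    (hl : L.length ≤ v.length) : (mag (prodL L) : NC α) v
      = if v = L.map Prod.fst then (L.map fun p => (p.2 : ℚ)).prod else 0 := by
  induction L generalizing v with
  | nil =>
    cases v <;> simp [prodL]
  | cons p L ih =>
    obtain ⟨i, e⟩ := p
    cases v with
    | nil => simp at hl
    | cons b v =>
      have hl' : L.length ≤ v.length := by simpa using hl
      have hv' : v.IsChain (· ≠ ·) := hv.tail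
      rw [prodL_cons, map_mul, Units.val_mul, mul_cons, ih (b :: v) hv (by simp; omega), if_neg,
        mul_zero, zero_add]
      · by_cases hb : b = i
        · subst hb
          have hD : (D b (mag (FreeGroup.of b ^ e) : NC α) * (mag (prodL L) : NC α)) v
              = e * (mag (prodL L) : NC α) v := by
            have h0 : D b (mag (FreeGroup.of b ^ e) : NC α) [] = e := by
              rw [D_app, lin_zpow]; simp
            cases v with
            | nil => rw [mul_nil, h0]
            | cons c v =>
              rw [mul_cons, h0]
              have hbc : b ≠ c := (List.isChain_cons_cons.1 hv).1
              have : D c (D b (mag (FreeGroup.of b ^ e) : NC α)) = 0 := by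
                ext l
                exact cent (zpow_comm b e) (b := c) (l := b :: c :: l) (by simp) hbc.symm
              rw [this]
              simp
          rw [hD, ih v hv' hl']
          simp
        · rw [cent_D (zpow_comm i e) hb]
          simp [hb]
      · intro h
        have := congrArg List.length h
        simp at this
        omega

/-- A syllable list of minimal length in its conjugacy class. -/
def Short (L : List (α × ℤ)) : Prop :=
  ∀ L', IsConj (prodL L') (prodL L) → L.length ≤ L'.length

theorem exists_short (w : FreeGroup α) : ∃ L, Short L ∧ IsConj (prodL L) w := by
  classical
  have h : ∃ k, ∃ L : List (α × ℤ), L.length = k ∧ IsConj (prodL L) w := by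
    obtain ⟨L, hL⟩ := prodL_surj w
    exact ⟨_, L, rfl, by rw [hL]⟩
  obtain ⟨L, hL, hc⟩ := Nat.find_spec h
  refine ⟨L, ?_, hc⟩
  intro L' hL'
  rw [hL]
  exact Nat.find_min' h ⟨L', rfl, hL'.trans hc⟩

theorem Short.rotate {L : List (α × ℤ)} (h : Short L) (r : ℕ) : Short (L.rotate r) := by
  have h1 : ∀ M : List (α × ℤ), IsConj (prodL (M.rotate 1)) (prodL M) := by
    intro M
    cases M with
    | nil => exact IsConj.refl _
    | cons p M =>
      rw [isConj_iff]
      refine ⟨FreeGroup.of p.1 ^ p.2, ?_⟩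
      simp [prodL, mul_assoc]
  have h2 : ∀ r, IsConj (prodL (L.rotate r)) (prodL L) := by
    intro r
    induction r with
    | zero => rw [List.rotate_zero]
    | succ r ih => rw [← List.rotate_rotate]; exact (h1 _).trans ih
  intro L' hL'
  rw [List.length_rotate]
  exact h L' (hL'.trans (h2 r))

theorem reduce_chain (L : List (α × ℤ)) (h : ¬ (L.map Prod.fst).IsChain (· ≠ ·)) :
    ∃ L', L'.length < L.length ∧ prodL L' = prodL L := by
  induction L with
  | nil => simp at h
  | cons p L ih =>
    cases L with
    | nil => simp at h
    | cons q L =>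
      by_cases hpq : p.1 = q.1
      · refine ⟨(p.1, p.2 + q.2) :: L, by simp, ?_⟩
        rw [prodL_cons, prodL_cons, prodL_cons, ← hpq, zpow_add, mul_assoc]
      · have h' : ¬ ((q :: L).map Prod.fst).IsChain (· ≠ ·) := by
          intro h'
          apply h
          simp only [List.map_cons] at h' ⊢
          exact List.isChain_cons_cons.2 ⟨hpq, h'⟩
        obtain ⟨L', h1, h2⟩ := ih h'
        exact ⟨p :: L', by simpa using h1, by rw [prodL_cons, h2, ← prodL_cons]⟩

theorem reduce_zero (L : List (α × ℤ)) (h : ∃ p ∈ L, p.2 = 0) :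
    ∃ L', L'.length < L.length ∧ prodL L' = prodL L := by
  obtain ⟨p, hp, h0⟩ := h
  obtain ⟨s, t, rfl⟩ := List.append_of_mem hp
  refine ⟨s ++ t, by simp, ?_⟩
  rw [prodL_append, prodL_append, prodL_cons, h0, zpow_zero, one_mul]

theorem Short.chain {L : List (α × ℤ)} (h : Short L) : (L.map Prod.fst).IsChain (· ≠ ·) := by
  by_contra hc
  obtain ⟨L', h1, h2⟩ := reduce_chain L hc
  have := h L' (by rw [h2])
  omega

theorem Short.prod_ne {L : List (α × ℤ)} (h : Short L) :
    (L.map fun p => (p.2 : ℚ)).prod ≠ 0 := by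
  intro hc
  rw [List.prod_eq_zero_iff, List.mem_map] at hc
  obtain ⟨p, hp, h0⟩ := hc
  obtain ⟨L', h1, h2⟩ := reduce_zero L ⟨p, hp, by exact_mod_cast h0⟩
  have := h L' (by rw [h2])
  omega

theorem mag_inj : Function.Injective (mag : FreeGroup α →* (NC α)ˣ) := by
  rw [injective_iff_map_eq_one]
  intro w hw
  obtain ⟨L, hL, hc⟩ := exists_short w
  have h1 : mag (prodL L) = 1 := by
    obtain ⟨c, rfl⟩ := isConj_iff.1 hc
    simpa [mul_inv_eq_one] using hw
  have h2 := mag_coeff L _ hL.chain (by simp)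
  rw [if_pos rfl, h1] at h2
  cases L with
  | nil =>
    obtain ⟨c, rfl⟩ := isConj_iff.1 hc
    simp [prodL]
  | cons p L =>
    exact absurd h2.symm hL.prod_ne

theorem conj_gen {w : FreeGroup α} {a : α} {r : (NC α)ˣ}
    (h : mag w = r * mag (FreeGroup.of a) * r⁻¹) : ∃ v, w = v * FreeGroup.of a * v⁻¹ := by
  obtain ⟨L, hL, hc⟩ := exists_short w
  have htr : ∀ c, tr c (mag (prodL L) : NC α) = tr c (1 + X a) := by
    intro c
    obtain ⟨g, hg⟩ := isConj_iff.1 hc.symm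
    rw [← hg]
    simp only [map_mul, map_inv, Units.val_mul]
    rw [tr_conj, h]
    simp only [Units.val_mul]
    rw [tr_conj, mag_of]
  match L, hL, hc, htr with
  | [], hL, hc, htr =>
    have := htr [a]
    simp [tr, prodL, X] at this
  | [(i, e)], hL, hc, htr =>
    have h1 := htr [a]
    have he : prodL [(i, e)] = FreeGroup.of i ^ e := by simp [prodL]
    rw [he] at h1
    simp only [tr, List.length_singleton, Finset.sum_range_one, List.rotate_zero, lin_zpow] at h1
    by_cases hi : a = i
    · subst hi
      simp [X] at h1
      rw [he, h1] at hc
      obtain ⟨v, hv⟩ := isConj_iff.1 hc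
      exact ⟨v, by rw [← hv]; simp⟩
    · simp [hi, X] at h1
  | p :: q :: L, hL, hc, htr =>
    exfalso
    set M := p :: q :: L with hM
    have h1 := htr (M.map Prod.fst)
    have h2 : tr (M.map Prod.fst) (1 + X a) = 0 := by
      unfold tr
      apply Finset.sum_eq_zero
      intro r _
      have hlen : ((M.map Prod.fst).rotate r).length = L.length + 2 := by simp [hM]
      match hh : (M.map Prod.fst).rotate r, hlen with
      | x :: y :: t, _ => simp [X]
    have h3 : ∀ r, (mag (prodL M) : NC α) ((M.map Prod.fst).rotate r)
        = if (M.map Prod.fst).rotate r = M.map Prod.fst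
          then (M.map fun p => (p.2 : ℚ)).prod else 0 := by
      intro r
      apply mag_coeff
      · rw [← List.map_rotate]
        exact (hL.rotate r).chain
      · simp
    rw [h2] at h1
    unfold tr at h1
    simp only [h3] at h1
    rw [← Finset.sum_filter, Finset.sum_const, smul_eq_zero] at h1
    rcases h1 with h1 | h1
    · rw [Finset.card_eq_zero] at h1
      have : 0 ∈ (Finset.range (M.map Prod.fst).length).filter
        (fun r => (M.map Prod.fst).rotate r = M.map Prod.fst) := by simp [hM]
      rw [h1] at this
      simp at this
    · exact hL.prod_ne h1

end magnus

section final
variable [DecidableEq α] [Fintype α]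

/-- Conjugation by a unit. -/
noncomputable def cj (u : (NC α)ˣ) : NC α →ₐ[ℚ] NC α :=
  AlgHom.ofLinearMap
    { toFun := fun f => (u : NC α) * f * ((u⁻¹ : (NC α)ˣ) : NC α)
      map_add' := by intro f g; rw [mul_add, add_mul]
      map_smul' := by intro c f; simp }
    (by simp)
    (by
      intro f g
      change (u : NC α) * (f * g) * ((u⁻¹ : (NC α)ˣ) : NC α)
        = ((u : NC α) * f * ((u⁻¹ : (NC α)ˣ) : NC α)) * ((u : NC α) * g * ((u⁻¹ : (NC α)ˣ) : NC α))
      simp only [mul_assoc, Units.inv_mul_cancel_left])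

theorem cj_app (u : (NC α)ˣ) (f : NC α) :
    cj u f = (u : NC α) * f * ((u⁻¹ : (NC α)ˣ) : NC α) := rfl

theorem cj_mul (u v : (NC α)ˣ) : cj (u * v) = cj u * cj v := by
  apply AlgHom.ext
  intro f
  rw [AlgHom.mul_apply]
  simp only [cj_app, mul_inv_rev, Units.val_mul, mul_assoc]

theorem cj_one : cj (1 : (NC α)ˣ) = 1 := by
  apply AlgHom.ext
  intro f
  simp [cj_app]

theorem cj_pow (u : (NC α)ˣ) (m : ℕ) : cj (u ^ m) = cj u ^ m := by
  induction m with
  | zero => simp [cj_one]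
  | succ m ih => rw [pow_succ, pow_succ, cj_mul, ih]

theorem raise (Φ : NC α →ₐ[ℚ] NC α) (h : ∀ a, Φ (X a) - X a ∈ V 2) (k : ℕ) (f : NC α)
    (hf : f ∈ V k) : Φ f - f ∈ V (k + 1) := by
  have h0 : ∀ a, Φ (X a) [] = 0 := by
    intro a
    have := h a [] (by simp)
    simpa using this
  induction k generalizing f with
  | zero =>
    rw [zero_add, V_one_iff, hom_expand Φ f]
    simp [h0]
  | succ k ih =>
    have e : Φ f - f = ∑ a, ((Φ (X a) - X a) * Φ (D a f) + X a * (Φ (D a f) - D a f)) := by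
      conv_lhs => rw [hom_expand Φ f]
      conv_lhs => enter [2]; rw [expand f]
      rw [add_sub_add_left_eq_sub, ← Finset.sum_sub_distrib]
      apply Finset.sum_congr rfl
      intro a _
      noncomm_ring
    rw [e]
    refine Submodule.sum_mem _ fun a _ => ?_
    have h1 := ih _ (D_V a hf)
    have h2 : Φ (D a f) ∈ V k := by
      have := Submodule.add_mem _ (V_mono (Nat.le_succ k) h1) (D_V a hf)
      rwa [sub_add_cancel] at this
    refine Submodule.add_mem _ ?_ ?_
    · have := V_mul (h a) h2
      rwa [show 2 + k = k + 1 + 1 by ring] at this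
    · have := V_mul (X_V a) h1
      rwa [show 1 + (k + 1) = k + 1 + 1 by ring] at this

theorem torsion (Φ : NC α →ₐ[ℚ] NC α) (h : ∀ a, Φ (X a) - X a ∈ V 2) {m : ℕ} (hm : 0 < m)
    (hp : Φ ^ m = 1) : Φ = 1 := by
  apply AlgHom.ext
  intro f
  rw [← sub_eq_zero]
  apply V_all
  intro k
  change Φ f - f ∈ V k
  induction k with
  | zero => exact V_zero _
  | succ k ih =>
    have key : ∀ j : ℕ, (Φ ^ j) f - f - (j : ℚ) • (Φ f - f) ∈ V (k + 1) := by
      intro j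
      induction j with
      | zero => simp
      | succ j ihj =>
        have h1 := raise Φ h _ _ ihj
        have h2 := raise Φ h _ _ ih
        have h3 := Submodule.add_mem _ (V_mono (Nat.le_succ _) h1) ihj
        have h4 := Submodule.add_mem _ h3 (Submodule.smul_mem _ (j : ℚ) h2)
        convert h4 using 1
        rw [pow_succ', AlgHom.mul_apply]
        simp only [map_sub, map_smul]
        push_cast
        simp only [add_smul, smul_sub, one_smul]
        abel
    have := key m
    rw [hp] at this
    have h1 : -((m : ℚ) • (Φ f - f)) ∈ V (k + 1) := by simpa using this
    rw [Submodule.neg_mem_iff] at h1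
    have h2 := Submodule.smul_mem _ (m : ℚ)⁻¹ h1
    rwa [inv_smul_smul₀ (by positivity)] at h2

theorem hom_mag {β : Type} [DecidableEq β] (Φ : NC α →ₐ[ℚ] NC β) (p : FreeGroup α →* FreeGroup β)
    (h : ∀ a, Φ (X a) = (mag (p (FreeGroup.of a)) : NC β) - 1) (w : FreeGroup α) :
    Φ (mag w : NC α) = (mag (p w) : NC β) := by
  have : (Units.map (Φ : NC α →* NC β)).comp mag = mag.comp p := by
    apply FreeGroup.ext_hom
    intro a
    ext1
    change Φ (mag (FreeGroup.of a) : NC α) = _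
    rw [mag_of, map_add, h, map_one, add_sub_cancel]
    rfl
  have h2 := DFunLike.congr_fun this w
  exact congrArg Units.val h2

theorem exists_conj {a b : α} (hab : a ≠ b) (θ : MulAut (FreeGroup α))
    (hθ : ∀ i j, (mag (θ (FreeGroup.of i)) : NC α) [j] = (mag (FreeGroup.of i) : NC α) [j])
    {m : ℕ} (hm : 0 < m) {h : FreeGroup α} (hh : θ ^ m = MulAut.conj h) :
    ∃ r : (NC α)ˣ, (r : NC α) [] = 1 ∧ ∀ x, mag (θ x) = r * mag x * r⁻¹ := by
  -- θ fixes h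
  have hfix : θ h = h := by
    have h1 : ∀ y, θ h * y * (θ h)⁻¹ = h * y * h⁻¹ := by
      intro y
      obtain ⟨x, rfl⟩ := θ.surjective y
      have e1 : θ ((θ ^ m) x) = (θ ^ m) (θ x) := by
        rw [← MulAut.mul_apply, ← MulAut.mul_apply, ← pow_succ, ← pow_succ']
      rw [hh] at e1
      simpa using e1
    have h2 : ∀ y, (h⁻¹ * θ h) * y = y * (h⁻¹ * θ h) := by
      intro y
      have := h1 y
      rw [mul_inv_eq_iff_eq_mul] at this
      rw [mul_assoc, this]
      group
    have h3 : ∀ i, (mag (h⁻¹ * θ h) : NC α) * X i = X i * (mag (h⁻¹ * θ h) : NC α) := by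
      intro i
      apply comm_X_of
      rw [← Units.val_mul, ← Units.val_mul, ← map_mul, ← map_mul, h2]
    have h4 : mag (h⁻¹ * θ h) = 1 := by
      ext1
      exact cent_one hab (h3 a) (h3 b) (mag_nil _)
    have h5 : h⁻¹ * θ h = 1 := mag_inj (by rw [h4, map_one])
    exact (inv_mul_eq_one.1 h5).symm
  have hY : ∀ i, ((mag (θ (FreeGroup.of i)) : NC α) - 1) [] = 0 := by
    intro i; simp [mag_nil]
  let Θ : NC α →ₐ[ℚ] NC α := subst (fun i => (mag (θ (FreeGroup.of i)) : NC α) - 1) hY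
  have hΘX : ∀ i, Θ (X i) = (mag (θ (FreeGroup.of i)) : NC α) - 1 := fun i => subst_X _ _ i
  have hΘ : ∀ w, Θ (mag w : NC α) = (mag (θ w) : NC α) := hom_mag Θ θ.toMonoidHom hΘX
  have hΘV : ∀ i, Θ (X i) - X i ∈ V 2 := by
    intro i l hl
    rw [hΘX]
    match l, hl with
    | [], _ => simp [mag_nil]
    | [j], _ => simp [hθ, mag_of]
  have hΘm : Θ ^ m = cj (mag h) := by
    have hit : ∀ (k : ℕ) w, (Θ ^ k) (mag w : NC α) = (mag ((θ ^ k) w) : NC α) := by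
      intro k
      induction k with
      | zero => intro w; rfl
      | succ k ih => intro w; rw [pow_succ, pow_succ, AlgHom.mul_apply, hΘ, ih]; rfl
    have hX : ∀ i, (Θ ^ m) (X i) = cj (mag h) (X i) := by
      intro i
      have e : (X i : NC α) = (mag (FreeGroup.of i) : NC α) - 1 := by rw [mag_of]; simp
      rw [e, map_sub, map_sub, map_one, map_one, hit, hh, cj_app]
      simp
    apply hom_ext hX
    intro i
    rw [hX, cj_app]
    simp
  obtain ⟨r, hr1, hrm⟩ := root_exists (mag_nil h) hm
  obtain ⟨r, rfl⟩ := exists_unit r hr1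
  have hrm' : r ^ m = mag h := by ext1; simpa using hrm
  have hΘnil : ∀ f, (Θ f) [] = f [] := by
    intro f
    have := raise Θ hΘV 0 f (V_zero f) [] (by simp)
    simpa [sub_eq_zero] using this
  have hΘr : Θ r = r := by
    apply root_unique (by rw [hΘnil]; exact hr1) hr1 hm
    rw [← map_pow, hrm, hΘ, hfix]
  have hΘr' : Units.map (Θ : NC α →* NC α) r = r := by ext1; exact hΘr
  have hΘri : Θ ((r⁻¹ : (NC α)ˣ) : NC α) = ((r⁻¹ : (NC α)ˣ) : NC α) := by
    have := congrArg (fun u : (NC α)ˣ => ((u⁻¹ : (NC α)ˣ) : NC α)) hΘr'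
    rw [← map_inv] at this
    exact this
  have hcomm : Commute (cj r⁻¹) Θ := by
    apply AlgHom.ext
    intro f
    rw [AlgHom.mul_apply, AlgHom.mul_apply, cj_app, cj_app, map_mul, map_mul, inv_inv, hΘr, hΘri]
  have hΨ : cj r⁻¹ * Θ = 1 := by
    apply torsion _ _ hm
    · rw [hcomm.mul_pow, hΘm, ← cj_pow, ← cj_mul, inv_pow, hrm', inv_mul_cancel, cj_one]
    · intro i
      rw [AlgHom.mul_apply, cj_app, inv_inv]
      have hri := inv_nil hr1
      have e : ((r⁻¹ : (NC α)ˣ) : NC α) * Θ (X i) * (r : NC α) - X i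
          = ((r⁻¹ : (NC α)ˣ) : NC α) * (Θ (X i) - X i) * (r : NC α)
            + (((r⁻¹ : (NC α)ˣ) : NC α) - 1) * X i * (r : NC α)
            + X i * ((r : NC α) - 1) := by noncomm_ring
      rw [e]
      have q1 : ((r⁻¹ : (NC α)ˣ) : NC α) - 1 ∈ V 1 := by rw [V_one_iff]; simp [hri]
      have q2 : (r : NC α) - 1 ∈ V 1 := by rw [V_one_iff]; simp [hr1]
      exact Submodule.add_mem _ (Submodule.add_mem _ (V_mul_right (V_mul_left (hΘV i)))
        (V_mul_right (V_mul q1 (X_V i)))) (V_mul (X_V i) q2)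
  have hΘc : Θ = cj r := by
    have : cj r * (cj r⁻¹ * Θ) = cj r := by rw [hΨ, mul_one]
    rwa [← mul_assoc, ← cj_mul, mul_inv_cancel, cj_one, one_mul] at this
  refine ⟨r, hr1, fun x => ?_⟩
  ext1
  rw [← hΘ, hΘc, cj_app]
  rfl

theorem main {a b : α} (hab : a ≠ b) (θ : MulAut (FreeGroup α))
    (hθ : ∀ i j, (mag (θ (FreeGroup.of i)) : NC α) [j] = (mag (FreeGroup.of i) : NC α) [j])
    {m : ℕ} (hm : 0 < m) {h : FreeGroup α} (hh : θ ^ m = MulAut.conj h) :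
    ∃ g, θ = MulAut.conj g := by
  obtain ⟨r, hr1, hr⟩ := exists_conj hab θ hθ hm hh
  obtain ⟨v, hv⟩ := conj_gen (hr (FreeGroup.of a))
  obtain ⟨u, hu⟩ := conj_gen (hr (FreeGroup.of b))
  have hs : ∀ (i : α) (v : FreeGroup α), θ (FreeGroup.of i) = v * FreeGroup.of i * v⁻¹ →
      Commute ((mag v)⁻¹ * r) (mag (FreeGroup.of i)) := by
    intro i v hv
    have h1 := hr (FreeGroup.of i)
    rw [hv, map_mul, map_mul, map_inv, mul_inv_eq_iff_eq_mul] at h1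
    rw [commute_iff_eq]
    have h2 : mag v * mag (FreeGroup.of i) * ((mag v)⁻¹ * r) = r * mag (FreeGroup.of i) := by
      rw [eq_comm, ← mul_inv_eq_iff_eq_mul, mul_inv_rev, inv_inv, ← mul_assoc]
      exact h1.symm
    rw [mul_assoc, ← h2]
    group
  set s := (mag v)⁻¹ * r with hsdef
  set s' := (mag u)⁻¹ * r with hsdef'
  have cs := (hs a v hv).inv_left
  have cs' := hs b u hu
  have e : mag (u⁻¹ * v) = s' * s⁻¹ := by rw [hsdef, hsdef', map_mul, map_inv]; group
  have c1 : ((s⁻¹ : (NC α)ˣ) : NC α) * X a = X a * ((s⁻¹ : (NC α)ˣ) : NC α) := by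
    apply comm_X_of
    exact congrArg Units.val cs.eq
  have c2 : (s' : NC α) * X b = X b * (s' : NC α) := by
    apply comm_X_of
    exact congrArg Units.val cs'.eq
  have s1' : (s' : NC α) [] = 1 := by
    rw [hsdef', Units.val_mul, mul_nil, hr1, inv_nil (mag_nil u), one_mul]
  let p : FreeGroup α →* FreeGroup α :=
    FreeGroup.lift (fun i => if i = a then FreeGroup.of a else 1)
  have hY : ∀ i : α, (if i = a then X a else 0 : NC α) [] = 0 := by
    intro i; split <;> simp
  let P : NC α →ₐ[ℚ] NC α := subst (fun i => if i = a then X a else 0) hY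
  have hPX : ∀ i, P (X i) = if i = a then X a else 0 := fun i => subst_X _ _ i
  have hP : ∀ w, P (mag w : NC α) = (mag (p w) : NC α) := by
    apply hom_mag
    intro i
    rw [hPX]
    by_cases hi : i = a
    · simp [p, hi, mag_of]
    · simp [p, hi]
  have hPs' : P (s' : NC α) = 1 := by
    rw [hom_expand P, s1', one_smul]
    rw [Finset.sum_eq_zero, add_zero]
    intro i _
    by_cases hi : i = a
    · rw [hi, cent_D c2 hab]; simp
    · rw [hPX, if_neg hi, zero_mul]
  have hPs : P ((s⁻¹ : (NC α)ˣ) : NC α) = ((s⁻¹ : (NC α)ˣ) : NC α) := by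
    have gen : ∀ k (f : NC α), (∀ l, (∃ c ∈ l, c ≠ a) → f l = 0) → P f - f ∈ V k := by
      intro k
      induction k with
      | zero => intro f _; exact V_zero _
      | succ k ih =>
        intro f hf
        have e1 : P f - f = X a * (P (D a f) - D a f) := by
          conv_lhs => rw [hom_expand P f]
          conv_lhs => enter [2]; rw [expand f]
          rw [add_sub_add_left_eq_sub, ← Finset.sum_sub_distrib, Finset.sum_eq_single a]
          · rw [hPX, if_pos rfl, mul_sub]
          · intro i _ hi
            have : D i f = 0 := by
              ext l
              exact hf _ ⟨i, List.mem_cons_self, hi⟩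
            rw [this]; simp
          · simp
        rw [e1, add_comm]
        refine V_mul (X_V a) (ih _ ?_)
        rintro l ⟨c, hc, hca⟩
        exact hf _ ⟨c, List.mem_cons_of_mem _ hc, hca⟩
    rw [← sub_eq_zero]
    apply V_all
    intro k
    apply gen
    rintro l ⟨c, hc, hca⟩
    exact cent c1 hc hca
  have hsF : s⁻¹ = mag (p (u⁻¹ * v)) := by
    ext1
    rw [← hP, e, Units.val_mul, map_mul, hPs', hPs, one_mul]
  have hrF : r = mag (v * (p (u⁻¹ * v))⁻¹) := by
    rw [map_mul, map_inv, ← hsF, inv_inv, hsdef]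
    group
  refine ⟨v * (p (u⁻¹ * v))⁻¹, ?_⟩
  ext1 x
  apply mag_inj
  rw [hr, hrF, MulAut.conj_apply]
  simp only [map_mul, map_inv]

end final

end Torelli

/-- The Torelli subgroup of `Out(Fₙ)` — the kernel of the natural
surjection `Out(Fₙ) → GL_n(ℤ)` induced by abelianization — is torsion-free.  An outer
automorphism lies in this kernel exactly when (any, equivalently every, one of) its
representative automorphisms acts trivially on the abelianization `H₁(Fₙ) ≅ ℤⁿ`.
The claim: any such outer automorphism of finite order is trivial. -/
theorem torelli_torsion_free (n : ℕ) (θ : MulAut (FreeGroup (Fin n)))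
    (hab : ∀ a : Abelianization (FreeGroup (Fin n)), abMap θ a = a)
    (hfin : IsOfFinOrder (toOut _ θ)) :
    toOut _ θ = 1 := by
  have hker : ∀ φ : MulAut (FreeGroup (Fin n)), toOut _ φ = 1 ↔ ∃ g, MulAut.conj g = φ := by
    intro φ
    exact QuotientGroup.eq_one_iff (N := (MulAut.conj : FreeGroup (Fin n) →* _).range) φ
  have hof : ∀ x, Abelianization.of (θ x) = Abelianization.of x := by
    intro x
    have := hab (Abelianization.of x)
    simpa [abMap] using this
  by_cases hn : 2 ≤ n
  · obtain ⟨m, hm, hp⟩ := isOfFinOrder_iff_pow_eq_one.1 hfin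
    rw [← map_pow, hker] at hp
    obtain ⟨h, hh⟩ := hp
    have hne : (⟨0, by omega⟩ : Fin n) ≠ ⟨1, by omega⟩ := by simp
    obtain ⟨g, hg⟩ := Torelli.main hne θ (by
      intro i j
      have := congrArg (Abelianization.lift (Torelli.lin j)) (hof (FreeGroup.of i))
      simp only [Abelianization.lift_apply_of] at this
      exact congrArg Multiplicative.toAdd this) hm hh.symm
    exact (hker θ).2 ⟨g, hg.symm⟩
  · have hcomm : ∀ x y : FreeGroup (Fin n), x * y = y * x := by
      have : n = 0 ∨ n = 1 := by omega
      rcases this with rfl | rfl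
      · intro x y
        exact Subsingleton.elim _ _
      · intro x y
        exact (IsCyclic.isMulCommutative (α := FreeGroup (Fin 1))).is_comm.comm x y
    have hinj : ∀ x, θ x = x := by
      let _ : CommGroup (FreeGroup (Fin n)) := { mul_comm := hcomm }
      intro x
      have := congrArg (Abelianization.lift (MonoidHom.id (FreeGroup (Fin n)))) (hof x)
      simpa using this
    have : θ = 1 := by ext1 x; exact hinj x
    rw [this, map_one]
end
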